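/- There is an absolute constant c > 0 such that for every measurable 2π-biperiodic f with ‖f‖_(Φ) < ∞ (where Φ(t) = t log⁺t) and every λ > 0, |{(x,y) ∈ 𝕋² : bmo[S_{nn}(x,y,f)] > λ}| ≤ c·‖f‖_(Φ)/λ. -/

import Mathlib

open MeasureTheory Filter Set

noncomputable section

/-- `[-π, π)`, a fundamental domain for the circle `𝕋 = ℝ/2πℤ`. -/
def T1 : Set ℝ := Set.Ico (-Real.pi) Real.pi

/-- `[-π, π)²`, a fundamental domain for the torus `𝕋²`. -/
def T2 : Set (ℝ × ℝ) := T1 ×ˢ T1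

/-- `log⁺ u = log u` for `u > 1`, and `0` otherwise. -/
def logPlus (u : ℝ) : ℝ := if 1 < u then Real.log u else 0

/-- `f` is `2π`-periodic in each variable. -/
def Biperiodic (f : ℝ × ℝ → ℝ) : Prop :=
  ∀ x y : ℝ, f (x + 2 * Real.pi, y) = f (x, y) ∧ f (x, y + 2 * Real.pi) = f (x, y)

/-- Fourier coefficients `f̂(m,n)` of a function on `𝕋²`. -/
def fourierCoef2 (f : ℝ × ℝ → ℝ) (m n : ℤ) : ℂ :=
  (1 / (4 * (Real.pi : ℂ) ^ 2)) *
    ∫ p in T2, (f p : ℂ) * Complex.exp (-Complex.I * ((m : ℂ) * (p.1 : ℂ) + (n : ℂ) * (p.2 : ℂ)))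

/-- Quadratic partial sums `S_{nn}(x, y, f)` of the double Fourier series.
(For real `f` the symmetric sum is real, so we take the real part.) -/
def Snn (f : ℝ × ℝ → ℝ) (n : ℕ) (x y : ℝ) : ℝ :=
  (∑ m ∈ Finset.Icc (-(n : ℤ)) (n : ℤ), ∑ k ∈ Finset.Icc (-(n : ℤ)) (n : ℤ),
    fourierCoef2 f m k * Complex.exp (Complex.I * ((m : ℂ) * (x : ℂ) + (k : ℂ) * (y : ℂ)))).re

/-- The `BMO[0,1]` norm:
`‖g‖_BMO = sup_{I ⊂ [0,1]} (1/|I|) ∫_I |g - g_I| + |∫_0^1 g|`. -/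
def bmoNorm (g : ℝ → ℝ) : ℝ :=
  (⨆ I : {p : ℝ × ℝ // 0 ≤ p.1 ∧ p.1 < p.2 ∧ p.2 ≤ 1},
      (I.1.2 - I.1.1)⁻¹ *
        ∫ t in Set.Icc I.1.1 I.1.2,
          |g t - (I.1.2 - I.1.1)⁻¹ * ∫ s in Set.Icc I.1.1 I.1.2, g s|) +
    |∫ t in Set.Icc (0 : ℝ) 1, g t|

/-- The step function `Σ_{k=0}^n ξ_k 𝟙_{δ_k^n}` with `δ_k^n = [k/(n+1), (k+1)/(n+1)]`. -/
def stepFun (ξ : ℕ → ℝ) (n : ℕ) (t : ℝ) : ℝ :=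
  ∑ k ∈ Finset.range (n + 1),
    Set.indicator (Set.Icc ((k : ℝ) / ((n : ℝ) + 1)) (((k : ℝ) + 1) / ((n : ℝ) + 1)))
      (fun _ => ξ k) t

/-- `bmo[ξ_n] = sup_{n ≥ 0} ‖Σ_{k=0}^n ξ_k 𝟙_{δ_k^n}‖_BMO`. -/
def bmoSeq (ξ : ℕ → ℝ) : ℝ := ⨆ n : ℕ, bmoNorm (stepFun ξ n)

/-- `L` is the principal value `p.v. ∫_𝕋 g`, i.e. the limit as `ε → 0⁺` of the
integrals over `{ε < |t| < π}`. -/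
def pvT1 (g : ℝ → ℝ) (L : ℝ) : Prop :=
  Filter.Tendsto (fun ε : ℝ => ∫ t in {t : ℝ | ε < |t| ∧ |t| < Real.pi}, g t)
    (nhdsWithin 0 (Set.Ioi 0)) (nhds L)

/-- `L` is the two-dimensional principal value `p.v. ∬_{𝕋²} g`, the limit as `ε → 0⁺`
of the integrals over `{ε < |t| < π, ε < |s| < π}`. -/
def pvT2 (g : ℝ × ℝ → ℝ) (L : ℝ) : Prop :=
  Filter.Tendsto
    (fun ε : ℝ =>
      ∫ q in {q : ℝ × ℝ | (ε < |q.1| ∧ |q.1| < Real.pi) ∧ ε < |q.2| ∧ |q.2| < Real.pi}, g q)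
    (nhdsWithin 0 (Set.Ioi 0)) (nhds L)

/-- Luxemburg norm with respect to a Young function `M`. -/
def luxNorm {α : Type*} [MeasurableSpace α] (μ : Measure α) (M : ℝ → ℝ) (g : α → ℝ) : ℝ :=
  sInf {lam : ℝ | 0 < lam ∧ ∫⁻ x, ENNReal.ofReal (M (|g x| / lam)) ∂μ ≤ 1}

/-- The Young function `Φ(t) = t log⁺ t`. -/
def PhiY (t : ℝ) : ℝ := t * logPlus t

/-- The Young function `Ψ(t) = eᵗ - 1`. -/
def PsiY (t : ℝ) : ℝ := Real.exp t - 1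

lemma two_pi_pos' : (0:ℝ) < 2 * Real.pi := by positivity

lemma measurableSet_T1 : MeasurableSet T1 := measurableSet_Ico

lemma restrict_T1 : (volume.restrict T1 : Measure ℝ) =
    volume.restrict (Ioc (-Real.pi) (-Real.pi + 2 * Real.pi)) := by
  have : -Real.pi + 2 * Real.pi = Real.pi := by ring
  rw [this]
  exact Measure.restrict_congr_set Ico_ae_eq_Ioc

lemma volume_T1 : volume T1 = ENNReal.ofReal (2 * Real.pi) := by
  rw [T1, Real.volume_Ico]; congr 1; ring

lemma restrict_T2 : (volume.restrict T2 : Measure (ℝ × ℝ)) =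
    (volume.restrict T1).prod (volume.restrict T1) := by
  rw [Measure.prod_restrict]; rfl

lemma per_Ioc (w : ℝ → ENNReal) (hw : Function.Periodic w (2 * Real.pi)) (a b : ℝ) :
    ∫⁻ x in Ioc a (a + 2 * Real.pi), w x = ∫⁻ x in Ioc b (b + 2 * Real.pi), w x := by
  have : VAddInvariantMeasure (AddSubgroup.zmultiples (2 * Real.pi)) ℝ volume :=
    ⟨fun c s _ => measure_preimage_add _ _ _⟩
  exact IsAddFundamentalDomain.setLIntegral_eq (G := AddSubgroup.zmultiples (2 * Real.pi))
    (isAddFundamentalDomain_Ioc two_pi_pos' a volume)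
    (isAddFundamentalDomain_Ioc two_pi_pos' b volume) w hw.map_vadd_zmultiples

lemma per_shift (w : ℝ → ENNReal) (hw : Function.Periodic w (2 * Real.pi)) (c : ℝ) :
    ∫⁻ x in T1, w (x + c) = ∫⁻ x in T1, w x := by
  rw [restrict_T1]
  have h1 : ∫⁻ x in Ioc (-Real.pi) (-Real.pi + 2 * Real.pi), w (x + c)
      = ∫⁻ x in Ioc (-Real.pi + c) (-Real.pi + c + 2 * Real.pi), w x := by
    have hmp := (measurePreserving_add_right (volume : Measure ℝ) c)
    have := hmp.setLIntegral_comp_emb (MeasurableEquiv.addRight c).measurableEmbedding w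
      (Ioc (-Real.pi) (-Real.pi + 2 * Real.pi))
    rw [this]
    congr 2
    simp only [image_add_const_Ioc]
    congr 1; ring
  rw [h1]
  exact per_Ioc w hw _ _

lemma per_reflect (w : ℝ → ENNReal) (hw : Function.Periodic w (2 * Real.pi)) (c : ℝ) :
    ∫⁻ x in T1, w (c - x) = ∫⁻ x in T1, w x := by
  have h1 : ∫⁻ x in T1, w (c - x) = ∫⁻ x in Ioc (-Real.pi) Real.pi, w (x + c) := by
    have hmp := (Measure.measurePreserving_neg (volume : Measure ℝ))
    have := hmp.setLIntegral_comp_emb (MeasurableEquiv.neg ℝ).measurableEmbedding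
      (fun x => w (x + c)) T1
    have h2 : Neg.neg '' T1 = Ioc (-Real.pi) Real.pi := by
      rw [T1, image_neg_Ico]; simp
    rw [h2] at this
    rw [← this]
    congr 1; ext x; congr 1; ring
  rw [h1, ← per_shift w hw c]
  rw [T1]
  exact congrArg (fun m => ∫⁻ x, w (x + c) ∂m) (Measure.restrict_congr_set Ico_ae_eq_Ioc).symm

lemma per2_shift (G : ℝ × ℝ → ENNReal) (hG : Measurable G)
    (hx : ∀ x y, G (x + 2 * Real.pi, y) = G (x, y)) (hy : ∀ x y, G (x, y + 2 * Real.pi) = G (x, y))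
    (c d : ℝ) : ∫⁻ p in T2, G (p.1 + c, p.2 + d) = ∫⁻ p in T2, G p := by
  rw [restrict_T2, lintegral_prod _ (by fun_prop), lintegral_prod _ (by fun_prop)]
  have h1 : ∀ x, ∫⁻ y in T1, G (x + c, y + d) = ∫⁻ y in T1, G (x + c, y) := fun x =>
    per_shift (fun y => G (x + c, y)) (fun y => hy _ _) d
  simp only [h1]
  exact per_shift (fun x => ∫⁻ y in T1, G (x, y)) (fun x => by simp only [hx]) c

lemma transfer (G : ℝ × ℝ → ENNReal) (hG : Measurable G)
    (hx : ∀ x y, G (x + 2 * Real.pi, y) = G (x, y)) (hy : ∀ x y, G (x, y + 2 * Real.pi) = G (x, y))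
    (a b : ℝ) : ∫⁻ p in T2, ∫⁻ t in T1, G (p.1 + a * t, p.2 + b * t)
      = ENNReal.ofReal (2 * Real.pi) * ∫⁻ p in T2, G p := by
  rw [lintegral_lintegral_swap (by fun_prop)]
  simp only [fun t : ℝ => per2_shift G hG hx hy (a * t) (b * t)]
  rw [lintegral_const, Measure.restrict_apply_univ, volume_T1, mul_comm]

/-- super-level set of the (centered) maximal function -/
def Om (w : ℝ → ENNReal) (lam : ℝ) : Set ℝ :=
  {x | ∃ r > 0, ENNReal.ofReal (2 * r * lam) < ∫⁻ y in Metric.closedBall x r, w y}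

lemma per_Ioc_T1 (w : ℝ → ENNReal) (hw : Function.Periodic w (2 * Real.pi)) (a : ℝ) :
    ∫⁻ x in Ioc a (a + 2 * Real.pi), w x = ∫⁻ x in T1, w x := by
  rw [restrict_T1]; exact per_Ioc w hw _ _

lemma per_Ioc_n (w : ℝ → ENNReal) (hw : Function.Periodic w (2 * Real.pi)) (a : ℝ) (n : ℕ) :
    ∫⁻ x in Ioc a (a + n * (2 * Real.pi)), w x ≤ n * ∫⁻ x in T1, w x := by
  induction n with
  | zero => simp
  | succ n ih =>
    have h : Ioc a (a + (n + 1 : ℕ) * (2 * Real.pi)) ⊆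
        Ioc a (a + n * (2 * Real.pi)) ∪
          Ioc (a + n * (2 * Real.pi)) (a + n * (2 * Real.pi) + 2 * Real.pi) := by
      intro x hx
      simp only [mem_union, mem_Ioc, Nat.cast_add, Nat.cast_one] at *
      by_cases h : x ≤ a + n * (2 * Real.pi)
      · left; exact ⟨hx.1, h⟩
      · right; push Not at h; exact ⟨h, by linarith [hx.2]⟩
    calc _ ≤ _ := lintegral_mono_set h
      _ ≤ _ := lintegral_union_le _ _ _
      _ ≤ n * (∫⁻ x in T1, w x) + (∫⁻ x in T1, w x) := by
        exact add_le_add ih (per_Ioc_T1 w hw _).le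
      _ = _ := by push_cast; rw [add_mul, one_mul]

lemma large_ball (w : ℝ → ENNReal) (hw : Function.Periodic w (2 * Real.pi)) (x r : ℝ)
    (hr : Real.pi ≤ r) :
    ∫⁻ y in Metric.closedBall x r, w y ≤ ENNReal.ofReal (2 * r / Real.pi) * ∫⁻ y in T1, w y := by
  have hpi := Real.pi_pos
  set n := ⌈r / Real.pi⌉₊
  have h1 : r / Real.pi ≤ n := Nat.le_ceil _
  have h2 : (n : ℝ) < r / Real.pi + 1 := Nat.ceil_lt_add_one (div_nonneg (hpi.le.trans hr) hpi.le)
  have h3 : 1 ≤ r / Real.pi := by rwa [le_div_iff₀ hpi, one_mul]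
  have h4 : r ≤ n * Real.pi := by rwa [div_le_iff₀ hpi] at h1
  calc ∫⁻ y in Metric.closedBall x r, w y = ∫⁻ y in Ioc (x - r) (x + r), w y := by
        rw [Real.closedBall_eq_Icc, Measure.restrict_congr_set Ioc_ae_eq_Icc.symm]
    _ ≤ ∫⁻ y in Ioc (x - r) (x - r + n * (2 * Real.pi)), w y :=
        lintegral_mono_set (Ioc_subset_Ioc_right (by linarith))
    _ ≤ n * ∫⁻ x in T1, w x := per_Ioc_n w hw _ n
    _ ≤ _ := by
        gcongr
        rw [← ENNReal.ofReal_natCast]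
        apply ENNReal.ofReal_le_ofReal
        have : 2 * r / Real.pi = 2 * (r / Real.pi) := by ring
        linarith

lemma HL_weak (w : ℝ → ENNReal) (hw : Function.Periodic w (2 * Real.pi))
    (lam : ℝ) (hlam : 0 < lam) :
    ENNReal.ofReal lam * volume (T1 ∩ Om w lam) ≤ 10 * ∫⁻ x in T1, w x := by
  have hpi := Real.pi_pos
  set I := ∫⁻ x in T1, w x with hI
  by_cases hc : ENNReal.ofReal (Real.pi * lam) ≤ I
  · calc ENNReal.ofReal lam * volume (T1 ∩ Om w lam) ≤ ENNReal.ofReal lam * volume T1 := by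
          gcongr; exact inter_subset_left
      _ = 2 * ENNReal.ofReal (Real.pi * lam) := by
          rw [volume_T1, ← ENNReal.ofReal_mul hlam.le, ← ENNReal.ofReal_ofNat,
            ← ENNReal.ofReal_mul (by norm_num)]
          congr 1; ring
      _ ≤ 2 * I := by gcongr
      _ ≤ 10 * I := by gcongr; norm_num
  push Not at hc
  have hex : ∀ x : (T1 ∩ Om w lam : Set ℝ), ∃ r > 0, r < Real.pi ∧
      ENNReal.ofReal (2 * r * lam) < ∫⁻ y in Metric.closedBall x.1 r, w y := by
    rintro ⟨x, hx, r, hr, h⟩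
    refine ⟨r, hr, ?_, h⟩
    by_contra hcon
    push Not at hcon
    have h1 := h.trans_le (large_ball w hw x r hcon)
    have h2 : ENNReal.ofReal (2 * r / Real.pi) * I ≤
        ENNReal.ofReal (2 * r / Real.pi) * ENNReal.ofReal (Real.pi * lam) := by gcongr
    rw [← ENNReal.ofReal_mul (by positivity)] at h2
    have h3 : 2 * r / Real.pi * (Real.pi * lam) = 2 * r * lam := by field_simp
    rw [h3] at h2
    exact absurd (h1.trans_le h2) (lt_irrefl _)
  choose r hr0 hrpi hrw using hex
  obtain ⟨u, -, hdisj, hcov⟩ := Vitali.exists_disjoint_subfamily_covering_enlargement_closedBall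
    (univ : Set (T1 ∩ Om w lam : Set ℝ)) (fun x => x.1) r Real.pi (fun a _ => (hrpi a).le) 5 (by norm_num)
  have hucount : u.Countable := by
    apply hdisj.countable_of_nonempty_interior
    intro a _
    refine ⟨a.1, ?_⟩
    exact Metric.ball_subset_interior_closedBall (Metric.mem_ball_self (hr0 a))
  have hsub : T1 ∩ Om w lam ⊆ ⋃ a ∈ u, Metric.closedBall a.1 (5 * r a) := by
    intro x hx
    obtain ⟨b, hb, hb2⟩ := hcov ⟨x, hx⟩ (mem_univ _)
    exact mem_biUnion hb (hb2 (Metric.mem_closedBall_self (hr0 _).le))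
  have : Countable u := hucount
  have hbig : ⋃ a ∈ u, Metric.closedBall a.1 (r a) ⊆
      Icc (-2 * Real.pi) (2 * Real.pi) := by
    apply iUnion₂_subset
    intro a _ y hy
    rw [Real.closedBall_eq_Icc, mem_Icc] at hy
    have ha := a.2.1
    simp only [T1, mem_Ico] at ha
    have := hrpi a
    constructor <;> linarith [hy.1, hy.2]
  calc ENNReal.ofReal lam * volume (T1 ∩ Om w lam)
      ≤ ENNReal.ofReal lam * ∑' a : u, volume (Metric.closedBall a.1.1 (5 * r a.1)) := by
        gcongr
        exact (measure_mono hsub).trans (measure_biUnion_le _ hucount _)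
    _ = ∑' a : u, 5 * ENNReal.ofReal (2 * r a.1 * lam) := by
        rw [← ENNReal.tsum_mul_left]
        congr 1; ext a
        rw [Real.volume_closedBall, ← ENNReal.ofReal_mul hlam.le, ← ENNReal.ofReal_ofNat,
            ← ENNReal.ofReal_mul (by norm_num)]
        congr 1; ring
    _ ≤ ∑' a : u, 5 * ∫⁻ y in Metric.closedBall a.1.1 (r a.1), w y := by
        gcongr with a
        exact (hrw a.1).le
    _ = 5 * ∫⁻ y in ⋃ a ∈ u, Metric.closedBall a.1 (r a), w y := by
        rw [ENNReal.tsum_mul_left, lintegral_biUnion hucount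
          (fun a _ => Metric.isClosed_closedBall.measurableSet) hdisj]
    _ ≤ 5 * ∫⁻ y in Icc (-2 * Real.pi) (2 * Real.pi), w y := by
        gcongr
    _ = 5 * ∫⁻ y in Ioc (-2 * Real.pi) (-2 * Real.pi + (2:ℕ) * (2 * Real.pi)), w y := by
        rw [Measure.restrict_congr_set Ioc_ae_eq_Icc.symm]
        congr 4; push_cast; ring_nf
    _ ≤ 5 * ((2:ℕ) * I) := by gcongr; exact per_Ioc_n w hw _ 2
    _ = 10 * I := by push_cast; rw [← mul_assoc]; norm_num

lemma Om_periodic (w : ℝ → ENNReal) (hw : Function.Periodic w (2 * Real.pi)) (lam x : ℝ) :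
    x + 2 * Real.pi ∈ Om w lam ↔ x ∈ Om w lam := by
  have h : ∀ r, ∫⁻ y in Metric.closedBall (x + 2 * Real.pi) r, w y
      = ∫⁻ y in Metric.closedBall x r, w y := by
    intro r
    have hmp := (measurePreserving_add_right (volume : Measure ℝ) (2 * Real.pi))
    have := hmp.setLIntegral_comp_emb
      (MeasurableEquiv.addRight (2 * Real.pi)).measurableEmbedding w (Metric.closedBall x r)
    simp only [hw _] at this
    rw [this]
    congr 2
    simp only [Real.closedBall_eq_Icc, image_add_const_Icc]
    congr 1 <;> ring
  simp only [Om, mem_ofPred_eq, h]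

/-- ball averages near the complement -/
lemma ball_le_infDist (w : ℝ → ENNReal) (lam : ℝ) (hlam : 0 < lam) (hne : (Om w lam)ᶜ.Nonempty)
    (y r : ℝ) (hr : 0 < r) :
    ∫⁻ z in Metric.closedBall y r, w z
      ≤ ENNReal.ofReal (2 * lam * (r + Metric.infDist y (Om w lam)ᶜ)) := by
  apply le_of_forall_gt_imp_ge_of_dense
  intro b hb
  by_cases hbt : b = ⊤
  · rw [hbt]; exact le_top
  set d := Metric.infDist y (Om w lam)ᶜ
  have hd : 0 ≤ d := Metric.infDist_nonneg
  have h1 : 2 * lam * (r + d) < b.toReal := by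
    rwa [ENNReal.ofReal_lt_iff_lt_toReal (by positivity) hbt] at hb
  have h2 : d < b.toReal / (2 * lam) - r := by
    rw [lt_sub_iff_add_lt, lt_div_iff₀ (by positivity)]; linarith
  obtain ⟨z, hz, hzd⟩ := (Metric.infDist_lt_iff hne).1 h2
  have h3 : ∫⁻ z in Metric.closedBall y r, w z ≤ ∫⁻ x in Metric.closedBall z (r + dist y z), w x := by
    apply lintegral_mono_set
    exact Metric.closedBall_subset_closedBall' le_rfl
  have h4 : ¬ (z ∈ Om w lam) := hz
  simp only [Om, mem_ofPred_eq, not_exists, not_and, not_lt] at h4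
  refine h3.trans ((h4 (r + dist y z) (by positivity)).trans ?_)
  rw [← ENNReal.ofReal_toReal hbt]
  apply ENNReal.ofReal_le_ofReal
  have : r + dist y z < b.toReal / (2 * lam) := by linarith
  rw [lt_div_iff₀ (by positivity)] at this
  linarith

lemma tail2 (h : ℝ) (hh : 0 < h) :
    ∫⁻ r in Ioi h, ENNReal.ofReal (1 / r ^ 2) = ENNReal.ofReal (1 / h) := by
  have h1 := integral_Ioi_rpow_of_lt (a := -2) (by norm_num) hh
  have h2 := integrableOn_Ioi_rpow_of_lt (a := -2) (by norm_num) hh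
  have h3 := ofReal_integral_eq_lintegral_ofReal h2 ((ae_restrict_iff' measurableSet_Ioi).2
    (Eventually.of_forall fun x (hx : h < x) => Real.rpow_nonneg (hh.trans hx).le _))
  rw [h1] at h3
  have h4 : -h ^ ((-2:ℝ) + 1) / (-2 + 1) = 1 / h := by
    norm_num [Real.rpow_neg_one]
  rw [h4] at h3
  rw [h3]
  apply setLIntegral_congr_fun measurableSet_Ioi
  intro x hx
  have hx : h < x := hx
  simp only
  rw [Real.rpow_neg (hh.trans hx).le]
  norm_num

lemma tail3 (h : ℝ) (hh : 0 < h) :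
    ∫⁻ r in Ioi h, ENNReal.ofReal (2 / r ^ 3) = ENNReal.ofReal (1 / h ^ 2) := by
  have h1 := integral_Ioi_rpow_of_lt (a := -3) (by norm_num) hh
  have h2 := integrableOn_Ioi_rpow_of_lt (a := -3) (by norm_num) hh
  have h3 := ofReal_integral_eq_lintegral_ofReal (h2.const_mul 2) ((ae_restrict_iff' measurableSet_Ioi).2
    (Eventually.of_forall fun x (hx : h < x) => mul_nonneg (by norm_num)
      (Real.rpow_nonneg (hh.trans hx).le _)))
  rw [integral_const_mul, h1] at h3
  have h4 : 2 * (-h ^ ((-3:ℝ) + 1) / (-3 + 1)) = 1 / h ^ 2 := by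
    have : h ^ ((-3:ℝ) + 1) = (h ^ 2)⁻¹ := by
      rw [show ((-3:ℝ) + 1) = -(2:ℕ) by norm_num, Real.rpow_neg hh.le, Real.rpow_natCast]
    rw [this]; field_simp; norm_num
  rw [h4] at h3
  rw [h3]
  apply setLIntegral_congr_fun measurableSet_Ioi
  intro x hx
  have hx : h < x := hx
  simp only
  rw [show ((-3:ℝ)) = -(3:ℕ) by norm_num, Real.rpow_neg (hh.trans hx).le, Real.rpow_natCast]
  rfl

lemma PK (w : ℝ → ENNReal) (hw : Measurable w) (y h lam d : ℝ) (hh : 0 < h) (hlam : 0 < lam)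
    (hd : 0 ≤ d)
    (H : ∀ r > 0, ∫⁻ z in Metric.closedBall y r, w z ≤ ENNReal.ofReal (2 * lam * (r + d))) :
    ∫⁻ v, w (y + v) * ENNReal.ofReal (1 / (max h |v|) ^ 2)
      ≤ ENNReal.ofReal (lam * (4 / h + 2 * d / h ^ 2)) := by
  have hmeas : Measurable (fun q : ℝ × ℝ => (Ioi (|q.1|)).indicator
      (fun r => w (y + q.1) * ENNReal.ofReal (2 / r ^ 3)) q.2) := by
    have : (fun q : ℝ × ℝ => (Ioi (|q.1|)).indicator
      (fun r => w (y + q.1) * ENNReal.ofReal (2 / r ^ 3)) q.2) =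
      {q : ℝ × ℝ | |q.1| < q.2}.indicator (fun q => w (y + q.1) * ENNReal.ofReal (2 / q.2 ^ 3)) := by
      ext q; simp [indicator]
    rw [this]
    apply Measurable.indicator
    · fun_prop
    · exact measurableSet_lt (by fun_prop) (by fun_prop)
  calc ∫⁻ v, w (y + v) * ENNReal.ofReal (1 / (max h |v|) ^ 2)
      = ∫⁻ v, ∫⁻ r in Ioi h, (Ioi (|v|)).indicator
          (fun r => w (y + v) * ENNReal.ofReal (2 / r ^ 3)) r := by
        congr 1; ext v
        rw [setLIntegral_indicator measurableSet_Ioi, lintegral_const_mul _ (by fun_prop),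
          Ioi_inter_Ioi, max_comm, tail3 _ (lt_max_of_lt_right hh)]
    _ = ∫⁻ r in Ioi h, ∫⁻ v, (Ioi (|v|)).indicator
          (fun r => w (y + v) * ENNReal.ofReal (2 / r ^ 3)) r := by
        rw [lintegral_lintegral_swap hmeas.aemeasurable]
    _ ≤ ∫⁻ r in Ioi h, ENNReal.ofReal (2 * lam * (2 * (1 / r ^ 2) + d * (2 / r ^ 3))) := by
        apply setLIntegral_mono' measurableSet_Ioi
        intro r hr
        have hr : h < r := hr
        have hr0 := hh.trans hr
        calc ∫⁻ v, (Ioi (|v|)).indicator (fun r => w (y + v) * ENNReal.ofReal (2 / r ^ 3)) r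
            ≤ ∫⁻ v in Metric.closedBall 0 r, w (y + v) * ENNReal.ofReal (2 / r ^ 3) := by
              rw [← lintegral_indicator Metric.isClosed_closedBall.measurableSet]
              apply lintegral_mono
              intro v
              simp only [indicator, mem_Ioi, Metric.mem_closedBall, dist_zero_right, Real.norm_eq_abs]
              by_cases hv : |v| < r
              · simp [hv, hv.le]
              · simp [hv]
          _ = (∫⁻ z in Metric.closedBall y r, w z) * ENNReal.ofReal (2 / r ^ 3) := by
              rw [lintegral_mul_const _ (by fun_prop)]
              congr 1
              have hmp := (measurePreserving_add_left (volume : Measure ℝ) y)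
              have := hmp.setLIntegral_comp_emb
                (MeasurableEquiv.addLeft y).measurableEmbedding w (Metric.closedBall 0 r)
              rw [this]
              congr 2
              simp only [Real.closedBall_eq_Icc, image_const_add_Icc]
              congr 1 <;> ring
          _ ≤ ENNReal.ofReal (2 * lam * (r + d)) * ENNReal.ofReal (2 / r ^ 3) := by
              gcongr; exact H r hr0
          _ = _ := by
              rw [← ENNReal.ofReal_mul (by positivity)]
              congr 1; field_simp
    _ = ENNReal.ofReal (2 * lam) * (2 * ENNReal.ofReal (1 / h) + ENNReal.ofReal d * ENNReal.ofReal (1 / h ^ 2)) := by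
        rw [← tail2 h hh, ← tail3 h hh, ← lintegral_const_mul _ (by fun_prop),
          ← lintegral_const_mul _ (by fun_prop), ← lintegral_add_left (by fun_prop),
          ← lintegral_const_mul _ (by fun_prop)]
        apply setLIntegral_congr_fun measurableSet_Ioi
        intro r hr
        have hr : h < r := hr
        have hr0 := hh.trans hr
        simp only
        rw [← ENNReal.ofReal_ofNat 2, ← ENNReal.ofReal_mul (by positivity),
          ← ENNReal.ofReal_mul (by positivity), ← ENNReal.ofReal_add (by positivity) (by positivity),
          ← ENNReal.ofReal_mul (by positivity)]
    _ = _ := by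
        rw [← ENNReal.ofReal_ofNat 2, ← ENNReal.ofReal_mul (by positivity),
          ← ENNReal.ofReal_mul (by positivity), ← ENNReal.ofReal_add (by positivity) (by positivity),
          ← ENNReal.ofReal_mul (by positivity)]
        congr 1; ring

/-- unnormalised exponential -/
def ex (k : ℤ) (u : ℝ) : ℂ := Complex.exp (Complex.I * ((k : ℂ) * (u : ℂ)))

lemma ex_continuous (k : ℤ) : Continuous (ex k) := by unfold ex; fun_prop

lemma ex_norm (k : ℤ) (u : ℝ) : ‖ex k u‖ = 1 := by
  unfold ex
  rw [mul_comm, show (k : ℂ) * (u : ℂ) = ((k * u : ℝ) : ℂ) by push_cast; ring]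
  exact Complex.norm_exp_ofReal_mul_I _

lemma ex_add (k l : ℤ) (u : ℝ) : ex (k + l) u = ex k u * ex l u := by
  unfold ex; rw [← Complex.exp_add]; congr 1; push_cast; ring

lemma ex_add' (k : ℤ) (u v : ℝ) : ex k (u + v) = ex k u * ex k v := by
  unfold ex; rw [← Complex.exp_add]; congr 1; push_cast; ring

lemma ex_conj (k : ℤ) (u : ℝ) : (starRingEnd ℂ) (ex k u) = ex (-k) u := by
  unfold ex; rw [← Complex.exp_conj]; congr 1
  simp

lemma ex_neg (k : ℤ) (u : ℝ) : ex k (-u) = ex (-k) u := by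
  unfold ex; congr 1; push_cast; ring

lemma ex_sub' (k : ℤ) (u v : ℝ) : ex k (u - v) = ex k u * (starRingEnd ℂ) (ex k v) := by
  rw [sub_eq_add_neg, ex_add', ex_neg, ex_conj]

lemma ex_zero (u : ℝ) : ex 0 u = 1 := by simp [ex]

lemma ex_periodic (k : ℤ) (u : ℝ) : ex k (u + 2 * Real.pi) = ex k u := by
  rw [ex_add']
  have : ex k (2 * Real.pi) = 1 := by
    unfold ex
    rw [Complex.exp_eq_one_iff]
    exact ⟨k, by push_cast; ring⟩
  rw [this, mul_one]

/-- geometric sum -/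
def DD (M : ℕ) (u : ℝ) : ℂ := ∑ p ∈ Finset.range M, ex p u

lemma DD_continuous (M : ℕ) : Continuous (DD M) := by
  unfold DD; exact continuous_finsetSum _ fun i _ => ex_continuous _

lemma DD_periodic (M : ℕ) (u : ℝ) : DD M (u + 2 * Real.pi) = DD M u := by
  simp [DD, ex_periodic]

lemma DD_conj (M : ℕ) (u : ℝ) : (starRingEnd ℂ) (DD M u) = DD M (-u) := by
  simp [DD, ex_conj, ex_neg]

lemma DD_norm_neg (M : ℕ) (u : ℝ) : ‖DD M (-u)‖ = ‖DD M u‖ := by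
  rw [← DD_conj, RCLike.norm_conj]

lemma DD_norm_le (M : ℕ) (u : ℝ) : ‖DD M u‖ ≤ M := by
  refine (norm_sum_le _ _).trans ?_
  simp [ex_norm]

lemma sin_half_lower (u : ℝ) (hu : |u| ≤ Real.pi) : |u| / Real.pi ≤ |Real.sin (u / 2)| := by
  have h1 := Real.mul_le_sin (x := |u| / 2) (by positivity) (by linarith)
  have h2 : |Real.sin (u / 2)| = |Real.sin (|u| / 2)| := by
    rcases abs_cases u with h | h
    · rw [h.1]
    · rw [h.1, show -u / 2 = -(u / 2) by ring, Real.sin_neg, abs_neg]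
  rw [h2]
  refine le_trans ?_ (le_abs_self _)
  refine le_trans (le_of_eq ?_) h1
  field_simp

lemma DD_mul_sin (M : ℕ) (u : ℝ) : ‖DD M u‖ * |Real.sin (u / 2)| ≤ 1 := by
  have h1 : DD M u * (ex 1 u - 1) = ex M u - 1 := by
    have : ∀ p : ℕ, ex p u = (ex 1 u) ^ p := by
      intro p
      unfold ex; rw [← Complex.exp_nat_mul]; congr 1; push_cast; ring
    unfold DD
    simp only [this]
    exact geom_sum_mul _ _
  have h2 : ‖ex 1 u - 1‖ = 2 * |Real.sin (u / 2)| := by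
    have := Complex.norm_exp_I_mul_ofReal_sub_one u
    unfold ex
    simp only [Int.cast_one, one_mul]
    rw [this, norm_mul]; simp
  have h3 : ‖ex M u - 1‖ ≤ 2 := (norm_sub_le _ _).trans (by rw [ex_norm]; norm_num)
  have h4 := congrArg norm h1
  rw [norm_mul, h2] at h4
  nlinarith

lemma DD_bound (N : ℕ) (hN : 1 ≤ N) (u : ℝ) (hu : |u| ≤ Real.pi) :
    ‖DD (2 * N) u‖ ^ 2 ≤ Real.pi ^ 2 * (1 / (max (1 / (N:ℝ)) |u|) ^ 2) := by
  have hpi := Real.pi_pos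
  have hN' : (0:ℝ) < N := by exact_mod_cast hN
  have hm : 0 < max (1 / (N:ℝ)) |u| := lt_max_of_lt_left (by positivity)
  have key : ‖DD (2 * N) u‖ * max (1 / (N:ℝ)) |u| ≤ Real.pi := by
    rcases max_choice (1 / (N:ℝ)) |u| with h | h
    · rw [h]
      have := DD_norm_le (2 * N) u
      push_cast at this
      calc _ ≤ (2 * N) * (1 / (N:ℝ)) := by gcongr
        _ = 2 := by field_simp
        _ ≤ _ := Real.two_le_pi
    · rw [h]
      have h1 := DD_mul_sin (2 * N) u
      have h2 := sin_half_lower u hu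
      rw [div_le_iff₀ hpi] at h2
      calc _ ≤ ‖DD (2 * N) u‖ * (|Real.sin (u / 2)| * Real.pi) := by gcongr
        _ = (‖DD (2 * N) u‖ * |Real.sin (u / 2)|) * Real.pi := by ring
        _ ≤ 1 * Real.pi := by gcongr
        _ = _ := one_mul _
  rw [mul_one_div, le_div_iff₀ (by positivity), ← mul_pow]
  gcongr

/-- Fourier-type integral -/
def Gh (G : ℝ → ℂ) (k : ℤ) : ℂ := ∫ u in T1, G u * ex k u

lemma Gh_int (G : ℝ → ℂ) (hG : IntegrableOn G T1) (k : ℤ) :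
    IntegrableOn (fun u => G u * ex k u) T1 := by
  apply Integrable.mul_bdd (c := 1) hG (ex_continuous k).aestronglyMeasurable
  exact Eventually.of_forall fun x => (ex_norm k x).le

lemma L2_lemma (G : ℝ → ℂ) (hG : IntegrableOn G T1) (a : ℤ) (N : ℕ) :
    ENNReal.ofReal (N * ∑ j ∈ Finset.range N, ‖Gh G (a + j)‖ ^ 2) ≤
      ∫⁻ q, ‖G q.1‖ₑ * ‖G q.2‖ₑ * ENNReal.ofReal (‖DD (2 * N) (q.1 - q.2)‖ ^ 2)
        ∂((volume.restrict T1).prod (volume.restrict T1)) := by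
  set μ := (volume.restrict T1 : Measure ℝ)
  set X : ℝ := ∑ p ∈ Finset.range (2 * N), ∑ q ∈ Finset.range (2 * N), ‖Gh G (a + p - q)‖ ^ 2
  have hX0 : 0 ≤ X := by positivity
  have h1 : N * ∑ j ∈ Finset.range N, ‖Gh G (a + j)‖ ^ 2 ≤ X := by
    have : N * ∑ j ∈ Finset.range N, ‖Gh G (a + j)‖ ^ 2 =
        ∑ q ∈ Finset.range N, ∑ j ∈ Finset.range N, ‖Gh G (a + (j + q : ℕ) - q)‖ ^ 2 := by
      have hc : ∀ q j : ℕ, (a + ((j + q : ℕ) : ℤ) - q) = a + j := by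
        intro q j; push_cast; ring
      simp only [hc, Finset.sum_const, Finset.card_range, nsmul_eq_mul]
    rw [this]
    have hXc : X = ∑ q ∈ Finset.range (2 * N), ∑ p ∈ Finset.range (2 * N), ‖Gh G (a + p - q)‖ ^ 2 :=
      Finset.sum_comm
    rw [hXc]
    calc _ ≤ ∑ q ∈ Finset.range N, ∑ p ∈ Finset.range (2 * N), ‖Gh G (a + p - q)‖ ^ 2 := by
          apply Finset.sum_le_sum
          intro q hq
          rw [Finset.mem_range] at hq
          rw [← Finset.sum_image (s := Finset.range N) (g := fun j => j + q)
            (f := fun p : ℕ => ‖Gh G (a + p - q)‖ ^ 2) (by intro x _ y _; simp)]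
          apply Finset.sum_le_sum_of_subset_of_nonneg
          · intro p hp
            simp only [Finset.mem_image, Finset.mem_range] at *
            omega
          · intros; positivity
      _ ≤ _ := by
          apply Finset.sum_le_sum_of_subset_of_nonneg
          · intro p hp
            simp only [Finset.mem_range] at *
            omega
          · intros; positivity
  have h2 : (X : ℂ) = ∫ q, G q.1 * (starRingEnd ℂ) (G q.2) * (ex a (q.1 - q.2) *
      (DD (2 * N) (q.1 - q.2) * (starRingEnd ℂ) (DD (2 * N) (q.1 - q.2)))) ∂(μ.prod μ) := by
    have hk : ∀ k : ℤ, ((‖Gh G k‖ ^ 2 : ℝ) : ℂ) =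
        ∫ q, (G q.1 * ex k q.1) * (starRingEnd ℂ) (G q.2 * ex k q.2) ∂(μ.prod μ) := by
      intro k
      rw [integral_prod_mul (μ := μ) (ν := μ) (fun u => G u * ex k u)
        (fun u => (starRingEnd ℂ) (G u * ex k u)), integral_conj]
      push_cast
      rw [← Complex.mul_conj']
      rfl
    have hki : ∀ k : ℤ, Integrable (fun q : ℝ × ℝ => (G q.1 * ex k q.1) *
        (starRingEnd ℂ) (G q.2 * ex k q.2)) (μ.prod μ) := by
      intro k
      apply Integrable.mul_prod (Gh_int G hG k) (f := fun u => G u * ex k u)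
        (g := fun u => (starRingEnd ℂ) (G u * ex k u))
      exact (Complex.conjLIE.toContinuousLinearEquiv.toContinuousLinearMap).integrable_comp (Gh_int G hG k)
    simp only [X]
    push_cast
    simp only [← Complex.ofReal_pow, hk]
    simp only [← integral_finsetSum _ (fun q _ => hki _)]
    rw [← integral_finsetSum _ (fun p _ => integrable_finsetSum _ (fun q _ => hki _))]
    congr 1; ext q
    simp only [DD, map_sum]
    rw [Finset.sum_mul_sum]
    simp only [Finset.mul_sum]
    apply Finset.sum_congr rfl; intro i _
    apply Finset.sum_congr rfl; intro j _
    rw [map_mul, ex_sub', ex_sub', ex_sub', map_mul, sub_eq_add_neg, ex_add, ex_add, ex_add, ex_add, map_mul, map_mul,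
        Complex.conj_conj]
    simp only [ex_conj, neg_neg]
    ring
  calc _ ≤ ENNReal.ofReal X := ENNReal.ofReal_le_ofReal h1
    _ = ‖(X : ℂ)‖ₑ := by
        rw [← ofReal_norm, Complex.norm_real, Real.norm_of_nonneg hX0]
    _ ≤ _ := by
        rw [h2]
        refine (enorm_integral_le_lintegral_enorm _).trans (le_of_eq ?_)
        congr 1; ext q
        simp only [enorm_mul, RCLike.enorm_conj]
        have : ‖ex a (q.1 - q.2)‖ₑ = 1 := by rw [← ofReal_norm, ex_norm]; simp
        rw [this, one_mul, ENNReal.ofReal_pow (norm_nonneg _), ofReal_norm, sq]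

/-- conjugate Dirichlet kernel -/
def EE (k : ℕ) (u : ℝ) : ℝ := ∑ i ∈ Finset.range k, Real.sin ((i + 1) * u)

lemma EE_continuous (k : ℕ) : Continuous (EE k) := by
  unfold EE; fun_prop

lemma EE_far (k : ℕ) (u : ℝ) (hu : Real.sin (u / 2) ≠ 0) :
    EE k u = (Real.cos (u / 2) - Real.cos ((k + 1 / 2) * u)) / (2 * Real.sin (u / 2)) := by
  induction k with
  | zero => simp [EE, show (2⁻¹ * u) = u / 2 by ring]
  | succ k ih =>
    unfold EE at *
    rw [Finset.sum_range_succ, ih, eq_div_iff (by positivity), add_mul, div_mul_cancel₀ _ (by positivity)]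
    have h1 : Real.cos ((k + 1 / 2) * u) - Real.cos (((k + 1 : ℕ) + 1 / 2 : ℝ) * u)
        = Real.sin ((k + 1) * u) * (2 * Real.sin (u / 2)) := by
      rw [Real.cos_sub_cos, show ((k + 1 / 2) * u + ((k + 1 : ℕ) + 1 / 2 : ℝ) * u) / 2 = (k + 1) * u by
        push_cast; ring, show ((k + 1 / 2) * u - ((k + 1 : ℕ) + 1 / 2 : ℝ) * u) / 2 = -(u / 2) by
        push_cast; ring, Real.sin_neg]
      ring
    linarith

lemma EE_diff (a j : ℕ) (u : ℝ) : |EE (a + j) u - EE a u| ≤ j := by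
  unfold EE
  rw [Finset.sum_range_add, add_sub_cancel_left]
  refine (Finset.abs_sum_le_sum_abs _ _).trans ?_
  refine (Finset.sum_le_sum fun i _ => Real.abs_sin_le_one _).trans ?_
  simp

/-- conjugate partial sum operator -/
def Tk (g : ℝ → ℂ) (k : ℕ) (x : ℝ) : ℂ := ∫ u in T1, g (x - u) * (EE k u : ℂ)

lemma abs_le_pi_of_T1 {u : ℝ} (hu : u ∈ T1) : |u| ≤ Real.pi := abs_le.2 ⟨hu.1, hu.2.le⟩

lemma cont_intOn_T1 {g : ℝ → ℂ} (hg : Continuous g) : IntegrableOn g T1 :=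
  (hg.integrableOn_Icc (a := -Real.pi) (b := Real.pi)).mono_set Ico_subset_Icc_self

/-- auxiliary function B -/
def BB (w : ℝ → ENNReal) (lam x : ℝ) : ENNReal :=
  ∫⁻ t in T1, w (x - t) * ENNReal.ofReal (if Metric.infDist (x - t) (Om w lam)ᶜ ≤ |t| then
    Metric.infDist (x - t) (Om w lam)ᶜ / t ^ 2 else 0)

lemma infDist_per (w : ℝ → ENNReal) (hw : Function.Periodic w (2 * Real.pi)) (lam : ℝ) :
    Function.Periodic (fun y => Metric.infDist y (Om w lam)ᶜ) (2 * Real.pi) := by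
  have key : ∀ y, ∀ c : ℝ, (∀ z, z ∈ (Om w lam)ᶜ → z + c ∈ (Om w lam)ᶜ) →
      (Om w lam)ᶜ.Nonempty → Metric.infDist (y + c) (Om w lam)ᶜ ≤ Metric.infDist y (Om w lam)ᶜ := by
    intro y c hc hne
    rw [Metric.le_infDist hne]
    intro z hz
    refine (Metric.infDist_le_dist_of_mem (hc z hz)).trans ?_
    simp
  intro y
  rcases (Om w lam)ᶜ.eq_empty_or_nonempty with h | hne
  · simp [h]
  · have h1 : ∀ z, z ∈ (Om w lam)ᶜ → z + 2 * Real.pi ∈ (Om w lam)ᶜ := by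
      intro z hz; rw [mem_compl_iff, Om_periodic w hw]; exact hz
    have h2 : ∀ z, z ∈ (Om w lam)ᶜ → z + -(2 * Real.pi) ∈ (Om w lam)ᶜ := by
      intro z hz; rw [mem_compl_iff, ← Om_periodic w hw]; simpa using hz
    apply le_antisymm (key y _ h1 hne)
    have := key (y + 2 * Real.pi) _ h2 hne
    simpa using this

lemma BB_meas (w : ℝ → ENNReal) (hm : Measurable w) (lam : ℝ) : Measurable
    (fun q : ℝ × ℝ => w (q.1 - q.2) * ENNReal.ofReal (if Metric.infDist (q.1 - q.2) (Om w lam)ᶜ ≤ |q.2| then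
    Metric.infDist (q.1 - q.2) (Om w lam)ᶜ / q.2 ^ 2 else 0)) := by
  have hd : Measurable (fun q : ℝ × ℝ => Metric.infDist (q.1 - q.2) (Om w lam)ᶜ) :=
    (Metric.continuous_infDist_pt _).measurable.comp (by fun_prop)
  refine (hm.comp (by fun_prop)).mul (Measurable.ennreal_ofReal ?_)
  refine Measurable.ite (measurableSet_le hd (by fun_prop)) (by fun_prop) (by fun_prop)

lemma BB_int (w : ℝ → ENNReal) (hm : Measurable w) (hw : Function.Periodic w (2 * Real.pi)) (lam : ℝ) :
    ∫⁻ x in T1, BB w lam x ≤ 4 * ∫⁻ x in T1, w x := by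
  unfold BB
  rw [lintegral_lintegral_swap (BB_meas w hm lam).aemeasurable]
  have h1 : ∀ t, ∫⁻ x in T1, w (x - t) * ENNReal.ofReal (if Metric.infDist (x - t) (Om w lam)ᶜ ≤ |t| then
    Metric.infDist (x - t) (Om w lam)ᶜ / t ^ 2 else 0) =
    ∫⁻ x in T1, w x * ENNReal.ofReal (if Metric.infDist x (Om w lam)ᶜ ≤ |t| then
    Metric.infDist x (Om w lam)ᶜ / t ^ 2 else 0) := by
    intro t
    have := per_shift (fun x => w x * ENNReal.ofReal (if Metric.infDist x (Om w lam)ᶜ ≤ |t| then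
      Metric.infDist x (Om w lam)ᶜ / t ^ 2 else 0)) (by
        intro x
        have h2 := infDist_per w hw lam x
        simp only at h2
        simp only [h2, hw x]) (-t)
    simpa only [← sub_eq_add_neg] using this
  simp only [h1]
  have hd : Measurable (fun q : ℝ × ℝ => Metric.infDist q.2 (Om w lam)ᶜ) :=
    (Metric.continuous_infDist_pt _).measurable.comp (by fun_prop)
  have hmm : ∀ d : ℝ, Measurable (fun t : ℝ => ENNReal.ofReal (if d ≤ |t| then d / t ^ 2 else 0)) := by
    intro d
    exact Measurable.ennreal_ofReal (Measurable.ite (measurableSet_le (by fun_prop) (by fun_prop))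
      (by fun_prop) (by fun_prop))
  rw [lintegral_lintegral_swap]
  · calc _ = ∫⁻ x in T1, w x * ∫⁻ t in T1, ENNReal.ofReal (if Metric.infDist x (Om w lam)ᶜ ≤ |t| then
        Metric.infDist x (Om w lam)ᶜ / t ^ 2 else 0) := by
          congr 1; ext x
          exact lintegral_const_mul _ (hmm _)
      _ ≤ ∫⁻ x in T1, w x * 4 := by
          gcongr with x
          set d := Metric.infDist x (Om w lam)ᶜ
          have hd0 : 0 ≤ d := Metric.infDist_nonneg
          rcases hd0.eq_or_lt with h | h
          · simp [← h]
          · have h5 := PK (fun _ => 1) measurable_const 0 d 1 0 h one_pos le_rfl (by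
              intro r hr
              simp)
            calc _ ≤ ∫⁻ t in T1, ENNReal.ofReal d * (1 * ENNReal.ofReal (1 / (max d |t|) ^ 2)) := by
                  gcongr with t
                  rw [one_mul, ← ENNReal.ofReal_mul hd0]
                  apply ENNReal.ofReal_le_ofReal
                  split_ifs with hc
                  · rw [max_eq_right hc, sq_abs]; exact le_of_eq (by ring)
                  · positivity
              _ ≤ ∫⁻ t, ENNReal.ofReal d * (1 * ENNReal.ofReal (1 / (max d |t|) ^ 2)) := setLIntegral_le_lintegral _ _
              _ = ENNReal.ofReal d * ∫⁻ t, (1 * ENNReal.ofReal (1 / (max d |t|) ^ 2)) := lintegral_const_mul _ (by fun_prop)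
              _ ≤ ENNReal.ofReal d * ENNReal.ofReal (1 * (4 / d + 2 * 0 / d ^ 2)) := by gcongr
              _ = 4 := by
                rw [← ENNReal.ofReal_mul hd0]
                have : d * (1 * (4 / d + 2 * 0 / d ^ 2)) = 4 := by field_simp; ring
                rw [this]; simp
      _ = _ := by rw [lintegral_mul_const _ hm, mul_comm]
  · refine Measurable.aemeasurable ?_
    refine (hm.comp measurable_snd).mul (Measurable.ennreal_ofReal ?_)
    refine Measurable.ite (measurableSet_le hd (by fun_prop)) (by fun_prop) (by fun_prop)

/-- far part -/
def Gx (g : ℝ → ℂ) (x h : ℝ) (u : ℝ) : ℂ :=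
  {u : ℝ | h < |u|}.indicator (fun u => g (x - u) *
    (Complex.exp (Complex.I * (u / 2)) / ((2 * Real.sin (u / 2) : ℝ) : ℂ))) u

lemma measurableSet_far (h : ℝ) : MeasurableSet {u : ℝ | h < |u|} :=
  measurableSet_lt measurable_const (by fun_prop)

lemma Gx_norm (g : ℝ → ℂ) (x h : ℝ) (hh : 0 < h) (u : ℝ) (hu : u ∈ T1) :
    ‖Gx g x h u‖ ≤ ‖g (x - u)‖ * {u : ℝ | h < |u|}.indicator (fun u => Real.pi / (2 * |u|)) u := by
  unfold Gx
  by_cases hc : u ∈ {u : ℝ | h < |u|}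
  · rw [indicator_of_mem hc, indicator_of_mem hc, norm_mul, norm_div]
    have h1 : ‖Complex.exp (Complex.I * (u / 2))‖ = 1 := by
      rw [mul_comm, show (u : ℂ) / 2 = ((u / 2 : ℝ) : ℂ) by push_cast; ring]
      exact Complex.norm_exp_ofReal_mul_I _
    have h0 : 0 < |u| := hh.trans hc
    rw [h1, Complex.norm_real, Real.norm_eq_abs, abs_mul, abs_two]
    have h2 := sin_half_lower u (abs_le_pi_of_T1 hu)
    have hpi := Real.pi_pos
    refine mul_le_mul_of_nonneg_left ?_ (norm_nonneg _)
    calc 1 / (2 * |Real.sin (u / 2)|) ≤ 1 / (2 * (|u| / Real.pi)) := by gcongr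
      _ = _ := by field_simp
  · rw [indicator_of_notMem hc, indicator_of_notMem hc]; simp

lemma Gx_int (g : ℝ → ℂ) (hg : Continuous g) (x h : ℝ) (hh : 0 < h) : IntegrableOn (Gx g x h) T1 := by
  have h1 : IntegrableOn (fun u => g (x - u)) T1 := cont_intOn_T1 (by fun_prop)
  have h2 := h1.norm.mul_const (Real.pi / (2 * h))
  have hpi := Real.pi_pos
  refine h2.mono' ?_ ?_
  · refine Measurable.aestronglyMeasurable ?_
    unfold Gx
    refine Measurable.indicator ?_ (measurableSet_far h)
    have := hg.measurable
    fun_prop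
  · refine (ae_restrict_iff' measurableSet_T1).2 (Eventually.of_forall fun u hu => ?_)
    refine (Gx_norm g x h hh u hu).trans ?_
    gcongr
    apply indicator_le'
    · intro u hu
      have : h < |u| := hu
      gcongr
    · intros; positivity

lemma Tk_split (g : ℝ → ℂ) (hg : Continuous g) (x h : ℝ) (hh : 0 < h) (a : ℕ) : ∃ c : ℂ, ∀ k : ℕ,
    Tk g k x - c = (∫ u in T1, {u : ℝ | h < |u|}ᶜ.indicator (fun u => g (x - u) * ((EE k u - EE a u : ℝ) : ℂ)) u)
      - (1 / 2) * (Gh (Gx g x h) k + Gh (Gx g x h) (-k - 1)) := by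
  have hF := measurableSet_far h
  have hIntg : ∀ φ : ℝ → ℂ, Continuous φ → IntegrableOn (fun u => g (x - u) * φ u) T1 :=
    fun φ hφ => cont_intOn_T1 (by fun_prop)
  refine ⟨(∫ u in T1, {u : ℝ | h < |u|}ᶜ.indicator (fun u => g (x - u) * ((EE a u : ℝ) : ℂ)) u) +
    (1 / 2) * (Gh (Gx g x h) 0 + Gh (Gx g x h) (-1)), fun k => ?_⟩
  unfold Tk Gh
  have hE : ∀ k, Continuous (fun u => (EE k u : ℂ)) := fun k => Complex.continuous_ofReal.comp (EE_continuous k)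
  have i1 : IntegrableOn ({u : ℝ | h < |u|}ᶜ.indicator (fun u => g (x - u) * ((EE a u : ℝ) : ℂ))) T1 :=
    (hIntg _ (hE a)).indicator hF.compl
  have i2 : IntegrableOn ({u : ℝ | h < |u|}ᶜ.indicator (fun u => g (x - u) * ((EE k u - EE a u : ℝ) : ℂ))) T1 := by
    refine Integrable.indicator (hIntg (fun u => ((EE k u - EE a u : ℝ) : ℂ)) ?_) hF.compl
    push_cast
    exact (hE k).sub (hE a)
  have i3 := hIntg _ (hE k)
  have iG : ∀ l : ℤ, IntegrableOn (fun u => Gx g x h u * ex l u) T1 := Gh_int _ (Gx_int g hg x h hh)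
  have iP : ∀ l m : ℤ, IntegrableOn (fun u => (1 / 2 : ℂ) * (Gx g x h u * ex l u + Gx g x h u * ex m u)) T1 :=
    fun l m => ((iG l).add (iG m)).const_mul _
  have i4 : IntegrableOn (fun u => {u : ℝ | h < |u|}ᶜ.indicator (fun u => g (x - u) * ((EE a u : ℝ) : ℂ)) u +
    (1 / 2 : ℂ) * (Gx g x h u * ex 0 u + Gx g x h u * ex (-1) u)) T1 := i1.add (iP _ _)
  rw [← integral_add (iG _) (iG _), ← integral_add (iG _) (iG _), ← integral_const_mul, ← integral_const_mul,
    ← integral_add i1 (iP _ _), ← integral_sub i3 i4, ← integral_sub i2 (iP _ _)]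
  refine setIntegral_congr_fun measurableSet_T1 fun u hu => ?_
  beta_reduce
  by_cases hc : u ∈ {u : ℝ | h < |u|}
  · have hc' : u ∉ {u : ℝ | h < |u|}ᶜ := by simpa using hc
    rw [indicator_of_notMem hc', indicator_of_notMem hc']
    unfold Gx
    rw [indicator_of_mem hc]
    have h0 : 0 < |u| := hh.trans hc
    have hs : Real.sin (u / 2) ≠ 0 := by
      have h2 := sin_half_lower u (abs_le_pi_of_T1 hu)
      have : 0 < |Real.sin (u / 2)| := lt_of_lt_of_le (div_pos h0 Real.pi_pos) h2
      exact abs_pos.1 this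
    rw [EE_far k u hs]
    set e := Complex.exp (Complex.I * (u / 2))
    have e1 : e * ex 0 u + e * ex (-1) u = 2 * (Real.cos (u / 2) : ℂ) := by
      rw [Complex.ofReal_cos, Complex.cos]; unfold ex; simp only [e]
      rw [← Complex.exp_add, ← Complex.exp_add, mul_div_cancel₀ _ two_ne_zero]
      congr 2 <;> push_cast <;> ring
    have e2 : e * ex k u + e * ex (-k - 1) u = 2 * (Real.cos ((k + 1 / 2) * u) : ℂ) := by
      rw [Complex.ofReal_cos, Complex.cos]; unfold ex; simp only [e]
      rw [← Complex.exp_add, ← Complex.exp_add, mul_div_cancel₀ _ two_ne_zero]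
      congr 2 <;> push_cast <;> ring
    set s := ((2 * Real.sin (u / 2) : ℝ) : ℂ) with hsdef
    rw [Complex.ofReal_div, ← hsdef, Complex.ofReal_sub]
    have : ∀ p q : ℂ, g (x - u) * (e / s) * p + g (x - u) * (e / s) * q = g (x - u) / s * (e * p + e * q) := by
      intros; ring
    rw [this, this, e1, e2]
    ring
  · have hc' : u ∈ {u : ℝ | h < |u|}ᶜ := hc
    rw [indicator_of_mem hc', indicator_of_mem hc']
    unfold Gx
    rw [indicator_of_notMem hc]
    push_cast
    ring

lemma near_bound (g : ℝ → ℂ) (x lam : ℝ) (N : ℕ) (hN : 1 ≤ N) (hx : x ∉ Om (fun y => ‖g y‖ₑ) lam) (a j : ℕ) (hj : j < N)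
    (hlam : 0 < lam) :
    ‖∫ u in T1, {u : ℝ | 1 / (N:ℝ) < |u|}ᶜ.indicator (fun u => g (x - u) * ((EE (a + j) u - EE a u : ℝ) : ℂ)) u‖ ≤ 2 * lam := by
  have hN' : (0:ℝ) < N := by exact_mod_cast hN
  rw [← ENNReal.ofReal_le_ofReal_iff (by positivity), ofReal_norm]
  refine (enorm_integral_le_lintegral_enorm _).trans ?_
  have hx' : ∫⁻ y in Metric.closedBall x (1 / N), ‖g y‖ₑ ≤ ENNReal.ofReal (2 * (1 / N) * lam) := by
    by_contra hc
    exact hx ⟨1 / N, by positivity, not_le.1 hc⟩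
  calc _ ≤ ∫⁻ u in T1, ENNReal.ofReal N * (Metric.closedBall x (1 / (N:ℝ))).indicator (fun y => ‖g y‖ₑ) (x - u) := by
        gcongr with u
        by_cases hc : 1 / (N:ℝ) < |u|
        · rw [indicator_of_notMem]
          · simp
          · simpa using hc
        · have h1 : x - u ∈ Metric.closedBall x (1 / (N:ℝ)) := by
            rw [Metric.mem_closedBall, Real.dist_eq]; simpa using hc
          rw [indicator_of_mem h1, indicator_of_mem (by exact hc), enorm_mul, mul_comm]
          gcongr
          rw [← ofReal_norm, Complex.norm_real, Real.norm_eq_abs]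
          apply ENNReal.ofReal_le_ofReal
          exact (EE_diff a j u).trans (by exact_mod_cast hj.le)
    _ ≤ ∫⁻ u, ENNReal.ofReal N * (Metric.closedBall x (1 / (N:ℝ))).indicator (fun y => ‖g y‖ₑ) (x - u) :=
        setLIntegral_le_lintegral _ _
    _ = ENNReal.ofReal N * ∫⁻ y in Metric.closedBall x (1 / N), ‖g y‖ₑ := by
        rw [lintegral_const_mul' _ _ ENNReal.ofReal_ne_top, lintegral_sub_left_eq_self
          (fun y => (Metric.closedBall x (1 / (N:ℝ))).indicator (fun y => ‖g y‖ₑ) y),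
          lintegral_indicator Metric.isClosed_closedBall.measurableSet]
    _ ≤ ENNReal.ofReal N * ENNReal.ofReal (2 * (1 / N) * lam) := by gcongr
    _ = _ := by
        rw [← ENNReal.ofReal_mul (by positivity)]; congr 1; field_simp

lemma DD_inner (w : ℝ → ENNReal) (hm : Measurable w) (hw : Function.Periodic w (2 * Real.pi)) (lam : ℝ) (hlam : 0 < lam)
    (hne : (Om w lam)ᶜ.Nonempty) (x t : ℝ) (N : ℕ) (hN : 1 ≤ N) :
    ∫⁻ s in T1, w (x - s) * ENNReal.ofReal (‖DD (2 * N) (t - s)‖ ^ 2) ≤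
      ENNReal.ofReal (Real.pi ^ 2 * (lam * (4 * N + 2 * Metric.infDist (x - t) (Om w lam)ᶜ * N ^ 2))) := by
  have hN' : (0:ℝ) < N := by exact_mod_cast hN
  have h1 := per_reflect (fun v => w (x - t + v) * ENNReal.ofReal (‖DD (2 * N) v‖ ^ 2)) (by
    intro v
    simp only [DD_periodic, ← add_assoc]
    rw [hw (x - t + v)]) t
  simp only [sub_add_sub_cancel] at h1
  rw [h1]
  have h2 := PK w hm (x - t) (1 / N) lam (Metric.infDist (x - t) (Om w lam)ᶜ) (by positivity) hlam
    Metric.infDist_nonneg (fun r hr => ball_le_infDist w lam hlam hne _ r hr)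
  calc _ ≤ ∫⁻ v in T1, ENNReal.ofReal (Real.pi ^ 2) * (w (x - t + v) * ENNReal.ofReal (1 / (max (1 / (N:ℝ)) |v|) ^ 2)) := by
        refine setLIntegral_mono' measurableSet_T1 fun v hv => ?_
        have := DD_bound N hN v (abs_le_pi_of_T1 hv)
        rw [mul_left_comm, ← ENNReal.ofReal_mul (by positivity)]
        gcongr
    _ ≤ ∫⁻ v, ENNReal.ofReal (Real.pi ^ 2) * (w (x - t + v) * ENNReal.ofReal (1 / (max (1 / (N:ℝ)) |v|) ^ 2)) :=
        setLIntegral_le_lintegral _ _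
    _ = ENNReal.ofReal (Real.pi ^ 2) * ∫⁻ v, (w (x - t + v) * ENNReal.ofReal (1 / (max (1 / (N:ℝ)) |v|) ^ 2)) :=
        lintegral_const_mul' _ _ ENNReal.ofReal_ne_top
    _ ≤ ENNReal.ofReal (Real.pi ^ 2) * ENNReal.ofReal (lam * (4 / (1 / N) + 2 * Metric.infDist (x - t) (Om w lam)ᶜ / (1 / N) ^ 2)) := by gcongr
    _ = _ := by
        rw [← ENNReal.ofReal_mul (by positivity)]; congr 1; field_simp

lemma far_outer (w : ℝ → ENNReal) (hm : Measurable w) (lam : ℝ) (hlam : 0 < lam)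
    (x : ℝ) (hx : x ∉ Om w lam) (hB : BB w lam x ≤ ENNReal.ofReal lam) (N : ℕ) (hN : 1 ≤ N) :
    ∫⁻ t in T1, w (x - t) * ENNReal.ofReal ({u : ℝ | 1 / (N:ℝ) < |u|}.indicator (fun u => Real.pi / (2 * |u|)) t) ^ 2 *
      ENNReal.ofReal (Real.pi ^ 2 * (lam * (4 * N + 2 * Metric.infDist (x - t) (Om w lam)ᶜ * N ^ 2)))
      ≤ ENNReal.ofReal (9 / 2 * Real.pi ^ 4 * lam ^ 2 * N ^ 2) := by
  have hN' : (0:ℝ) < N := by exact_mod_cast hN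
  have hpi := Real.pi_pos
  set δ := fun t => Metric.infDist (x - t) (Om w lam)ᶜ with hδ
  have hδ0 : ∀ t, 0 ≤ δ t := fun t => Metric.infDist_nonneg
  have hδc : Continuous δ := (Metric.continuous_infDist_pt _).comp (by fun_prop)
  have hδt : ∀ t, δ t ≤ |t| := by
    intro t
    have := Metric.infDist_le_dist_of_mem (x := x - t) (show x ∈ (Om w lam)ᶜ from hx)
    simpa [Real.dist_eq] using this
  have h2 := PK w hm x (1 / N) lam 0 (by positivity) hlam le_rfl (fun r hr => by
    by_contra hc
    exact hx ⟨r, hr, by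
      rw [show 2 * r * lam = 2 * lam * (r + 0) by ring]; exact not_le.1 hc⟩)
  calc _ ≤ ∫⁻ t in T1, (ENNReal.ofReal (Real.pi ^ 4 * lam * N) * (w (x - t) * ENNReal.ofReal (1 / (max (1 / (N:ℝ)) |t|) ^ 2))
        + ENNReal.ofReal (Real.pi ^ 4 * lam * N ^ 2 / 2) * (w (x - t) * ENNReal.ofReal (if δ t ≤ |t| then δ t / t ^ 2 else 0))) := by
        gcongr with t
        rw [mul_left_comm (ENNReal.ofReal (Real.pi ^ 4 * lam * N)), mul_left_comm (ENNReal.ofReal (Real.pi ^ 4 * lam * N ^ 2 / 2)), ← mul_add, mul_assoc]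
        gcongr
        by_cases hc : t ∈ {u : ℝ | 1 / (N:ℝ) < |u|}
        · have hc' : 1 / (N:ℝ) < |t| := hc
          have h0 : 0 < |t| := lt_trans (by positivity) hc'
          rw [indicator_of_mem hc, if_pos (hδt t), ← ENNReal.ofReal_mul (by positivity), ← ENNReal.ofReal_pow (by positivity),
            ← ENNReal.ofReal_mul (by positivity),
            ← ENNReal.ofReal_mul (by positivity), ← ENNReal.ofReal_add (by positivity)
              (by have := hδ0 t; positivity), max_eq_right hc'.le]
          apply le_of_eq
          congr 1
          change (Real.pi / (2 * |t|)) ^ 2 * (Real.pi ^ 2 * (lam * (4 * N + 2 * δ t * N ^ 2))) = _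
          rw [div_pow, mul_pow, sq_abs]
          have : t ^ 2 ≠ 0 := by
            have : t ≠ 0 := abs_pos.1 h0
            positivity
          field_simp
          ring
        · rw [indicator_of_notMem hc]; simp
    _ = ENNReal.ofReal (Real.pi ^ 4 * lam * N) * (∫⁻ t in T1, (w (x - t) * ENNReal.ofReal (1 / (max (1 / (N:ℝ)) |t|) ^ 2)))
        + ENNReal.ofReal (Real.pi ^ 4 * lam * N ^ 2 / 2) * BB w lam x := by
        rw [lintegral_add_left (by fun_prop), lintegral_const_mul' _ _ ENNReal.ofReal_ne_top,
          lintegral_const_mul' _ _ ENNReal.ofReal_ne_top]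
        rfl
    _ ≤ ENNReal.ofReal (Real.pi ^ 4 * lam * N) * ENNReal.ofReal (lam * (4 / (1 / N) + 2 * 0 / (1 / N) ^ 2))
        + ENNReal.ofReal (Real.pi ^ 4 * lam * N ^ 2 / 2) * ENNReal.ofReal lam := by
        gcongr
        refine (setLIntegral_le_lintegral _ _).trans (le_trans (le_of_eq ?_) h2)
        rw [← lintegral_neg_eq_self]
        simp only [abs_neg, sub_neg_eq_add]
    _ = _ := by
        rw [← ENNReal.ofReal_mul (by positivity), ← ENNReal.ofReal_mul (by positivity),
          ← ENNReal.ofReal_add (by positivity) (by positivity)]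
        congr 1; field_simp; ring

lemma far_bound (g : ℝ → ℂ) (hg : Continuous g) (hw : Function.Periodic (fun y => ‖g y‖ₑ) (2 * Real.pi)) (lam : ℝ) (hlam : 0 < lam)
    (x : ℝ) (hx : x ∉ Om (fun y => ‖g y‖ₑ) lam) (hB : BB (fun y => ‖g y‖ₑ) lam x ≤ ENNReal.ofReal lam) (N : ℕ) (hN : 1 ≤ N)
    (a : ℤ) : ∑ j ∈ Finset.range N, ‖Gh (Gx g x (1 / N)) (a + j)‖ ≤ 30 * lam * N := by
  have hN' : (0:ℝ) < N := by exact_mod_cast hN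
  have hpi := Real.pi_pos
  set w : ℝ → ENNReal := fun y => ‖g y‖ₑ with hwdef
  have hm : Measurable w := hg.enorm.measurable
  set s : ℝ → ENNReal := fun t => ENNReal.ofReal ({u : ℝ | 1 / (N:ℝ) < |u|}.indicator (fun u => Real.pi / (2 * |u|)) t)
  have hs : Measurable s := by
    refine Measurable.ennreal_ofReal (Measurable.indicator (by fun_prop) (measurableSet_far _))
  have hG : ∀ t ∈ T1, ‖Gx g x (1 / N) t‖ₑ ≤ w (x - t) * s t := by
    intro t ht
    rw [← ofReal_norm]
    refine (ENNReal.ofReal_le_ofReal (Gx_norm g x (1 / N) (by positivity) t ht)).trans ?_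
    rw [ENNReal.ofReal_mul (norm_nonneg _), ofReal_norm]
  set K : ℝ → ENNReal := fun u => ENNReal.ofReal (‖DD (2 * N) u‖ ^ 2)
  have hK : Measurable K := by
    have := (DD_continuous (2 * N)).measurable
    fun_prop
  have hKn : ∀ u v, K (u - v) = K (v - u) := by
    intro u v
    simp only [K]; rw [← neg_sub, DD_norm_neg]
  have h1 := L2_lemma _ (Gx_int g hg x (1 / N) (by positivity)) a N
  set J := ∫⁻ t in T1, w (x - t) * s t ^ 2 * ∫⁻ s in T1, w (x - s) * K (t - s)
  have h2 : J ≤ ENNReal.ofReal (9 / 2 * Real.pi ^ 4 * lam ^ 2 * N ^ 2) := by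
    refine le_trans ?_ (far_outer w hm lam hlam x hx hB N hN)
    refine lintegral_mono fun t => ?_
    exact mul_le_mul_right (DD_inner w hm hw lam hlam ⟨x, hx⟩ x t N hN) _
  have hJ1 : J = ∫⁻ t in T1, ∫⁻ r in T1, w (x - t) * s t ^ 2 * (w (x - r) * K (t - r)) := by
    simp only [J]
    congr 1; ext t
    rw [lintegral_const_mul _ (by fun_prop)]
  have hJ2 : J = ∫⁻ t in T1, ∫⁻ r in T1, w (x - r) * s r ^ 2 * (w (x - t) * K (r - t)) := by
    rw [hJ1, lintegral_lintegral_swap (by fun_prop)]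
  have h3 : ENNReal.ofReal (N * ∑ j ∈ Finset.range N, ‖Gh (Gx g x (1 / N)) (a + j)‖ ^ 2) ≤ J + J := by
    refine h1.trans ?_
    calc _ ≤ ∫⁻ q, (w (x - q.1) * s q.1) * (w (x - q.2) * s q.2) * K (q.1 - q.2)
          ∂((volume.restrict T1).prod (volume.restrict T1)) := by
          rw [← restrict_T2]
          refine setLIntegral_mono' (measurableSet_T1.prod measurableSet_T1) fun q hq => ?_
          have := hG q.1 hq.1
          have := hG q.2 hq.2
          gcongr
      _ = ∫⁻ t in T1, ∫⁻ r in T1, (w (x - t) * s t) * (w (x - r) * s r) * K (t - r) := by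
          rw [lintegral_prod _ (by fun_prop)]
      _ ≤ ∫⁻ t in T1, ∫⁻ r in T1, (w (x - t) * s t ^ 2 * (w (x - r) * K (t - r)) + w (x - r) * s r ^ 2 * (w (x - t) * K (r - t))) := by
          gcongr with t r
          rw [hKn r t]
          have : s t * s r ≤ s t ^ 2 + s r ^ 2 := by
            rcases le_total (s t) (s r) with h | h
            · calc s t * s r ≤ s r * s r := by gcongr
                _ ≤ _ := by rw [← sq]; exact le_add_self
            · calc s t * s r ≤ s t * s t := by gcongr
                _ ≤ _ := by rw [← sq]; exact le_self_add
          calc _ = w (x - t) * w (x - r) * K (t - r) * (s t * s r) := by ring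
            _ ≤ w (x - t) * w (x - r) * K (t - r) * (s t ^ 2 + s r ^ 2) := by gcongr
            _ = _ := by ring
      _ = J + J := by
          nth_rw 1 [hJ1]; rw [hJ2]
          rw [← lintegral_add_left (by fun_prop)]
          congr 1; ext t
          rw [lintegral_add_left (by fun_prop)]
  have h4 : N * ∑ j ∈ Finset.range N, ‖Gh (Gx g x (1 / N)) (a + j)‖ ^ 2 ≤ 9 * Real.pi ^ 4 * lam ^ 2 * N ^ 2 := by
    rw [← ENNReal.ofReal_le_ofReal_iff (by positivity)]
    refine (h3.trans (add_le_add h2 h2)).trans (le_of_eq ?_)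
    rw [← ENNReal.ofReal_add (by positivity) (by positivity)]
    congr 1; ring
  have h5 := sq_sum_le_card_mul_sum_sq (s := Finset.range N) (f := fun j => ‖Gh (Gx g x (1 / N)) (a + j)‖)
  rw [Finset.card_range] at h5
  have h6 : Real.pi ^ 2 ≤ 10 := by
    have := Real.pi_lt_d2; nlinarith
  refine abs_le_of_sq_le_sq' ?_ (by positivity) |>.2
  refine (h5.trans h4).trans ?_
  have : Real.pi ^ 4 ≤ 100 := by nlinarith [sq_nonneg (Real.pi ^ 2)]
  calc _ ≤ 9 * 100 * lam ^ 2 * N ^ 2 := by gcongr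
    _ = _ := by ring

/-- oscillation badness -/
def OscBad (c : ℝ) (ξ : ℕ → ℂ) : Prop := ∃ a N : ℕ, 1 ≤ N ∧
  c * N ^ 2 < ∑ i ∈ Finset.range N, ∑ j ∈ Finset.range N, ‖ξ (a + i) - ξ (a + j)‖

lemma rodin_pt (g : ℝ → ℂ) (hg : Continuous g) (hw : Function.Periodic (fun y => ‖g y‖ₑ) (2 * Real.pi)) (lam : ℝ) (hlam : 0 < lam)
    (x : ℝ) (hx : x ∉ Om (fun y => ‖g y‖ₑ) lam) (hB : BB (fun y => ‖g y‖ₑ) lam x ≤ ENNReal.ofReal lam) :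
    ¬ OscBad (64 * lam) (fun k => Tk g k x) := by
  rintro ⟨a, N, hN, hc⟩
  have hN' : (0:ℝ) < N := by exact_mod_cast hN
  apply not_le.2 hc
  obtain ⟨c, hcc⟩ := Tk_split g hg x (1 / N) (by positivity) a
  have h1 : ∑ j ∈ Finset.range N, ‖Tk g (a + j) x - c‖ ≤ 32 * lam * N := by
    calc _ ≤ ∑ j ∈ Finset.range N, (2 * lam + 1 / 2 * (‖Gh (Gx g x (1 / N)) (a + j)‖ + ‖Gh (Gx g x (1 / N)) (-a - 1 - j)‖)) := by
          apply Finset.sum_le_sum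
          intro j hj
          rw [hcc]
          refine (norm_sub_le _ _).trans ?_
          refine add_le_add (near_bound g x lam N hN hx a j (Finset.mem_range.1 hj) hlam) ?_
          rw [norm_mul]
          have : ‖(1 / 2 : ℂ)‖ = 1 / 2 := by simp
          rw [this]
          refine mul_le_mul_of_nonneg_left ((norm_add_le _ _).trans (le_of_eq ?_)) (by norm_num)
          push_cast
          rw [show (-((a:ℤ) + (j:ℤ)) - 1 : ℤ) = -a - 1 - j by ring]
      _ = 2 * lam * N + 1 / 2 * (∑ j ∈ Finset.range N, ‖Gh (Gx g x (1 / N)) (a + j)‖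
            + ∑ j ∈ Finset.range N, ‖Gh (Gx g x (1 / N)) (-a - 1 - j)‖) := by
          rw [Finset.sum_add_distrib, ← Finset.mul_sum (f := fun j => ‖Gh (Gx g x (1 / N)) (a + (j:ℕ))‖ + ‖Gh (Gx g x (1 / N)) (-a - 1 - (j:ℕ))‖), Finset.sum_add_distrib]
          simp; ring
      _ ≤ 2 * lam * N + 1 / 2 * (30 * lam * N + 30 * lam * N) := by
          have e1 := far_bound g hg hw lam hlam x hx hB N hN a
          have e2 := far_bound g hg hw lam hlam x hx hB N hN (-a - N)
          rw [← Finset.sum_range_reflect] at e2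
          have e3 : ∑ j ∈ Finset.range N, ‖Gh (Gx g x (1 / N)) (-a - 1 - j)‖ = ∑ j ∈ Finset.range N, ‖Gh (Gx g x (1 / N)) (-a - N + ((N - 1 - j : ℕ) : ℤ))‖ := by
            apply Finset.sum_congr rfl
            intro j hj
            have := Finset.mem_range.1 hj
            congr 2; omega
          rw [e3]
          gcongr
      _ = _ := by ring
  calc _ ≤ ∑ i ∈ Finset.range N, ∑ j ∈ Finset.range N, (‖Tk g (a + i) x - c‖ + ‖Tk g (a + j) x - c‖) := by
        gcongr with i _ j _
        calc _ = ‖(Tk g (a + i) x - c) - (Tk g (a + j) x - c)‖ := by congr 1; ring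
          _ ≤ _ := norm_sub_le _ _
    _ = N * ∑ j ∈ Finset.range N, ‖Tk g (a + j) x - c‖ + N * ∑ j ∈ Finset.range N, ‖Tk g (a + j) x - c‖ := by
        simp [Finset.sum_add_distrib, Finset.mul_sum]
    _ ≤ N * (32 * lam * N) + N * (32 * lam * N) := by gcongr
    _ = _ := by ring

theorem rodin (g : ℝ → ℂ) (hg : Continuous g) (hw : Function.Periodic (fun y => ‖g y‖ₑ) (2 * Real.pi)) (lam : ℝ) (hlam : 0 < lam) :
    ENNReal.ofReal lam * volume (T1 ∩ {x | OscBad (64 * lam) (fun k => Tk g k x)}) ≤ 14 * ∫⁻ x in T1, ‖g x‖ₑ := by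
  have h1 := HL_weak _ hw lam hlam
  set w : ℝ → ENNReal := fun y => ‖g y‖ₑ with hwdef
  have hm : Measurable w := hg.enorm.measurable
  have h2 := BB_int w hm hw lam
  have hBm : Measurable (BB w lam) := by
    unfold BB
    exact Measurable.lintegral_prod_right (BB_meas w hm lam)
  have h3 : ENNReal.ofReal lam * volume (T1 ∩ {x | ENNReal.ofReal lam ≤ BB w lam x}) ≤ 4 * ∫⁻ x in T1, w x := by
    refine le_trans ?_ h2
    have := mul_meas_ge_le_lintegral₀ (μ := volume.restrict T1) hBm.aemeasurable (ENNReal.ofReal lam)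
    rwa [Measure.restrict_apply' measurableSet_T1, inter_comm] at this
  calc _ ≤ ENNReal.ofReal lam * (volume (T1 ∩ Om w lam) + volume (T1 ∩ {x | ENNReal.ofReal lam ≤ BB w lam x})) := by
        gcongr
        refine le_trans (measure_mono ?_) (measure_union_le _ _)
        rintro x ⟨hx1, hx2⟩
        by_cases hO : x ∈ Om w lam
        · exact Or.inl ⟨hx1, hO⟩
        · refine Or.inr ⟨hx1, ?_⟩
          by_contra hc
          exact rodin_pt g hg hw lam hlam x hO (not_le.1 hc).le hx2
    _ ≤ 10 * (∫⁻ x in T1, w x) + 4 * ∫⁻ x in T1, w x := by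
        rw [mul_add]; gcongr
    _ = _ := by rw [← add_mul]; norm_num

lemma circ_T1 (F : ℝ → ℂ) (hF : Function.Periodic F (2 * Real.pi)) :
    ∫ u in T1, F u = ∫ u in (0:ℝ)..(2 * Real.pi), F u := by
  have h1 : ∫ u in T1, F u = ∫ u in (-Real.pi)..(-Real.pi + 2 * Real.pi), F u := by
    rw [intervalIntegral.integral_of_le (by have := Real.pi_pos; linarith), restrict_T1]
  rw [h1, hF.intervalIntegral_add_eq (-Real.pi) 0, zero_add]

lemma circ_T1_avg (f : ℂ → ℂ) : Real.circleAverage f 0 1 = (2 * Real.pi)⁻¹ • ∫ u in T1, f (ex 1 u) := by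
  rw [Real.circleAverage_def, circ_T1 (fun u => f (ex 1 u)) (fun u => by simp only [ex_periodic])]
  congr 2; ext u; simp [circleMap, ex, mul_comm]

/-- Poisson kernel -/
def Pk (ρ u : ℝ) : ℝ := (1 - ρ ^ 2) / ‖ex 1 u - ρ‖ ^ 2

lemma ex_ne (ρ u : ℝ) (h0 : 0 ≤ ρ) (h1 : ρ < 1) : 0 < ‖ex 1 u - ρ‖ := by
  rw [norm_pos_iff, sub_ne_zero]
  intro h
  have := congrArg norm h
  rw [ex_norm, Complex.norm_real, Real.norm_of_nonneg h0] at this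
  linarith

lemma Pk_continuous (ρ : ℝ) (h0 : 0 ≤ ρ) (h1 : ρ < 1) : Continuous (Pk ρ) := by
  unfold Pk
  refine continuous_const.div₀ (((ex_continuous 1).sub continuous_const).norm.pow 2) fun u => ?_
  have := ex_ne ρ u h0 h1
  positivity

lemma Pk_nonneg (ρ u : ℝ) (h0 : 0 ≤ ρ) (h1 : ρ < 1) : 0 ≤ Pk ρ u := by
  unfold Pk
  have : 0 ≤ 1 - ρ ^ 2 := by nlinarith
  positivity

lemma norm_ex_sub_sq (ρ u : ℝ) : ‖ex 1 u - ρ‖ ^ 2 = (1 - ρ) ^ 2 + 4 * ρ * Real.sin (u / 2) ^ 2 := by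
  have : ex 1 u = (Real.cos u : ℂ) + (Real.sin u : ℂ) * Complex.I := by
    unfold ex
    simp only [Int.cast_one, one_mul]
    rw [mul_comm, Complex.exp_mul_I]; simp
  rw [this, ← Complex.normSq_eq_norm_sq, Complex.normSq_apply]
  have e1 : Real.cos u = 1 - 2 * Real.sin (u / 2) ^ 2 := by
    have := Real.cos_sq' (u / 2)
    have h := Real.cos_two_mul (u / 2)
    rw [mul_div_cancel₀ _ two_ne_zero] at h
    linarith
  have := Real.sin_sq_add_cos_sq u
  simp [-Complex.ofReal_cos, -Complex.ofReal_sin]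
  linear_combination this - 2 * ρ * e1

lemma Pk_bound (ρ u : ℝ) (h0 : 1 / 2 ≤ ρ) (h1 : ρ < 1) (hu : |u| ≤ Real.pi) :
    Pk ρ u ≤ 10 * (1 - ρ) * (1 / (max (1 - ρ) |u|) ^ 2) := by
  have hd := ex_ne ρ u (by linarith) h1
  have hm : 0 < max (1 - ρ) |u| := lt_max_of_lt_left (by linarith)
  have hpi := Real.pi_pos
  have hpi2 : Real.pi ^ 2 ≤ 10 := by have := Real.pi_lt_d2; nlinarith
  have key : (max (1 - ρ) |u|) ^ 2 ≤ 5 * ‖ex 1 u - ρ‖ ^ 2 := by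
    rw [norm_ex_sub_sq]
    rcases max_choice (1 - ρ) |u| with h | h
    · rw [h]
      nlinarith [sq_nonneg (1 - ρ), mul_nonneg (show 0 ≤ ρ by linarith) (sq_nonneg (Real.sin (u / 2)))]
    · rw [h]
      have h2 := sin_half_lower u hu
      rw [div_le_iff₀ hpi] at h2
      have h3 : |u| ^ 2 ≤ Real.sin (u / 2) ^ 2 * Real.pi ^ 2 := by
        rw [← sq_abs (Real.sin (u / 2)), ← mul_pow]
        gcongr
      nlinarith [sq_nonneg (1 - ρ), sq_nonneg (Real.sin (u / 2)), mul_nonneg (show 0 ≤ ρ - 1 / 2 by linarith) (sq_nonneg (Real.sin (u / 2)))]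
  unfold Pk
  rw [mul_one_div, div_le_div_iff₀ (by positivity) (by positivity)]
  have : 1 - ρ ^ 2 ≤ 2 * (1 - ρ) := by nlinarith
  calc _ ≤ (2 * (1 - ρ)) * (5 * ‖ex 1 u - ρ‖ ^ 2) := by
        apply mul_le_mul this key (by positivity) (by linarith)
    _ = _ := by ring

lemma Pk_coef_nat (ρ : ℝ) (h0 : 0 ≤ ρ) (h1 : ρ < 1) (k : ℕ) :
    ∫ u in T1, (Pk ρ u : ℂ) * ex k u = 2 * Real.pi * (ρ:ℂ) ^ k := by
  have hd : DiffContOnCl ℂ (fun z : ℂ => z ^ k) (Metric.ball 0 1) :=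
    (Differentiable.diffContOnCl (by fun_prop))
  have := hd.circleAverage_poissonKernel_smul (w := (ρ:ℂ)) (by simp [abs_of_nonneg h0, h1])
  rw [circ_T1_avg, inv_smul_eq_iff₀ (by positivity)] at this
  have hk : ∀ u, ex k u = (ex 1 u) ^ k := by
    intro p
    unfold ex; rw [← Complex.exp_nat_mul]; congr 1; push_cast; ring
  simp only [hk]
  rw [show (2 * Real.pi : ℂ) * (ρ:ℂ) ^ k = (2 * Real.pi : ℝ) • ((ρ:ℂ) ^ k) by
    rw [Complex.real_smul]; push_cast; ring, ← this]
  congr 1; ext u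
  simp [Pk, poissonKernel, ex_norm, abs_of_nonneg h0]

lemma Pk_coef (ρ : ℝ) (h0 : 0 ≤ ρ) (h1 : ρ < 1) (k : ℤ) :
    ∫ u in T1, (Pk ρ u : ℂ) * ex k u = 2 * Real.pi * (ρ:ℂ) ^ k.natAbs := by
  rcases Int.natAbs_eq k with h | h
  · conv_lhs => rw [h]
    exact Pk_coef_nat ρ h0 h1 _
  · have := congrArg (starRingEnd ℂ) (Pk_coef_nat ρ h0 h1 k.natAbs)
    rw [← integral_conj] at this
    simp only [map_mul, Complex.conj_ofReal, ex_conj, map_pow, ← h] at this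
    rw [this, Complex.conj_ofNat]

/-- Poisson average -/
def Pconv (ρ : ℝ) (p : ℝ → ℝ) (x : ℝ) : ℝ := (2 * Real.pi)⁻¹ * ∫ u in T1, Pk ρ u * p (x - u)

lemma cont_intOn_T1_real {g : ℝ → ℝ} (hg : Continuous g) : IntegrableOn g T1 :=
  (hg.integrableOn_Icc (a := -Real.pi) (b := Real.pi)).mono_set Ico_subset_Icc_self

lemma Pconv_Om (ρ : ℝ) (h0 : 1 / 2 ≤ ρ) (h1 : ρ < 1) (p : ℝ → ℝ) (hp : Continuous p) (hp0 : ∀ x, 0 ≤ p x)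
    (lam : ℝ) (hlam : 0 < lam) (x : ℝ) (hx : x ∉ Om (fun y => ENNReal.ofReal (p y)) lam) :
    Pconv ρ p x ≤ 7 * lam := by
  have hρ : 0 < 1 - ρ := by linarith
  have hpi := Real.pi_gt_three
  have h2 := PK (fun y => ENNReal.ofReal (p y)) (by fun_prop) x (1 - ρ) lam 0 hρ hlam le_rfl (fun r hr => by
    by_contra hc
    exact hx ⟨r, hr, by
      rw [show 2 * r * lam = 2 * lam * (r + 0) by ring]; exact not_le.1 hc⟩)
  have h3 : ∫ u in T1, Pk ρ u * p (x - u) ≤ 40 * lam := by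
    rw [← ENNReal.ofReal_le_ofReal_iff (by positivity)]
    have hnn : ∀ u, 0 ≤ Pk ρ u * p (x - u) := fun u => mul_nonneg (Pk_nonneg ρ u (by linarith) h1) (hp0 _)
    have hc : Continuous (fun u => Pk ρ u * p (x - u)) := (Pk_continuous ρ (by linarith) h1).mul (by fun_prop)
    rw [ofReal_integral_eq_lintegral_ofReal (cont_intOn_T1_real hc)
      (Eventually.of_forall hnn)]
    calc _ ≤ ∫⁻ u in T1, ENNReal.ofReal (10 * (1 - ρ)) * (ENNReal.ofReal (p (x - u)) * ENNReal.ofReal (1 / (max (1 - ρ) |u|) ^ 2)) := by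
          refine setLIntegral_mono' measurableSet_T1 fun u hu => ?_
          have := Pk_bound ρ u h0 h1 (abs_le_pi_of_T1 hu)
          rw [← ENNReal.ofReal_mul (hp0 _), ← ENNReal.ofReal_mul (by positivity)]
          apply ENNReal.ofReal_le_ofReal
          calc _ ≤ 10 * (1 - ρ) * (1 / (max (1 - ρ) |u|) ^ 2) * p (x - u) := by
                have := hp0 (x - u)
                gcongr
            _ = _ := by ring
      _ ≤ ∫⁻ u, ENNReal.ofReal (10 * (1 - ρ)) * (ENNReal.ofReal (p (x - u)) * ENNReal.ofReal (1 / (max (1 - ρ) |u|) ^ 2)) :=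
          setLIntegral_le_lintegral _ _
      _ = ENNReal.ofReal (10 * (1 - ρ)) * ∫⁻ u, (ENNReal.ofReal (p (x - u)) * ENNReal.ofReal (1 / (max (1 - ρ) |u|) ^ 2)) :=
          lintegral_const_mul' _ _ ENNReal.ofReal_ne_top
      _ ≤ ENNReal.ofReal (10 * (1 - ρ)) * ENNReal.ofReal (lam * (4 / (1 - ρ) + 2 * 0 / (1 - ρ) ^ 2)) := by
          gcongr
          refine le_trans (le_of_eq ?_) h2
          rw [← lintegral_neg_eq_self]
          simp only [abs_neg, sub_neg_eq_add]
      _ = _ := by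
          rw [← ENNReal.ofReal_mul (by positivity)]
          congr 1; field_simp; ring
  unfold Pconv
  rw [inv_mul_le_iff₀ (by positivity)]
  nlinarith

lemma inner_log (v : ℝ) (hv : 0 ≤ v) :
    ∫⁻ l in Ioi (1:ℝ), ENNReal.ofReal (1 / l) * ENNReal.ofReal (v - l) ≤ ENNReal.ofReal ((1 + v) * Real.log (1 + v)) := by
  rcases le_or_gt v 1 with h | h
  · have : ∫⁻ l in Ioi (1:ℝ), ENNReal.ofReal (1 / l) * ENNReal.ofReal (v - l) = ∫⁻ l in Ioi (1:ℝ), 0 := by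
      refine setLIntegral_congr_fun measurableSet_Ioi fun l hl => ?_
      have : v - l ≤ 0 := by have : (1:ℝ) < l := hl; linarith
      simp [ENNReal.ofReal_of_nonpos this]
    rw [this]; simp
  · have h1 : ∫⁻ l in Ioi (1:ℝ), ENNReal.ofReal (1 / l) * ENNReal.ofReal (v - l) ≤ ∫⁻ l in Ioc 1 v, ENNReal.ofReal (v * (1 / l)) := by
      rw [← Ioc_union_Ioi_eq_Ioi h.le, lintegral_union measurableSet_Ioi (by
        rw [disjoint_left]; rintro x ⟨_, hx⟩ hx2; exact not_lt.2 hx hx2)]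
      have : ∫⁻ l in Ioi v, ENNReal.ofReal (1 / l) * ENNReal.ofReal (v - l) = ∫⁻ l in Ioi v, 0 := by
        refine setLIntegral_congr_fun measurableSet_Ioi fun l hl => ?_
        have : v - l ≤ 0 := by have : v < l := hl; linarith
        simp [ENNReal.ofReal_of_nonpos this]
      rw [this]; simp only [lintegral_zero, add_zero]
      refine setLIntegral_mono' measurableSet_Ioc fun l hl => ?_
      have : (0:ℝ) < l := by linarith [hl.1]
      rw [← ENNReal.ofReal_mul (by positivity), mul_comm]
      gcongr
      linarith
    refine h1.trans ?_
    have hIntg : IntegrableOn (fun l : ℝ => v * (1 / l)) (Ioc 1 v) := by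
      have : ContinuousOn (fun l : ℝ => v * (1 / l)) (Icc 1 v) := by
        refine continuousOn_const.mul (continuousOn_const.div continuousOn_id fun x hx => ?_)
        have := hx.1; simp; linarith
      exact this.integrableOn_Icc.mono_set Ioc_subset_Icc_self
    rw [← ofReal_integral_eq_lintegral_ofReal hIntg ((ae_restrict_iff' measurableSet_Ioc).2 (Eventually.of_forall
      fun l hl => by
        have : (0:ℝ) < l := by linarith [hl.1]
        positivity)), ← intervalIntegral.integral_of_le h.le, intervalIntegral.integral_const_mul,
        integral_one_div_of_pos one_pos (by linarith)]
    apply ENNReal.ofReal_le_ofReal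
    rw [div_one]
    have := Real.log_le_log (show 0 < v by linarith) (show v ≤ 1 + v by linarith)
    have := Real.log_nonneg h.le
    nlinarith

lemma Om_sub (w : ℝ → ENNReal) (hm : Measurable w) (lam : ℝ) (hlam : 0 < lam) :
    Om w (2 * lam) ⊆ Om (fun x => w x - ENNReal.ofReal lam) lam := by
  rintro x ⟨r, hr, h⟩
  refine ⟨r, hr, ?_⟩
  by_contra hc
  push Not at hc
  apply not_le.2 h
  calc _ ≤ ∫⁻ y in Metric.closedBall x r, ((w y - ENNReal.ofReal lam) + ENNReal.ofReal lam) := by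
        gcongr with y; exact le_tsub_add
    _ = (∫⁻ y in Metric.closedBall x r, (w y - ENNReal.ofReal lam)) + ENNReal.ofReal lam * ENNReal.ofReal (2 * r) := by
        rw [lintegral_add_right _ measurable_const, setLIntegral_const, Real.volume_closedBall]
    _ ≤ ENNReal.ofReal (2 * r * lam) + ENNReal.ofReal lam * ENNReal.ofReal (2 * r) := by gcongr
    _ = _ := by
        rw [← ENNReal.ofReal_mul hlam.le, ← ENNReal.ofReal_add (by positivity) (by positivity)]
        congr 1; ring

lemma max_LlogL (p : ℝ → ℝ) (hp : Continuous p) (hp0 : ∀ x, 0 ≤ p x) (hper : Function.Periodic p (2 * Real.pi))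
    (m : ℝ → ℝ) (hm : Continuous m) (hm0 : ∀ x, 0 ≤ m x)
    (H : ∀ lam > 0, ∀ x, x ∉ Om (fun y => ENNReal.ofReal (p y)) lam → m x ≤ 7 * lam) :
    ∫⁻ x in T1, ENNReal.ofReal (m x) ≤ 140 * (1 + ∫⁻ x in T1, ENNReal.ofReal ((1 + p x) * Real.log (1 + p x))) := by
  have hlay := lintegral_eq_lintegral_meas_lt (volume.restrict T1) (f := fun x => m x / 14)
    (Eventually.of_forall fun x => div_nonneg (hm0 x) (by norm_num)) (by fun_prop)
  have hbd : ∀ l > 0, (volume.restrict T1) {x | l < m x / 14} ≤ ENNReal.ofReal (1 / l) * (10 * ∫⁻ x in T1, ENNReal.ofReal (p x - l)) := by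
    intro l hl
    have h1 := HL_weak (fun y => ENNReal.ofReal (p y) - ENNReal.ofReal l) (fun x => by simp only [hper x]) l hl
    rw [Measure.restrict_apply' measurableSet_T1]
    have h2 : volume ({x | l < m x / 14} ∩ T1) ≤ volume (T1 ∩ Om (fun y => ENNReal.ofReal (p y) - ENNReal.ofReal l) l) := by
      apply measure_mono
      rintro x ⟨hx1, hx2⟩
      refine ⟨hx2, Om_sub _ (by fun_prop) l hl ?_⟩
      by_contra hc
      have := H (2 * l) (by positivity) x hc
      have : l < m x / 14 := hx1
      linarith
    refine h2.trans ?_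
    rw [one_div, ENNReal.ofReal_inv_of_pos hl, mul_comm, ← div_eq_mul_inv, ENNReal.le_div_iff_mul_le (Or.inl (by simpa using hl)) (Or.inl ENNReal.ofReal_ne_top), mul_comm]
    refine h1.trans (le_of_eq ?_)
    congr 2; ext x
    rw [ENNReal.ofReal_sub _ hl.le]
  have h3 : ∫⁻ l in Ioi (0:ℝ), (volume.restrict T1) {x | l < m x / 14} ≤ ENNReal.ofReal (2 * Real.pi) +
      10 * ∫⁻ x in T1, ENNReal.ofReal ((1 + p x) * Real.log (1 + p x)) := by
    rw [← Ioc_union_Ioi_eq_Ioi (zero_le_one (α := ℝ)), lintegral_union measurableSet_Ioi (by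
        rw [disjoint_left]; rintro x ⟨_, hx⟩ hx2; exact not_lt.2 hx hx2)]
    gcongr
    · calc _ ≤ ∫⁻ l in Ioc (0:ℝ) 1, ENNReal.ofReal (2 * Real.pi) := by
            gcongr with l
            refine (measure_mono (subset_univ _)).trans ?_
            rw [Measure.restrict_apply_univ, volume_T1]
        _ = _ := by simp
    · calc _ ≤ ∫⁻ l in Ioi (1:ℝ), 10 * ∫⁻ x in T1, ENNReal.ofReal (1 / l) * ENNReal.ofReal (p x - l) := by
            refine setLIntegral_mono' measurableSet_Ioi fun l hl => ?_
            refine (hbd l (lt_trans one_pos hl)).trans (le_of_eq ?_)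
            rw [lintegral_const_mul' _ _ ENNReal.ofReal_ne_top]; ring
        _ = 10 * ∫⁻ x in T1, ∫⁻ l in Ioi (1:ℝ), ENNReal.ofReal (1 / l) * ENNReal.ofReal (p x - l) := by
            rw [lintegral_const_mul' _ _ (by norm_num), lintegral_lintegral_swap]
            have := hp.measurable
            fun_prop
        _ ≤ _ := by
            gcongr with x
            exact inner_log _ (hp0 x)
  calc _ = ∫⁻ x in T1, 14 * ENNReal.ofReal (m x / 14) := by
        congr 1; ext x
        rw [show (14 : ENNReal) = ENNReal.ofReal 14 by simp, ← ENNReal.ofReal_mul (by norm_num)]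
        congr 1; ring
    _ = 14 * ∫⁻ x in T1, ENNReal.ofReal (m x / 14) := lintegral_const_mul' _ _ (by norm_num)
    _ ≤ 14 * (ENNReal.ofReal (2 * Real.pi) + 10 * ∫⁻ x in T1, ENNReal.ofReal ((1 + p x) * Real.log (1 + p x))) := by
        rw [hlay]; gcongr
    _ ≤ 14 * (10 + 10 * ∫⁻ x in T1, ENNReal.ofReal ((1 + p x) * Real.log (1 + p x))) := by
        gcongr
        rw [show (10 : ENNReal) = ENNReal.ofReal 10 by simp]
        apply ENNReal.ofReal_le_ofReal
        have := Real.pi_lt_d2; linarith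
    _ = _ := by
        rw [← mul_one_add, ← mul_assoc]; norm_num

lemma zlog_pt (z : ℂ) (hz : 1 ≤ z.re) : ‖z‖ / 2 - z.re - z.re * Real.log z.re ≤ - (z * Complex.log z).re := by
  have hz0 : z ≠ 0 := by rintro rfl; simp at hz; linarith
  have hn : 0 < ‖z‖ := norm_pos_iff.2 hz0
  set u := z.re
  set θ := Complex.arg z
  have hv : ‖z‖ * Real.sin θ = z.im := Complex.norm_mul_sin_arg z
  have hu : ‖z‖ * Real.cos θ = u := Complex.norm_mul_cos_arg z
  have h1 : Real.sin θ ^ 2 ≤ Real.sin θ * θ := by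
    rcases le_total 0 θ with h | h
    · have a1 := Real.sin_nonneg_of_nonneg_of_le_pi h (Complex.arg_le_pi z)
      have a2 := Real.sin_le h
      nlinarith
    · have a1 := Real.sin_nonneg_of_nonneg_of_le_pi (x := -θ) (by linarith) (by linarith [Complex.neg_pi_lt_arg z])
      have a2 := Real.sin_le (x := -θ) (by linarith)
      rw [Real.sin_neg] at a1 a2
      nlinarith
  have h2 : (z * Complex.log z).re = u * Real.log ‖z‖ - z.im * θ := by
    rw [Complex.mul_re, Complex.log_re, Complex.log_im]
  rw [h2]
  have h3 : Real.log ‖z‖ ≤ Real.log u + ‖z‖ / u / 2 := by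
    have hu0 : 0 < u := by linarith
    have e : Real.log ‖z‖ = Real.log u + (Real.log (‖z‖ / u / 2) + Real.log 2) := by
      rw [← Real.log_mul (by positivity) (by norm_num), ← Real.log_mul (by positivity) (by positivity)]
      congr 1; field_simp
    have e1 := Real.log_le_sub_one_of_pos (x := ‖z‖ / u / 2) (by positivity)
    have e2 := Real.log_two_lt_d9
    linarith
  have h4 : u * Real.log ‖z‖ ≤ u * Real.log u + ‖z‖ / 2 := by
    have hu0 : 0 < u := by linarith
    calc _ ≤ u * (Real.log u + ‖z‖ / u / 2) := by gcongr
      _ = _ := by field_simp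
  have h5 : ‖z‖ - u ≤ z.im * θ := by
    rw [← hv]
    have : ‖z‖ * Real.sin θ ^ 2 ≤ ‖z‖ * (Real.sin θ * θ) := by gcongr
    have h6 : ‖z‖ - u ≤ ‖z‖ * Real.sin θ ^ 2 := by
      rw [← hu, Real.sin_sq]
      have c1 := Real.cos_le_one θ
      have c0 : 0 ≤ Real.cos θ := by
        by_contra hc
        push Not at hc
        nlinarith
      nlinarith [mul_nonneg hn.le (mul_nonneg c0 (sub_nonneg.2 c1))]
    linarith
  linarith

lemma ex_int (k : ℤ) : ∫ u in T1, ex k u = if k = 0 then 2 * (Real.pi : ℂ) else 0 := by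
  split_ifs with h
  · subst h
    simp only [ex_zero]
    simp [T1]
    rw [max_eq_left (by have := Real.pi_pos; linarith)]
    push_cast; ring
  · have := circ_T1 (ex k) (ex_periodic k)
    rw [this]
    have hk : (Complex.I * k) ≠ 0 := by simp [h]
    have := integral_exp_mul_complex (a := 0) (b := 2 * Real.pi) hk
    have e : ∀ u : ℝ, ex k u = Complex.exp (Complex.I * k * u) := by
      intro u; unfold ex; congr 1; ring
    simp only [e]
    rw [this]
    have : Complex.exp (Complex.I * k * ((2 * Real.pi : ℝ) : ℂ)) = 1 := by
      rw [Complex.exp_eq_one_iff]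
      exact ⟨k, by push_cast; ring⟩
    rw [this]; simp

lemma ex_natpow (k : ℕ) (u : ℝ) : ex k u = (ex 1 u) ^ k := by
  unfold ex; rw [← Complex.exp_nat_mul]; congr 1; push_cast; ring

theorem zyg {ι : Type*} (s : Finset ι) (c : ι → ℂ) (k : ι → ℤ) (P : ℝ → ℝ)
    (hP : ∀ t, ∑ i ∈ s, c i * ex (k i) t = (P t : ℂ)) (hP1 : ∀ t, 1 ≤ P t)
    (hq : ∀ t, (∑ i ∈ s, ((k i).sign : ℂ) * c i * ex (k i) t).re = 0) :
    ∫ t in T1, ‖∑ i ∈ s, ((k i).sign : ℂ) * c i * ex (k i) t‖ ≤ ∫ t in T1, (2 * (P t * Real.log (P t)) + 2 * P t) := by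
  have hPc : Continuous P := by
    have : P = fun t => (∑ i ∈ s, c i * ex (k i) t).re := by ext t; rw [hP]; simp
    rw [this]
    exact Complex.continuous_re.comp (continuous_finsetSum _ fun i _ => continuous_const.mul (ex_continuous _))
  set q : ℝ → ℂ := fun t => ∑ i ∈ s, ((k i).sign : ℂ) * c i * ex (k i) t with hqdef
  have hqc : Continuous q := continuous_finsetSum _ fun i _ => continuous_const.mul (ex_continuous _)
  set F : ℂ → ℂ := fun z => ∑ i ∈ s, c i * (1 + ((k i).sign : ℂ)) * z ^ (k i).natAbs with hF
  have hFd : Differentiable ℂ F := by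
    simp only [hF]; fun_prop
  have hFe : ∀ t, F (ex 1 t) = P t + q t := by
    intro t
    rw [← hP t, hqdef, hF]
    simp only
    rw [← Finset.sum_add_distrib]
    refine Finset.sum_congr rfl fun i _ => ?_
    rw [← ex_natpow]
    rcases lt_trichotomy (k i) 0 with h | h | h
    · simp [Int.sign_eq_neg_one_of_neg h]
    · simp [h]
    · have : (((k i).natAbs : ℕ) : ℤ) = k i := by omega
      rw [this]; ring
  have hFe_re : ∀ t, (F (ex 1 t)).re = P t := by
    intro t; rw [hFe, Complex.add_re, hq t]; simp
  have hsph : ∀ z ∈ Metric.sphere (0:ℂ) 1, ∃ t, z = ex 1 t := by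
    intro z hz
    have hz' : ‖z‖ = 1 := by simpa using hz
    refine ⟨z.arg, ?_⟩
    have := Complex.norm_mul_exp_arg_mul_I z
    rw [hz'] at this
    conv_lhs => rw [← this]
    unfold ex
    simp [mul_comm]
  have hre : ∀ z ∈ Metric.closedBall (0:ℂ) 1, 1 ≤ (F z).re := by
    intro z hz
    have := Complex.norm_le_of_forall_mem_frontier_norm_le (U := Metric.ball (0:ℂ) 1) Metric.isBounded_ball
      (f := fun z => Complex.exp (-F z)) (Differentiable.diffContOnCl (by fun_prop)) (C := Real.exp (-1)) (by
        intro z hz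
        rw [frontier_ball _ one_ne_zero] at hz
        obtain ⟨t, rfl⟩ := hsph z hz
        rw [Complex.norm_exp, Complex.neg_re, hFe_re]
        have := hP1 t
        gcongr) (z := z) (by rwa [closure_ball _ one_ne_zero])
    rw [Complex.norm_exp, Complex.neg_re, Real.exp_le_exp] at this
    linarith
  have hH : DiffContOnCl ℂ (fun z => F z * Complex.log (F z)) (Metric.ball 0 1) := by
    apply DifferentiableOn.diffContOnCl
    intro z hz
    rw [closure_ball _ one_ne_zero] at hz
    apply DifferentiableAt.differentiableWithinAt
    refine (hFd z).mul ((hFd z).clog ?_)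
    left
    have := hre z hz
    linarith
  have hHav := (show DiffContOnCl ℂ (fun z => F z * Complex.log (F z)) (Metric.ball 0 |(1:ℝ)|) by rwa [abs_one]).circleAverage
  have hFav := (show DiffContOnCl ℂ F (Metric.ball 0 |(1:ℝ)|) from hFd.diffContOnCl).circleAverage
  rw [circ_T1_avg, inv_smul_eq_iff₀ (by positivity)] at hHav hFav
  have hF0 : (F 0).im = 0 := by
    have h1 : F 0 = ∑ i ∈ s, c i * (if k i = 0 then 1 else 0) := by
      rw [hF]
      refine Finset.sum_congr rfl fun i _ => ?_
      by_cases h : k i = 0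
      · simp [h]
      · have : (k i).natAbs ≠ 0 := by omega
        simp [h]
    have h2 : ∫ t in T1, (P t : ℂ) = 2 * Real.pi * F 0 := by
      rw [h1, Finset.mul_sum]
      simp only [← hP]
      have hii : ∀ i ∈ s, Integrable (fun t => c i * ex (k i) t) (volume.restrict T1) :=
        fun i _ => cont_intOn_T1 (continuous_const.mul (ex_continuous _))
      rw [integral_finsetSum _ hii]
      refine Finset.sum_congr rfl fun i _ => ?_
      rw [integral_const_mul, ex_int]
      split_ifs <;> ring
    have h2' : ∫ t in T1, (P t : ℂ) = ((∫ t in T1, P t : ℝ) : ℂ) := integral_ofReal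
    rw [h2'] at h2
    have h3 := congrArg Complex.im h2
    have h4 : (2 * (Real.pi : ℂ)) = ((2 * Real.pi : ℝ) : ℂ) := by push_cast; ring
    rw [h4, Complex.im_ofReal_mul] at h3
    have : (((∫ t in T1, P t : ℝ)) : ℂ).im = 0 := Complex.ofReal_im _
    have h5 : 2 * Real.pi * (F 0).im = 0 := by rw [← h3]; exact this
    have := Real.pi_pos
    rcases mul_eq_zero.1 h5 with h | h
    · linarith
    · exact h
  have hH0 : 0 ≤ (F 0 * Complex.log (F 0)).re := by
    have h1 := hre 0 (by simp)
    have : F 0 = ((F 0).re : ℂ) := by apply Complex.ext <;> simp [hF0]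
    rw [this, ← Complex.ofReal_log (by linarith), ← Complex.ofReal_mul, Complex.ofReal_re]
    exact mul_nonneg (by linarith) (Real.log_nonneg h1)
  have hcH : Continuous (fun t => F (ex 1 t) * Complex.log (F (ex 1 t))) := by
    have hc1 : Continuous (fun t => F (ex 1 t)) := hFd.continuous.comp (ex_continuous 1)
    refine hc1.mul (hc1.clog fun t => Or.inl ?_)
    rw [hFe_re]; linarith [hP1 t]
  have hI : 0 ≤ ∫ t in T1, (F (ex 1 t) * Complex.log (F (ex 1 t))).re := by
    have h1 := integral_re (cont_intOn_T1 hcH)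
    simp only [RCLike.re_to_complex] at h1
    rw [h1, hHav, Complex.real_smul, Complex.re_ofReal_mul]
    positivity
  have hlogc : Continuous (fun t => Real.log (P t)) := hPc.log fun t => by linarith [hP1 t]
  have hi1 : IntegrableOn (fun t => P t * Real.log (P t) + P t) T1 := cont_intOn_T1_real (by fun_prop)
  have hi2 : IntegrableOn (fun t => (F (ex 1 t) * Complex.log (F (ex 1 t))).re) T1 :=
    cont_intOn_T1_real (Complex.continuous_re.comp hcH)
  calc _ ≤ ∫ t in T1, 2 * ((P t * Real.log (P t) + P t) - (F (ex 1 t) * Complex.log (F (ex 1 t))).re) := by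
        refine integral_mono (cont_intOn_T1_real hqc.norm) ((hi1.sub hi2).const_mul 2) fun t => ?_
        have h1 := zlog_pt (F (ex 1 t)) (by rw [hFe_re]; exact hP1 t)
        rw [hFe_re] at h1
        have h2 : ‖q t‖ ≤ ‖F (ex 1 t)‖ := by
          have e1 : (F (ex 1 t)).im = (q t).im := by rw [hFe]; simp
          have e2 : q t = (((q t).im : ℝ) : ℂ) * Complex.I := by apply Complex.ext <;> simp [hq t, hqdef]
          rw [e2, norm_mul, Complex.norm_I, mul_one, Complex.norm_real, ← e1]
          exact Complex.abs_im_le_norm _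
        simp only
        linarith
    _ = 2 * ((∫ t in T1, (P t * Real.log (P t) + P t)) - ∫ t in T1, (F (ex 1 t) * Complex.log (F (ex 1 t))).re) := by
        rw [integral_const_mul, integral_sub hi1 hi2]
    _ ≤ 2 * (∫ t in T1, (P t * Real.log (P t) + P t)) := by linarith
    _ = _ := by
        rw [← integral_const_mul]; congr 1; ext t; ring

lemma transfer_le (a b : ℝ) (F G : ℝ × ℝ → ENNReal) (hF : Measurable F) (hG : Measurable G)
    (hFx : ∀ x y, F (x + 2 * Real.pi, y) = F (x, y)) (hFy : ∀ x y, F (x, y + 2 * Real.pi) = F (x, y))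
    (hGx : ∀ x y, G (x + 2 * Real.pi, y) = G (x, y)) (hGy : ∀ x y, G (x, y + 2 * Real.pi) = G (x, y))
    (C : ENNReal) (hC : C ≠ ⊤)
    (H : ∀ p : ℝ × ℝ, ∫⁻ t in T1, F (p.1 + a * t, p.2 + b * t) ≤ C * ∫⁻ t in T1, G (p.1 + a * t, p.2 + b * t)) :
    ∫⁻ p in T2, F p ≤ C * ∫⁻ p in T2, G p := by
  have h1 := transfer F hF hFx hFy a b
  have h2 := transfer G hG hGx hGy a b
  have hpi := Real.pi_pos
  have h0 : ENNReal.ofReal (2 * Real.pi) ≠ 0 := by simp [hpi]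
  have h3 : ENNReal.ofReal (2 * Real.pi) * ∫⁻ p in T2, F p ≤ ENNReal.ofReal (2 * Real.pi) * (C * ∫⁻ p in T2, G p) := by
    rw [← h1, mul_left_comm, ← h2, ← lintegral_const_mul' _ _ hC]
    exact lintegral_mono fun p => H p
  exact (ENNReal.mul_le_mul_iff_right h0 ENNReal.ofReal_ne_top).1 h3

lemma transfer_set (a b : ℝ) (E : Set (ℝ × ℝ)) (G : ℝ × ℝ → ENNReal) (hE : MeasurableSet E) (hG : Measurable G)
    (hFx : ∀ x y, (x + 2 * Real.pi, y) ∈ E ↔ (x, y) ∈ E) (hFy : ∀ x y, (x, y + 2 * Real.pi) ∈ E ↔ (x, y) ∈ E)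
    (hGx : ∀ x y, G (x + 2 * Real.pi, y) = G (x, y)) (hGy : ∀ x y, G (x, y + 2 * Real.pi) = G (x, y))
    (C : ENNReal) (hC : C ≠ ⊤) (lam : ℝ)
    (H : ∀ p : ℝ × ℝ, ENNReal.ofReal lam * volume (T1 ∩ {t | (p.1 + a * t, p.2 + b * t) ∈ E})
      ≤ C * ∫⁻ t in T1, G (p.1 + a * t, p.2 + b * t)) :
    ENNReal.ofReal lam * volume (T2 ∩ E) ≤ C * ∫⁻ p in T2, G p := by
  have key : ∀ {α : Type} [MeasurableSpace α] (μ : Measure α) (S A : Set α), MeasurableSet A →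
      ∫⁻ x in S, A.indicator (fun _ => ENNReal.ofReal lam) x ∂μ = ENNReal.ofReal lam * μ (S ∩ A) := by
    intro α _ μ S A hA
    rw [lintegral_indicator_const hA, Measure.restrict_apply hA, inter_comm]
  have := transfer_le a b (E.indicator (fun _ => ENNReal.ofReal lam)) G (measurable_const.indicator hE) hG
    (by intro x y; by_cases h : (x, y) ∈ E <;> simp [h, hFx]) (by intro x y; by_cases h : (x, y) ∈ E <;> simp [h, hFy]) hGx hGy C hC (by
      intro p
      refine le_trans (le_of_eq ?_) (H p)
      have hm : MeasurableSet {t : ℝ | (p.1 + a * t, p.2 + b * t) ∈ E} := by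
        have : Measurable (fun t : ℝ => (p.1 + a * t, p.2 + b * t)) := by fun_prop
        exact this hE
      rw [← key volume T1 _ hm]
      rfl)
  rw [key volume T2 E hE] at this
  exact this

def e2 (i : ℤ × ℤ) (p : ℝ × ℝ) : ℂ := ex i.1 p.1 * ex i.2 p.2

def TP (s : Finset (ℤ × ℤ)) (c : ℤ × ℤ → ℂ) (p : ℝ × ℝ) : ℂ := ∑ i ∈ s, c i * e2 i p

lemma e2_continuous (i : ℤ × ℤ) : Continuous (e2 i) := by
  unfold e2; unfold ex; fun_prop

lemma TP_continuous (s c) : Continuous (TP s c) :=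
  continuous_finsetSum _ fun i _ => continuous_const.mul (e2_continuous i)

lemma TP_perx (s c) (x y : ℝ) : TP s c (x + 2 * Real.pi, y) = TP s c (x, y) := by
  unfold TP e2; simp only [ex_periodic]

lemma TP_pery (s c) (x y : ℝ) : TP s c (x, y + 2 * Real.pi) = TP s c (x, y) := by
  unfold TP e2; simp only [ex_periodic]

lemma e2_slice (i : ℤ × ℤ) (p : ℝ × ℝ) (a b : ℤ) (t : ℝ) :
    e2 i (p.1 + a * t, p.2 + b * t) = e2 i p * ex (i.1 * a + i.2 * b) t := by
  unfold e2 ex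
  simp only [← Complex.exp_add]
  congr 1; push_cast; ring

lemma TP_slice (s c) (p : ℝ × ℝ) (a b : ℤ) (t : ℝ) :
    TP s c (p.1 + a * t, p.2 + b * t) = ∑ i ∈ s, (c i * e2 i p) * ex (i.1 * a + i.2 * b) t := by
  unfold TP; simp only [e2_slice, mul_assoc]

lemma e2_conj (i : ℤ × ℤ) (p : ℝ × ℝ) : (starRingEnd ℂ) (e2 i p) = e2 (-i) p := by
  unfold e2; simp [ex_conj]

/-- `Q` is purely imaginary. -/
lemma Q_re (s : Finset (ℤ × ℤ)) (hs : ∀ i ∈ s, -i ∈ s) (c : ℤ × ℤ → ℂ) (hc : ∀ i, c (-i) = (starRingEnd ℂ) (c i))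
    (a b : ℤ) (p : ℝ × ℝ) : (TP s (fun i => ((i.1 * a + i.2 * b).sign : ℂ) * c i) p).re = 0 := by
  have h : (starRingEnd ℂ) (TP s (fun i => ((i.1 * a + i.2 * b).sign : ℂ) * c i) p)
      = - TP s (fun i => ((i.1 * a + i.2 * b).sign : ℂ) * c i) p := by
    unfold TP
    rw [map_sum, ← Finset.sum_neg_distrib]
    refine Finset.sum_bij' (fun i _ => -i) (fun i _ => -i) (fun i hi => hs i hi) (fun i hi => hs i hi)
      (fun i _ => neg_neg i) (fun i _ => neg_neg i) fun i _ => ?_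
    have : (-i).1 * a + (-i).2 * b = -(i.1 * a + i.2 * b) := by simp; ring
    beta_reduce
    rw [this, Int.sign_neg, hc]
    simp only [map_mul, e2_conj]
    push_cast
    have h4 : ∀ n : ℤ, (starRingEnd ℂ) (n : ℂ) = n := fun n => by simp
    rw [h4]; ring
  have h2 := congrArg Complex.re h
  simp at h2
  linarith

def Th (t : ℝ) : ℝ := (1 + t) * Real.log (1 + t)

lemma Th_bd (t : ℝ) (ht : 1 ≤ t) : 2 * (t * Real.log t) + 2 * t ≤ 6 * Th t := by
  unfold Th
  have h1 : Real.log t ≤ Real.log (1 + t) := Real.log_le_log (by linarith) (by linarith)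
  have h2 : Real.log 2 ≤ Real.log (1 + t) := Real.log_le_log (by norm_num) (by linarith)
  have h3 := Real.log_two_gt_d9
  nlinarith

lemma Th_nonneg (t : ℝ) (ht : 0 ≤ t) : 0 ≤ Th t := mul_nonneg (by linarith) (Real.log_nonneg (by linarith))

lemma Th_cont (P : ℝ × ℝ → ℝ) (hP : Continuous P) (h0 : ∀ p, 0 ≤ P p) : Continuous (fun p => Th (P p)) := by
  unfold Th
  have h1 : Continuous (fun p => 1 + P p) := by fun_prop
  exact h1.mul (h1.log fun p => by linarith [h0 p])

lemma TP_real_cont (s c) (P : ℝ × ℝ → ℝ) (hP : ∀ p, TP s c p = (P p : ℂ)) : Continuous P := by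
  have : P = fun p => (TP s c p).re := by ext p; rw [hP]; simp
  rw [this]; exact Complex.continuous_re.comp (TP_continuous s c)

lemma TP_real_per (s c) (P : ℝ × ℝ → ℝ) (hP : ∀ p, TP s c p = (P p : ℂ)) :
    (∀ x y, P (x + 2 * Real.pi, y) = P (x, y)) ∧ (∀ x y, P (x, y + 2 * Real.pi) = P (x, y)) := by
  constructor <;> intro x y <;> apply Complex.ofReal_injective <;> rw [← hP, ← hP]
  · exact TP_perx s c x y
  · exact TP_pery s c x y

lemma Q_bound (s : Finset (ℤ × ℤ)) (hs : ∀ i ∈ s, -i ∈ s) (c : ℤ × ℤ → ℂ) (hc : ∀ i, c (-i) = (starRingEnd ℂ) (c i))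
    (P : ℝ × ℝ → ℝ) (hP : ∀ p, TP s c p = (P p : ℂ)) (hP1 : ∀ p, 1 ≤ P p) (a b : ℤ) :
    ∫⁻ p in T2, ‖TP s (fun i => ((i.1 * a + i.2 * b).sign : ℂ) * c i) p‖ₑ ≤ 6 * ∫⁻ p in T2, ENNReal.ofReal (Th (P p)) := by
  have hPc := TP_real_cont s c P hP
  have hPp := TP_real_per s c P hP
  have hThc := Th_cont P hPc fun p => by linarith [hP1 p]
  refine transfer_le a b _ _ (TP_continuous _ _).enorm.measurable
    hThc.measurable.ennreal_ofReal
    (fun x y => by rw [TP_perx]) (fun x y => by rw [TP_pery]) (fun x y => by rw [hPp.1]) (fun x y => by rw [hPp.2])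
    6 (by norm_num) fun p => ?_
  have hz := zyg s (fun i => c i * e2 i p) (fun i => i.1 * a + i.2 * b) (fun t => P (p.1 + a * t, p.2 + b * t))
    (fun t => by rw [← TP_slice, hP]) (fun t => hP1 _) (fun t => by
      have := Q_re s hs c hc a b (p.1 + a * t, p.2 + b * t)
      rw [TP_slice] at this
      simpa only [mul_assoc] using this)
  have hsl : Continuous (fun t : ℝ => (p.1 + a * t, p.2 + b * t)) := by fun_prop
  have hq : ∀ t : ℝ, TP s (fun i => ((i.1 * a + i.2 * b).sign : ℂ) * c i) (p.1 + a * t, p.2 + b * t)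
     = ∑ i ∈ s, ((i.1 * a + i.2 * b).sign : ℂ) * (c i * e2 i p) * ex (i.1 * a + i.2 * b) t := by
    intro t; rw [TP_slice]; simp only [mul_assoc]
  simp only [← hq] at hz
  have hc1 : Continuous (fun t : ℝ => P (p.1 + a * t, p.2 + b * t)) := hPc.comp hsl
  have hc2 : Continuous (fun t : ℝ => Th (P (p.1 + a * t, p.2 + b * t))) := hThc.comp hsl
  have hc3 : Continuous (fun t : ℝ => TP s (fun i => ((i.1 * a + i.2 * b).sign : ℂ) * c i) (p.1 + a * t, p.2 + b * t)) :=
    (TP_continuous _ _).comp hsl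
  have hc4 : Continuous (fun t : ℝ => Real.log (P (p.1 + a * t, p.2 + b * t))) := hc1.log fun t => by linarith [hP1 (p.1 + a * t, p.2 + b * t)]
  have hc5 : IntegrableOn (fun t : ℝ => 6 * Th (P (p.1 + a * t, p.2 + b * t))) T1 := cont_intOn_T1_real (continuous_const.mul hc2)
  have hz2 := hz.trans (integral_mono (cont_intOn_T1_real (by fun_prop)) hc5
    (fun t => Th_bd _ (hP1 _)))
  have hz3 := ENNReal.ofReal_le_ofReal hz2
  rw [ofReal_integral_eq_lintegral_ofReal (cont_intOn_T1_real hc3.norm) (ae_of_all _ fun t => norm_nonneg _),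
    integral_const_mul, ENNReal.ofReal_mul (by norm_num),
    ofReal_integral_eq_lintegral_ofReal (cont_intOn_T1_real hc2) (ae_of_all _ fun t => Th_nonneg _ (by linarith [hP1 (p.1 + a * t, p.2 + b * t)]))] at hz3
  simp only [ofReal_norm] at hz3
  simpa using hz3

/-- multiplier -/
def sg (n : ℕ) (m : ℤ) : ℤ := if |m| ≤ n then m.sign else 0

lemma sin_ex (j : ℤ) (u : ℝ) : ((Real.sin (j * u) : ℝ) : ℂ) = (ex (-j) u - ex j u) * Complex.I / 2 := by
  unfold ex
  push_cast
  unfold Complex.sin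
  congr 3 <;> [congr 1; congr 1] <;> ring_nf

lemma EE_mult (n : ℕ) (m : ℤ) : ∫ u in T1, ex (-m) u * (EE n u : ℂ) = - (Real.pi * Complex.I) * (sg n m : ℂ) := by
  induction n with
  | zero =>
    simp [EE, sg]
  | succ n ih =>
    have h1 : ∀ u, ex (-m) u * (EE (n + 1) u : ℂ) = ex (-m) u * (EE n u : ℂ)
       + (ex (-m + -(n + 1 : ℤ)) u - ex (-m + (n + 1 : ℤ)) u) * (Complex.I / 2) := by
      intro u
      rw [ex_add, ex_add]
      have := sin_ex (n + 1) u
      unfold EE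
      rw [Finset.sum_range_succ]
      push_cast at this ⊢
      rw [this]; ring
    simp only [h1]
    have i1 : IntegrableOn (fun u => ex (-m) u * (EE n u : ℂ)) T1 :=
      cont_intOn_T1 ((ex_continuous _).mul (Complex.continuous_ofReal.comp (EE_continuous n)))
    have i2 : IntegrableOn (fun u => (ex (-m + -(n + 1 : ℤ)) u - ex (-m + (n + 1 : ℤ)) u) * (Complex.I / 2)) T1 :=
      cont_intOn_T1 (((ex_continuous _).sub (ex_continuous _)).mul continuous_const)
    rw [integral_add i1 i2, ih, integral_mul_const, integral_sub (cont_intOn_T1 (ex_continuous _)) (cont_intOn_T1 (ex_continuous _)),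
      ex_int, ex_int]
    have hsg : (sg (n + 1) m : ℤ) = sg n m + (if -m + (n + 1 : ℤ) = 0 then 1 else 0) - (if -m + -(n + 1 : ℤ) = 0 then 1 else 0) := by
      unfold sg
      push_cast
      by_cases h1 : -m + (n + 1 : ℤ) = 0
      · have : m = n + 1 := by omega
        subst this
        have h2 : |(n : ℤ) + 1| = n + 1 := abs_of_nonneg (by omega)
        have h3 : ((n : ℤ) + 1).sign = 1 := Int.sign_eq_one_of_pos (by omega)
        rw [h2, h3, if_pos le_rfl, if_neg (by omega), if_pos h1, if_neg (by omega)]; rfl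
      by_cases h4 : -m + -(n + 1 : ℤ) = 0
      · have : m = -(n + 1) := by omega
        subst this
        have h2 : |-((n : ℤ) + 1)| = n + 1 := by rw [abs_neg]; exact abs_of_nonneg (by omega)
        have h3 : (-((n : ℤ) + 1)).sign = -1 := Int.sign_eq_neg_one_of_neg (by omega)
        rw [h2, h3, if_pos le_rfl, if_neg (by omega), if_neg h1, if_pos h4]; rfl
      · rw [if_neg h1, if_neg h4]
        have : |m| ≤ (n : ℤ) + 1 ↔ |m| ≤ (n : ℤ) := by
          constructor
          · intro h
            rw [abs_le] at h ⊢; omega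
          · intro h; omega
        simp only [this]; ring
    rw [hsg]
    push_cast
    split_ifs <;> ring

lemma Tk_slice (s : Finset (ℤ × ℤ)) (d : ℤ × ℤ → ℂ) (a b : ℤ) (p : ℝ × ℝ) (n : ℕ) (t : ℝ) :
    Tk (fun t => TP s d (p.1 + a * t, p.2 + b * t)) n t
      = -(Real.pi * Complex.I) * TP s (fun i => (sg n (i.1 * a + i.2 * b) : ℂ) * d i) (p.1 + a * t, p.2 + b * t) := by
  unfold Tk
  simp only [TP_slice]
  have h : ∀ u, (∑ i ∈ s, (d i * e2 i p) * ex (i.1 * a + i.2 * b) (t - u)) * (EE n u : ℂ)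
     = ∑ i ∈ s, ((d i * e2 i p) * ex (i.1 * a + i.2 * b) t) * (ex (-(i.1 * a + i.2 * b)) u * (EE n u : ℂ)) := by
    intro u
    rw [Finset.sum_mul]
    refine Finset.sum_congr rfl fun i _ => ?_
    rw [ex_sub', ex_conj]; ring
  simp only [h]
  have hi : ∀ i ∈ s, Integrable (fun u => ((d i * e2 i p) * ex (i.1 * a + i.2 * b) t) * (ex (-(i.1 * a + i.2 * b)) u * (EE n u : ℂ))) (volume.restrict T1) :=
    fun i _ => cont_intOn_T1 (continuous_const.mul ((ex_continuous _).mul (Complex.continuous_ofReal.comp (EE_continuous n))))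
  rw [integral_finsetSum _ hi, Finset.mul_sum]
  refine Finset.sum_congr rfl fun i _ => ?_
  rw [integral_const_mul, EE_mult]; ring

lemma OscBad_open (c : ℝ) (F : ℕ → ℝ × ℝ → ℂ) (hF : ∀ n, Continuous (F n)) : MeasurableSet {p | OscBad c (fun n => F n p)} := by
  have : {p | OscBad c (fun n => F n p)} = ⋃ a : ℕ, ⋃ N : ℕ, ⋃ _ : 1 ≤ N,
     {p | c * N ^ 2 < ∑ i ∈ Finset.range N, ∑ j ∈ Finset.range N, ‖F (a + i) p - F (a + j) p‖} := by
    ext p; simp [OscBad]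
  rw [this]
  refine (isOpen_iUnion fun a => isOpen_iUnion fun N => isOpen_iUnion fun _ => isOpen_lt continuous_const ?_).measurableSet
  exact continuous_finsetSum _ fun i _ => continuous_finsetSum _ fun j _ => ((hF _).sub (hF _)).norm

lemma rodin_dir (s : Finset (ℤ × ℤ)) (d : ℤ × ℤ → ℂ) (a b : ℤ) (lam : ℝ) (hlam : 0 < lam) :
    ENNReal.ofReal lam * volume (T2 ∩ {p | OscBad (64 * lam)
      (fun n => -(Real.pi * Complex.I) * TP s (fun i => (sg n (i.1 * a + i.2 * b) : ℂ) * d i) p)})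
      ≤ 14 * ∫⁻ p in T2, ‖TP s d p‖ₑ := by
  refine transfer_set a b _ _ (OscBad_open _ _ fun n => continuous_const.mul (TP_continuous _ _)) (TP_continuous _ _).enorm.measurable
    (fun x y => ?_) (fun x y => ?_) (fun x y => by rw [TP_perx]) (fun x y => by rw [TP_pery]) 14 (by norm_num) lam fun p => ?_
  · simp only [Set.mem_ofPred_eq, Pi.mul_apply, TP_perx]
  · simp only [Set.mem_ofPred_eq, Pi.mul_apply, TP_pery]
  · have hsl : Continuous (fun t : ℝ => (p.1 + a * t, p.2 + b * t)) := by fun_prop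
    have := rodin (fun t => TP s d (p.1 + a * t, p.2 + b * t)) ((TP_continuous _ _).comp hsl) (by
      intro t
      simp only [TP_slice, ex_periodic]) lam hlam
    simp only [Tk_slice] at this
    exact this

lemma sgid (n : ℕ) (m k : ℤ) (h : ¬ (m = 0 ∧ k = 0)) :
    2 * (if |m| ≤ n ∧ |k| ≤ n then (1:ℤ) else 0)
      = sg n m * ((m + k).sign + (m - k).sign) + sg n k * ((m + k).sign - (m - k).sign) := by
  have hs : ∀ z : ℤ, (0 < z ∧ z.sign = 1) ∨ (z < 0 ∧ z.sign = -1) ∨ (z = 0 ∧ z.sign = 0) := by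
    intro z
    rcases lt_trichotomy z 0 with h | h | h
    · right; left; exact ⟨h, Int.sign_eq_neg_one_of_neg h⟩
    · right; right; subst h; simp
    · left; exact ⟨h, Int.sign_eq_one_of_pos h⟩
  unfold sg
  simp only [abs_le]
  rcases hs m with ⟨h1, e1⟩ | ⟨h1, e1⟩ | ⟨h1, e1⟩ <;>
  rcases hs k with ⟨h2, e2⟩ | ⟨h2, e2⟩ | ⟨h2, e2⟩ <;>
  rcases hs (m + k) with ⟨h3, e3⟩ | ⟨h3, e3⟩ | ⟨h3, e3⟩ <;>
  rcases hs (m - k) with ⟨h4, e4⟩ | ⟨h4, e4⟩ | ⟨h4, e4⟩ <;>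
  first
  | omega
  | (rw [e1, e2, e3, e4]; split_ifs <;> omega)

def Sq (s : Finset (ℤ × ℤ)) (c : ℤ × ℤ → ℂ) (n : ℕ) (p : ℝ × ℝ) : ℂ :=
  TP s (fun i => if |i.1| ≤ n ∧ |i.2| ≤ n then c i else 0) p

lemma Sq_diff (s : Finset (ℤ × ℤ)) (c : ℤ × ℤ → ℂ) (n l : ℕ) (p : ℝ × ℝ) :
    2 * (Sq s c n p - Sq s c l p) =
     (TP s (fun i => (sg n (i.1 * 1 + i.2 * 0) : ℂ) * ((((i.1 * 1 + i.2 * 1).sign : ℂ) + ((i.1 * 1 + i.2 * (-1)).sign : ℂ)) * c i)) p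
     - TP s (fun i => (sg l (i.1 * 1 + i.2 * 0) : ℂ) * ((((i.1 * 1 + i.2 * 1).sign : ℂ) + ((i.1 * 1 + i.2 * (-1)).sign : ℂ)) * c i)) p)
     + (TP s (fun i => (sg n (i.1 * 0 + i.2 * 1) : ℂ) * ((((i.1 * 1 + i.2 * 1).sign : ℂ) - ((i.1 * 1 + i.2 * (-1)).sign : ℂ)) * c i)) p
     - TP s (fun i => (sg l (i.1 * 0 + i.2 * 1) : ℂ) * ((((i.1 * 1 + i.2 * 1).sign : ℂ) - ((i.1 * 1 + i.2 * (-1)).sign : ℂ)) * c i)) p) := by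
  unfold Sq TP
  rw [← Finset.sum_sub_distrib, ← Finset.sum_sub_distrib, ← Finset.sum_sub_distrib, ← Finset.sum_add_distrib, Finset.mul_sum]
  refine Finset.sum_congr rfl fun i _ => ?_
  by_cases h : i.1 = 0 ∧ i.2 = 0
  · simp [h.1, h.2]
  · have e : ∀ n : ℕ, 2 * (if |i.1| ≤ (n:ℤ) ∧ |i.2| ≤ (n:ℤ) then c i else 0) =
       ((sg n i.1 : ℂ) * ((((i.1 + i.2).sign : ℤ) : ℂ) + (((i.1 - i.2).sign : ℤ) : ℂ))
       + (sg n i.2 : ℂ) * ((((i.1 + i.2).sign : ℤ) : ℂ) - (((i.1 - i.2).sign : ℤ) : ℂ))) * c i := by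
      intro n
      have := congrArg (fun z : ℤ => (z : ℂ)) (sgid n i.1 i.2 h)
      push_cast at this
      rw [← this]
      split_ifs <;> simp
    simp only [mul_one, mul_zero, add_zero, zero_add, mul_neg, ← sub_eq_add_neg]
    have e1 := e n
    have e2' := e l
    linear_combination (e1 - e2') * e2 i p

lemma OscBad_split (C : ℝ) (S A B : ℕ → ℂ)
    (h : ∀ n l, ‖S n - S l‖ ≤ (‖A n - A l‖ + ‖B n - B l‖) / 2) (hS : OscBad C S) : OscBad C A ∨ OscBad C B := by
  obtain ⟨a, N, hN, hlt⟩ := hS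
  by_contra hcon
  push Not at hcon
  obtain ⟨h1, h2⟩ := hcon
  unfold OscBad at h1 h2
  push Not at h1 h2
  have h1 := h1 a N hN
  have h2 := h2 a N hN
  have h3 : ∑ i ∈ Finset.range N, ∑ j ∈ Finset.range N, ‖S (a + i) - S (a + j)‖
     ≤ ∑ i ∈ Finset.range N, ∑ j ∈ Finset.range N, (‖A (a + i) - A (a + j)‖ + ‖B (a + i) - B (a + j)‖) / 2 :=
    Finset.sum_le_sum fun i _ => Finset.sum_le_sum fun j _ => h _ _
  simp only [← Finset.sum_div, Finset.sum_add_distrib] at h3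
  linarith

lemma TP_add (s) (c d : ℤ × ℤ → ℂ) (p) : TP s (fun i => c i + d i) p = TP s c p + TP s d p := by
  unfold TP; rw [← Finset.sum_add_distrib]; exact Finset.sum_congr rfl fun i _ => by ring
lemma TP_sub (s) (c d : ℤ × ℤ → ℂ) (p) : TP s (fun i => c i - d i) p = TP s c p - TP s d p := by
  unfold TP; rw [← Finset.sum_sub_distrib]; exact Finset.sum_congr rfl fun i _ => by ring

lemma half_norm (S S' a a' b b' : ℂ) (h : 2 * (S - S') = (a - a') + (b - b')) :
    ‖S - S'‖ ≤ (‖-((Real.pi : ℂ) * Complex.I) * a - -((Real.pi : ℂ) * Complex.I) * a'‖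
      + ‖-((Real.pi : ℂ) * Complex.I) * b - -((Real.pi : ℂ) * Complex.I) * b'‖) / 2 := by
  have hd := congrArg norm h
  rw [norm_mul] at hd
  have h2 : ‖(2:ℂ)‖ = 2 := by simp
  rw [h2] at hd
  have hd2 : ‖S - S'‖ * 2 ≤ ‖a - a'‖ + ‖b - b'‖ := by rw [mul_comm, hd]; exact norm_add_le _ _
  rw [← mul_sub, ← mul_sub, norm_mul, norm_mul]
  have hpi : 1 ≤ ‖-((Real.pi : ℂ) * Complex.I)‖ := by
    rw [norm_neg, norm_mul, Complex.norm_I, mul_one, Complex.norm_real, Real.norm_eq_abs, abs_of_pos Real.pi_pos]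
    linarith [Real.pi_gt_three]
  rw [le_div_iff₀ (by norm_num)]
  refine hd2.trans (add_le_add ?_ ?_)
  · exact le_mul_of_one_le_left (norm_nonneg _) hpi
  · exact le_mul_of_one_le_left (norm_nonneg _) hpi

theorem osc_set (s : Finset (ℤ × ℤ)) (hs : ∀ i ∈ s, -i ∈ s) (c : ℤ × ℤ → ℂ) (hc : ∀ i, c (-i) = (starRingEnd ℂ) (c i))
    (P : ℝ × ℝ → ℝ) (hP : ∀ p, TP s c p = (P p : ℂ)) (hP1 : ∀ p, 1 ≤ P p) (lam : ℝ) (hlam : 0 < lam) :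
    ENNReal.ofReal lam * volume (T2 ∩ {p | OscBad (64 * lam) (fun n => Sq s c n p)})
      ≤ 336 * ∫⁻ p in T2, ENNReal.ofReal (Th (P p)) := by
  set I := ∫⁻ p in T2, ENNReal.ofReal (Th (P p))
  set d1 : ℤ × ℤ → ℂ := fun i => (((i.1 * 1 + i.2 * 1).sign : ℂ) + ((i.1 * 1 + i.2 * (-1)).sign : ℂ)) * c i with hd1
  set d2 : ℤ × ℤ → ℂ := fun i => (((i.1 * 1 + i.2 * 1).sign : ℂ) - ((i.1 * 1 + i.2 * (-1)).sign : ℂ)) * c i with hd2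
  have b1 := Q_bound s hs c hc P hP hP1 1 1
  have b2 := Q_bound s hs c hc P hP hP1 1 (-1)
  have m1 : Measurable (fun p => ‖TP s (fun i => ((i.1 * 1 + i.2 * 1).sign : ℂ) * c i) p‖ₑ) := (TP_continuous _ _).enorm.measurable
  have bsum : (∫⁻ p in T2, ‖TP s (fun i => ((i.1 * 1 + i.2 * 1).sign : ℂ) * c i) p‖ₑ)
     + (∫⁻ p in T2, ‖TP s (fun i => ((i.1 * 1 + i.2 * (-1)).sign : ℂ) * c i) p‖ₑ) ≤ 12 * I := by
    calc _ ≤ 6 * I + 6 * I := add_le_add b1 b2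
      _ = 12 * I := by ring
  have n1 : ∫⁻ p in T2, ‖TP s d1 p‖ₑ ≤ 12 * I := by
    refine le_trans ?_ bsum
    rw [← lintegral_add_left m1]
    refine lintegral_mono fun p => ?_
    have : d1 = fun i : ℤ × ℤ => ((i.1 * 1 + i.2 * 1).sign : ℂ) * c i + ((i.1 * 1 + i.2 * (-1)).sign : ℂ) * c i := by
      ext i; simp only [hd1]; ring
    simp only [this, TP_add]
    exact enorm_add_le _ _
  have n2 : ∫⁻ p in T2, ‖TP s d2 p‖ₑ ≤ 12 * I := by
    refine le_trans ?_ bsum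
    rw [← lintegral_add_left m1]
    refine lintegral_mono fun p => ?_
    have : d2 = fun i : ℤ × ℤ => ((i.1 * 1 + i.2 * 1).sign : ℂ) * c i - ((i.1 * 1 + i.2 * (-1)).sign : ℂ) * c i := by
      ext i; simp only [hd2]; ring
    simp only [this, TP_sub]
    exact enorm_sub_le
  have r1 := rodin_dir s d1 1 0 lam hlam
  have r2 := rodin_dir s d2 0 1 lam hlam
  set E1 := {p | OscBad (64 * lam) (fun n => -(Real.pi * Complex.I) * TP s (fun i => (sg n (i.1 * 1 + i.2 * 0) : ℂ) * d1 i) p)} with hE1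
  set E2 := {p | OscBad (64 * lam) (fun n => -(Real.pi * Complex.I) * TP s (fun i => (sg n (i.1 * 0 + i.2 * 1) : ℂ) * d2 i) p)} with hE2
  have hsub : T2 ∩ {p | OscBad (64 * lam) (fun n => Sq s c n p)} ⊆ (T2 ∩ E1) ∪ (T2 ∩ E2) := by
    rintro p ⟨hp, hb⟩
    rw [← inter_union_distrib_left]
    have hb' : OscBad (64 * lam) (fun n => Sq s c n p) := hb
    refine ⟨hp, OscBad_split (64 * lam) (fun n => Sq s c n p)
      (fun n => -(Real.pi * Complex.I) * TP s (fun i => (sg n (i.1 * 1 + i.2 * 0) : ℂ) * d1 i) p)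
      (fun n => -(Real.pi * Complex.I) * TP s (fun i => (sg n (i.1 * 0 + i.2 * 1) : ℂ) * d2 i) p) (fun n l => ?_) hb'⟩
    exact half_norm _ _ _ _ _ _ (Sq_diff s c n l p)
  calc _ ≤ ENNReal.ofReal lam * (volume (T2 ∩ E1) + volume (T2 ∩ E2)) := by
        gcongr; exact (measure_mono hsub).trans (measure_union_le _ _)
    _ = ENNReal.ofReal lam * volume (T2 ∩ E1) + ENNReal.ofReal lam * volume (T2 ∩ E2) := mul_add _ _ _
    _ ≤ 14 * (12 * I) + 14 * (12 * I) := by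
        refine add_le_add ?_ ?_
        · refine le_trans ?_ (mul_le_mul_right n1 14)
          simpa using r1
        · refine le_trans ?_ (mul_le_mul_right n2 14)
          simpa using r2
    _ = 336 * I := by ring

lemma pois_dir (ρ : ℝ) (h0 : 0 ≤ ρ) (h1 : ρ < 1) (s : Finset (ℤ × ℤ)) (d : ℤ × ℤ → ℂ) (D : ℝ × ℝ → ℝ)
    (hD : ∀ q, TP s d q = (D q : ℂ)) (a b : ℤ) (p : ℝ × ℝ) (t : ℝ) :
    TP s (fun i => (ρ : ℂ) ^ (i.1 * a + i.2 * b).natAbs * d i) (p.1 + a * t, p.2 + b * t)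
      = ((Pconv ρ (fun t => D (p.1 + a * t, p.2 + b * t)) t : ℝ) : ℂ) := by
  unfold Pconv
  rw [Complex.ofReal_mul]
  have e1 : ((∫ u in T1, Pk ρ u * D (p.1 + a * (t - u), p.2 + b * (t - u)) : ℝ) : ℂ)
     = ∫ u in T1, ((Pk ρ u * D (p.1 + a * (t - u), p.2 + b * (t - u)) : ℝ) : ℂ) := integral_ofReal.symm
  rw [e1]
  have h : ∀ u, ((Pk ρ u * D (p.1 + a * (t - u), p.2 + b * (t - u)) : ℝ) : ℂ)
     = ∑ i ∈ s, ((d i * e2 i p) * ex (i.1 * a + i.2 * b) t) * ((Pk ρ u : ℂ) * ex (-(i.1 * a + i.2 * b)) u) := by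
    intro u
    push_cast
    rw [← hD]
    have := TP_slice s d p a b (t - u)
    rw [this, Finset.mul_sum]
    refine Finset.sum_congr rfl fun i _ => ?_
    rw [ex_sub', ex_conj]; ring
  simp only [h]
  have hi : ∀ i ∈ s, Integrable (fun u => ((d i * e2 i p) * ex (i.1 * a + i.2 * b) t) * ((Pk ρ u : ℂ) * ex (-(i.1 * a + i.2 * b)) u)) (volume.restrict T1) :=
    fun i _ => cont_intOn_T1 (continuous_const.mul ((Complex.continuous_ofReal.comp (Pk_continuous ρ h0 h1)).mul (ex_continuous _)))
  rw [integral_finsetSum _ hi, Finset.mul_sum, TP_slice]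
  refine Finset.sum_congr rfl fun i _ => ?_
  rw [integral_const_mul, Pk_coef ρ h0 h1, Int.natAbs_neg]
  have := Real.pi_pos
  push_cast
  field_simp

lemma pois_pt (ρ : ℝ) (h0 : 0 ≤ ρ) (h1 : ρ < 1) (s : Finset (ℤ × ℤ)) (d : ℤ × ℤ → ℂ) (D : ℝ × ℝ → ℝ)
    (hD : ∀ q, TP s d q = (D q : ℂ)) (a b : ℤ) (p : ℝ × ℝ) :
    TP s (fun i => (ρ : ℂ) ^ (i.1 * a + i.2 * b).natAbs * d i) p
      = ((Pconv ρ (fun t => D (p.1 + a * t, p.2 + b * t)) 0 : ℝ) : ℂ) := by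
  have := pois_dir ρ h0 h1 s d D hD a b p 0
  simpa using this

lemma Pconv_mono (ρ : ℝ) (h0 : 0 ≤ ρ) (h1 : ρ < 1) (p q : ℝ → ℝ) (hp : Continuous p) (hq : Continuous q) (h : ∀ x, p x ≤ q x) (x : ℝ) :
    Pconv ρ p x ≤ Pconv ρ q x := by
  unfold Pconv
  have := Real.pi_pos
  refine mul_le_mul_of_nonneg_left (integral_mono (cont_intOn_T1_real ((Pk_continuous ρ h0 h1).mul (hp.comp (by fun_prop))))
    (cont_intOn_T1_real ((Pk_continuous ρ h0 h1).mul (hq.comp (by fun_prop)))) fun u => ?_) (by positivity)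
  exact mul_le_mul_of_nonneg_left (h _) (Pk_nonneg ρ u h0 h1)

lemma Pconv_nonneg (ρ : ℝ) (h0 : 0 ≤ ρ) (h1 : ρ < 1) (p : ℝ → ℝ) (h : ∀ x, 0 ≤ p x) (x : ℝ) :
    0 ≤ Pconv ρ p x := by
  unfold Pconv
  have := Real.pi_pos
  exact mul_nonneg (by positivity) (integral_nonneg fun u => mul_nonneg (Pk_nonneg ρ u h0 h1) (h _))

theorem anchor_set (s : Finset (ℤ × ℤ)) (c : ℤ × ℤ → ℂ)
    (P : ℝ × ℝ → ℝ) (hP : ∀ p, TP s c p = (P p : ℂ)) (hP1 : ∀ p, 1 ≤ P p) (lam : ℝ) (hlam : 0 < lam)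
    (ρ : ℕ → ℝ) (h0 : ∀ n, 1 / 2 ≤ ρ n) (h1 : ∀ n, ρ n < 1) (n0 : ℕ) :
    ENNReal.ofReal lam * volume (T2 ∩ {p | ∃ n ∈ Finset.range (n0 + 1), 7 * lam <
       ‖TP s (fun i => (ρ n : ℂ) ^ (i.1 * 1 + i.2 * (-1)).natAbs * ((ρ n : ℂ) ^ (i.1 * 1 + i.2 * 1).natAbs * c i)) p‖})
      ≤ 2800 * ∫⁻ p in T2, ENNReal.ofReal (Th (P p)) := by
  have h0' : ∀ n, 0 ≤ ρ n := fun n => by linarith [h0 n]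
  have hPc := TP_real_cont s c P hP
  have hPp := TP_real_per s c P hP
  have hThc := Th_cont P hPc fun p => by linarith [hP1 p]
  set U : ℕ → ℝ × ℝ → ℝ := fun n p => Pconv (ρ n) (fun t => P (p.1 + (1:ℤ) * t, p.2 + (1:ℤ) * t)) 0 with hU
  have hU1 : ∀ n p, TP s (fun i => (ρ n : ℂ) ^ (i.1 * 1 + i.2 * 1).natAbs * c i) p = (U n p : ℂ) :=
    fun n p => pois_pt (ρ n) (h0' n) (h1 n) s c P hP 1 1 p
  have hUs : ∀ n (p : ℝ × ℝ) (t : ℝ), U n (p.1 + (1:ℤ) * t, p.2 + (1:ℤ) * t)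
      = Pconv (ρ n) (fun t => P (p.1 + (1:ℤ) * t, p.2 + (1:ℤ) * t)) t := by
    intro n p t
    apply Complex.ofReal_injective
    rw [← hU1, pois_dir (ρ n) (h0' n) (h1 n) s c P hP 1 1 p t]
  have hU0 : ∀ n p, 0 ≤ U n p := fun n p => Pconv_nonneg _ (h0' n) (h1 n) _ (fun t => by linarith [hP1 (p.1 + (1:ℤ) * t, p.2 + (1:ℤ) * t)]) _
  have hUc : ∀ n, Continuous (U n) := fun n => TP_real_cont s _ (U n) (hU1 n)
  have hUp : ∀ n, _ := fun n => TP_real_per s _ (U n) (hU1 n)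
  have hne : (Finset.range (n0 + 1)).Nonempty := ⟨0, by simp⟩
  set W : ℝ × ℝ → ℝ := fun p => (Finset.range (n0 + 1)).sup' hne (fun n => U n p) with hW
  have hWc : Continuous W := Continuous.finset_sup'_apply hne fun n _ => hUc n
  have hWU : ∀ n ∈ Finset.range (n0 + 1), ∀ p, U n p ≤ W p := fun n hn p => Finset.le_sup' (fun n => U n p) hn
  have hW0 : ∀ p, 0 ≤ W p := fun p => (hU0 0 p).trans (hWU 0 (by simp) p)
  have hWx : ∀ x y, W (x + 2 * Real.pi, y) = W (x, y) := fun x y => by simp only [hW, fun n => (hUp n).1 x y]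
  have hWy : ∀ x y, W (x, y + 2 * Real.pi) = W (x, y) := fun x y => by simp only [hW, fun n => (hUp n).2 x y]
  -- step 1
  have hWI : ∫⁻ p in T2, ENNReal.ofReal (W p) ≤ 280 * ∫⁻ p in T2, ENNReal.ofReal (Th (P p)) := by
    refine transfer_le ((1:ℤ):ℝ) ((1:ℤ):ℝ) _ _ hWc.measurable.ennreal_ofReal hThc.measurable.ennreal_ofReal
      (fun x y => by rw [hWx]) (fun x y => by rw [hWy]) (fun x y => by rw [hPp.1]) (fun x y => by rw [hPp.2])
      280 (by norm_num) fun p => ?_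
    have hsl : Continuous (fun t : ℝ => (p.1 + (1:ℤ) * t, p.2 + (1:ℤ) * t)) := by fun_prop
    have hm := max_LlogL (fun t => P (p.1 + (1:ℤ) * t, p.2 + (1:ℤ) * t)) (hPc.comp hsl)
      (fun t => by linarith [hP1 (p.1 + (1:ℤ) * t, p.2 + (1:ℤ) * t)])
      (by
        intro t
        apply Complex.ofReal_injective
        simp only [← hP, TP_slice, ex_periodic])
      (fun t => W (p.1 + (1:ℤ) * t, p.2 + (1:ℤ) * t)) (hWc.comp hsl) (fun t => hW0 _) (by
        intro l hl x hx
        refine Finset.sup'_le _ _ fun n _ => ?_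
        rw [hUs]
        exact Pconv_Om (ρ n) (h0 n) (h1 n) _ (hPc.comp hsl) (fun t => zero_le_one.trans (hP1 _)) l hl x hx)
    have hge : (1 : ENNReal) ≤ ∫⁻ t in T1, ENNReal.ofReal (Th (P (p.1 + (1:ℤ) * t, p.2 + (1:ℤ) * t))) := by
      calc (1 : ENNReal) ≤ ENNReal.ofReal (2 * Real.pi) := by
            rw [ENNReal.one_le_ofReal]; linarith [Real.pi_gt_three]
        _ = ∫⁻ t in T1, 1 := by rw [setLIntegral_one, volume_T1]
        _ ≤ _ := by
            refine lintegral_mono fun t => ?_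
            rw [ENNReal.one_le_ofReal]
            have := Th_bd _ (hP1 (p.1 + (1:ℤ) * t, p.2 + (1:ℤ) * t))
            have h2 := hP1 (p.1 + (1:ℤ) * t, p.2 + (1:ℤ) * t)
            unfold Th
            have h3 : Real.log 2 ≤ Real.log (1 + P (p.1 + (1:ℤ) * t, p.2 + (1:ℤ) * t)) := Real.log_le_log (by norm_num) (by linarith)
            have h4 := Real.log_two_gt_d9
            nlinarith
    refine hm.trans ?_
    calc _ ≤ 140 * ((∫⁻ t in T1, ENNReal.ofReal (Th (P (p.1 + (1:ℤ) * t, p.2 + (1:ℤ) * t)))) + ∫⁻ t in T1, ENNReal.ofReal (Th (P (p.1 + (1:ℤ) * t, p.2 + (1:ℤ) * t)))) := by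
          gcongr; exact le_rfl
      _ = _ := by ring
  -- step 2
  have hA : ENNReal.ofReal lam * volume (T2 ∩ {p | ∃ n ∈ Finset.range (n0 + 1), 7 * lam <
       ‖TP s (fun i => (ρ n : ℂ) ^ (i.1 * 1 + i.2 * (-1)).natAbs * ((ρ n : ℂ) ^ (i.1 * 1 + i.2 * 1).natAbs * c i)) p‖})
      ≤ 10 * ∫⁻ p in T2, ENNReal.ofReal (W p) := by
    refine transfer_set ((1:ℤ):ℝ) ((-1:ℤ):ℝ) _ _ ?_ hWc.measurable.ennreal_ofReal
      (fun x y => by simp only [Set.mem_ofPred_eq, TP_perx]) (fun x y => by simp only [Set.mem_ofPred_eq, TP_pery])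
      (fun x y => by rw [hWx]) (fun x y => by rw [hWy]) 10 (by norm_num) lam fun p => ?_
    · have : {p | ∃ n ∈ Finset.range (n0 + 1), 7 * lam <
       ‖TP s (fun i => (ρ n : ℂ) ^ (i.1 * 1 + i.2 * (-1)).natAbs * ((ρ n : ℂ) ^ (i.1 * 1 + i.2 * 1).natAbs * c i)) p‖}
         = ⋃ n ∈ Finset.range (n0 + 1), {p | 7 * lam <
       ‖TP s (fun i => (ρ n : ℂ) ^ (i.1 * 1 + i.2 * (-1)).natAbs * ((ρ n : ℂ) ^ (i.1 * 1 + i.2 * 1).natAbs * c i)) p‖} := by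
        ext p; simp
      rw [this]
      exact (isOpen_biUnion fun n _ => isOpen_lt continuous_const (TP_continuous _ _).norm).measurableSet
    · have hsl : Continuous (fun t : ℝ => (p.1 + (1:ℤ) * t, p.2 + (-1:ℤ) * t)) := by fun_prop
      have hper : Function.Periodic (fun t : ℝ => ENNReal.ofReal (W (p.1 + (1:ℤ) * t, p.2 + (-1:ℤ) * t))) (2 * Real.pi) := by
        intro t
        have : ∀ n, U n (p.1 + (1:ℤ) * (t + 2 * Real.pi), p.2 + (-1:ℤ) * (t + 2 * Real.pi)) = U n (p.1 + (1:ℤ) * t, p.2 + (-1:ℤ) * t) := by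
          intro n
          apply Complex.ofReal_injective
          simp only [← hU1, TP_slice, ex_periodic]
        simp only [hW, this]
      have := HL_weak _ hper lam hlam
      refine le_trans ?_ this
      gcongr
      rintro t ⟨n, hn, ht⟩
      by_contra hcon
      have hle := Pconv_Om (ρ n) (h0 n) (h1 n) _ (hWc.comp hsl) (fun t => hW0 _) lam hlam t hcon
      have hmono := Pconv_mono (ρ n) (h0' n) (h1 n) _ _ ((hUc n).comp hsl) (hWc.comp hsl) (fun t => hWU n hn _) t
      have e := pois_dir (ρ n) (h0' n) (h1 n) s _ (U n) (hU1 n) 1 (-1) p t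
      have e' : ‖TP s (fun i => (ρ n : ℂ) ^ (i.1 * 1 + i.2 * (-1)).natAbs * ((ρ n : ℂ) ^ (i.1 * 1 + i.2 * 1).natAbs * c i)) (p.1 + (1:ℤ) * t, p.2 + (-1:ℤ) * t)‖
         ≤ 7 * lam := by
        rw [e, Complex.norm_real, Real.norm_eq_abs, abs_of_nonneg (Pconv_nonneg _ (h0' n) (h1 n) _ (fun t => hU0 n _) _)]
        exact hmono.trans hle
      linarith
  refine hA.trans ?_
  calc _ ≤ 10 * (280 * ∫⁻ p in T2, ENNReal.ofReal (Th (P p))) := by gcongr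
    _ = _ := by rw [← mul_assoc]; norm_num

lemma abel_id (r : ℝ) (d D : ℕ → ℝ) (hD : ∀ k, D (k + 1) = D k + d k) (h0 : D 0 = 0) (K : ℕ) :
    ∑ k ∈ Finset.range K, r ^ k * d k = r ^ K * D K + (1 - r) * ∑ k ∈ Finset.range K, r ^ k * D (k + 1) := by
  induction K with
  | zero => simp [h0]
  | succ K ih =>
    rw [Finset.sum_range_succ, Finset.sum_range_succ, ih, hD]; ring

lemma geom2 (r : ℝ) (h0 : 0 ≤ r) (h1 : r < 1) (K : ℕ) :
    ∑ k ∈ Finset.range K, r ^ k * (2 * (k : ℝ) + 1) ≤ 2 / (1 - r) ^ 2 := by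
  have h : 0 < 1 - r := by linarith
  have key : ∀ K : ℕ, ∑ k ∈ Finset.range K, r ^ k * (2 * (k : ℝ) + 1) ≤ 2 / (1 - r) ^ 2 - r ^ K * (2 / (1 - r) ^ 2 + (2 * (K:ℝ) - 1) / (1 - r)) := by
    intro K
    induction K with
    | zero =>
      simp
      have : 0 ≤ (1 - r)⁻¹ := by positivity
      have e : (-1 : ℝ) / (1 - r) = - (1 - r)⁻¹ := by field_simp
      rw [e]; linarith
    | succ K ih =>
      rw [Finset.sum_range_succ]
      refine (add_le_add_left ih _).trans ?_
      have hk : 0 ≤ r ^ K := by positivity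
      have : r ^ K * (2 * (K : ℝ) + 1) ≤ r ^ K * ((2 / (1 - r) ^ 2 + (2 * (K:ℝ) - 1) / (1 - r)) - r * (2 / (1 - r) ^ 2 + (2 * (K + 1:ℝ) - 1) / (1 - r))) := by
        refine mul_le_mul_of_nonneg_left (le_of_eq ?_) hk
        field_simp; ring
      rw [pow_succ r K]; push_cast
      linarith
  refine (key K).trans ?_
  have hk : 0 ≤ r ^ K := by positivity
  have : 0 ≤ 2 / (1 - r) ^ 2 + (2 * (K:ℝ) - 1) / (1 - r) := by
    have e : 2 / (1 - r) ^ 2 + (2 * (K:ℝ) - 1) / (1 - r) = (2 + (2 * K - 1) * (1 - r)) / (1 - r) ^ 2 := by field_simp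
    rw [e]
    have : (0:ℝ) ≤ K := by positivity
    have : 0 ≤ 2 + (2 * (K:ℝ) - 1) * (1 - r) := by nlinarith
    positivity
  nlinarith [mul_nonneg hk this]

lemma disc_anchor (ξ : ℕ → ℂ) (N : ℕ) (hN : 1 ≤ N) (r : ℝ) (hr0 : 0 ≤ r) (hr1 : 3 / 4 ≤ (1 - r) * N) (hr2 : (1 - r) * N ≤ 1)
    (A : ℂ) (hA : HasSum (fun k => ((1 - r : ℝ) : ℂ) * (r : ℂ) ^ k * ξ k) A) (C : ℝ) (hC : 0 ≤ C)
    (hosc : ∀ M : ℕ, 1 ≤ M → ∑ i ∈ Finset.range M, ∑ j ∈ Finset.range M, ‖ξ i - ξ j‖ ≤ C * M ^ 2) :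
    ‖∑ k ∈ Finset.range N, ξ k‖ ≤ (‖A‖ + 4 * C) * N := by
  have hN0 : (0:ℝ) < N := by exact_mod_cast hN
  have hr : 0 < 1 - r := by
    by_contra h; push Not at h
    nlinarith
  set b : ℂ := (N : ℂ)⁻¹ * ∑ k ∈ Finset.range N, ξ k with hb
  have hNc : (N : ℂ) ≠ 0 := by exact_mod_cast hN0.ne'
  -- pointwise
  have hd : ∀ i, ‖ξ i - b‖ ≤ (N : ℝ)⁻¹ * ∑ j ∈ Finset.range N, ‖ξ i - ξ j‖ := by
    intro i
    have : ξ i - b = (N : ℂ)⁻¹ * ∑ j ∈ Finset.range N, (ξ i - ξ j) := by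
      rw [Finset.sum_sub_distrib, mul_sub, ← hb]; simp [hNc]
    rw [this, norm_mul, norm_inv, Complex.norm_natCast]
    gcongr
    exact norm_sum_le _ _
  set D : ℕ → ℝ := fun L => ∑ i ∈ Finset.range L, ‖ξ i - b‖ with hD
  have hDb : ∀ L, D L ≤ C * (N + L ^ 2 / N) := by
    intro L
    set M := max L N with hM
    have hLM : Finset.range L ⊆ Finset.range M := Finset.range_mono (le_max_left _ _)
    have hNM : Finset.range N ⊆ Finset.range M := Finset.range_mono (le_max_right _ _)
    have h1 : D L ≤ (N : ℝ)⁻¹ * (C * M ^ 2) := by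
      calc D L ≤ ∑ i ∈ Finset.range M, ‖ξ i - b‖ := Finset.sum_le_sum_of_subset_of_nonneg hLM fun _ _ _ => norm_nonneg _
        _ ≤ ∑ i ∈ Finset.range M, (N : ℝ)⁻¹ * ∑ j ∈ Finset.range M, ‖ξ i - ξ j‖ := by
            refine Finset.sum_le_sum fun i _ => (hd i).trans ?_
            gcongr
        _ = (N : ℝ)⁻¹ * ∑ i ∈ Finset.range M, ∑ j ∈ Finset.range M, ‖ξ i - ξ j‖ := by rw [Finset.mul_sum]
        _ ≤ _ := by gcongr; exact hosc M (hN.trans (le_max_right _ _))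
    have h2 : (M : ℝ) ^ 2 ≤ N ^ 2 + L ^ 2 := by
      rcases le_total L N with h | h
      · rw [hM, max_eq_right h]; nlinarith
      · rw [hM, max_eq_left h]; nlinarith
    calc D L ≤ (N : ℝ)⁻¹ * (C * M ^ 2) := h1
      _ ≤ (N : ℝ)⁻¹ * (C * (N ^ 2 + L ^ 2)) := by gcongr
      _ = _ := by field_simp
  have hsum : ∀ K, ∑ k ∈ Finset.range K, r ^ k * ‖ξ k - b‖ ≤ C * (N + 2 / (1 - r) ^ 2 / N) := by
    intro K
    rw [abel_id r (fun k => ‖ξ k - b‖) D (fun k => Finset.sum_range_succ _ _) (by simp [hD]) K]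
    set D' : ℕ → ℝ := fun L => C * ((L:ℝ) ^ 2 / N) with hD'
    have h1 : ∑ k ∈ Finset.range K, r ^ k * (C * ((2 * (k : ℝ) + 1) / N)) = r ^ K * D' K + (1 - r) * ∑ k ∈ Finset.range K, r ^ k * D' (k + 1) :=
      abel_id r _ D' (fun k => by simp only [hD']; push_cast; field_simp; ring) (by simp [hD']) K
    have h2 : r ^ K * D K + (1 - r) * ∑ k ∈ Finset.range K, r ^ k * D (k + 1)
       ≤ r ^ K * (C * N + D' K) + (1 - r) * ∑ k ∈ Finset.range K, r ^ k * (C * N + D' (k + 1)) := by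
      have e : ∀ L : ℕ, D L ≤ C * N + D' L := fun L => by rw [← mul_add]; exact hDb L
      gcongr
      · exact e K
      · exact e _
    have h3 : r ^ K * (C * N + D' K) + (1 - r) * ∑ k ∈ Finset.range K, r ^ k * (C * N + D' (k + 1))
       = C * N * (r ^ K + (1 - r) * ∑ k ∈ Finset.range K, r ^ k) + (r ^ K * D' K + (1 - r) * ∑ k ∈ Finset.range K, r ^ k * D' (k + 1)) := by
      simp only [mul_add, Finset.sum_add_distrib, ← Finset.sum_mul]; ring
    have h4 : r ^ K + (1 - r) * ∑ k ∈ Finset.range K, r ^ k = 1 := by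
      have := mul_neg_geom_sum r K
      linarith
    have h5 : ∑ k ∈ Finset.range K, r ^ k * (C * ((2 * (k : ℝ) + 1) / N)) = C / N * ∑ k ∈ Finset.range K, r ^ k * (2 * (k : ℝ) + 1) := by
      rw [Finset.mul_sum]; refine Finset.sum_congr rfl fun k _ => by field_simp
    rw [h4, ← h1, h5] at h3
    rw [h3] at h2
    refine h2.trans ?_
    calc _ ≤ C * N * 1 + C / N * (2 / (1 - r) ^ 2) := by gcongr; exact geom2 r hr0 (by linarith) K
      _ = _ := by ring
  have hB : HasSum (fun k => ((1 - r : ℝ) : ℂ) * (r : ℂ) ^ k * b) b := by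
    have h1 := (hasSum_geometric_of_lt_one hr0 (by linarith : r < 1))
    have h2 := (Complex.hasSum_ofReal.2 h1)
    have h3 := (h2.mul_left ((1 - r : ℝ) : ℂ)).mul_right b
    have e : ((1 - r : ℝ) : ℂ) * (((1 - r)⁻¹ : ℝ) : ℂ) * b = b := by
      rw [← Complex.ofReal_mul, mul_inv_cancel₀ hr.ne']; simp
    rw [e] at h3
    simpa using h3
  have hAB := (hA.sub hB).tendsto_sum_nat
  have hfin : ‖A - b‖ ≤ 4 * C := by
    refine le_of_tendsto hAB.norm (Eventually.of_forall fun K => ?_)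
    calc ‖∑ k ∈ Finset.range K, (((1 - r : ℝ) : ℂ) * (r : ℂ) ^ k * ξ k - ((1 - r : ℝ) : ℂ) * (r : ℂ) ^ k * b)‖
        ≤ ∑ k ∈ Finset.range K, (1 - r) * (r ^ k * ‖ξ k - b‖) := by
          refine (norm_sum_le _ _).trans (Finset.sum_le_sum fun k _ => le_of_eq ?_)
          rw [← mul_sub, norm_mul, norm_mul, norm_pow, Complex.norm_real, Complex.norm_real, Real.norm_of_nonneg hr.le, Real.norm_of_nonneg hr0]; ring
      _ = (1 - r) * ∑ k ∈ Finset.range K, r ^ k * ‖ξ k - b‖ := by rw [Finset.mul_sum]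
      _ ≤ (1 - r) * (C * (N + 2 / (1 - r) ^ 2 / N)) := by gcongr; exact hsum K
      _ = C * ((1 - r) * N + 2 / ((1 - r) * N)) := by field_simp
      _ ≤ C * 4 := by
          gcongr
          have : 2 / ((1 - r) * N) ≤ 3 := by rw [div_le_iff₀ (by positivity)]; linarith
          linarith
      _ = 4 * C := by ring
  have h6 : ‖b‖ ≤ ‖A‖ + 4 * C := by
    have := norm_sub_norm_le b A
    rw [norm_sub_rev] at this
    linarith
  have h7 : ∑ k ∈ Finset.range N, ξ k = N * b := by rw [hb]; field_simp
  rw [h7, norm_mul, Complex.norm_natCast, mul_comm]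
  gcongr

lemma abel_Sq (s : Finset (ℤ × ℤ)) (c : ℤ × ℤ → ℂ) (p : ℝ × ℝ) (ρ : ℝ) (h0 : 0 ≤ ρ) (h1 : ρ < 1) :
    HasSum (fun k => ((1 - ρ ^ 2 : ℝ) : ℂ) * ((ρ ^ 2 : ℝ) : ℂ) ^ k * Sq s c k p)
     (TP s (fun i => (ρ : ℂ) ^ (i.1 * 1 + i.2 * (-1)).natAbs * ((ρ : ℂ) ^ (i.1 * 1 + i.2 * 1).natAbs * c i)) p) := by
  have hr : ρ ^ 2 < 1 := by nlinarith
  unfold Sq TP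
  simp only [Finset.mul_sum]
  refine hasSum_sum fun i _ => ?_
  set j := max i.1.natAbs i.2.natAbs with hj
  have e1 : (i.1 * 1 + i.2 * (-1)).natAbs + (i.1 * 1 + i.2 * 1).natAbs = 2 * j := by omega
  have e2' : ∀ k : ℕ, (|i.1| ≤ (k:ℤ) ∧ |i.2| ≤ (k:ℤ)) ↔ j ≤ k := by
    intro k; rw [Int.abs_eq_natAbs, Int.abs_eq_natAbs]; omega
  have g1 : HasSum (fun k : ℕ => (ρ ^ 2) ^ k) (1 - ρ ^ 2)⁻¹ := hasSum_geometric_of_lt_one (by positivity) hr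
  have g2 : HasSum (fun k : ℕ => if j ≤ k then (ρ ^ 2) ^ k else 0) ((1 - ρ ^ 2)⁻¹ * (ρ ^ 2) ^ j) := by
    rw [← hasSum_nat_add_iff' j]
    have : ∑ i ∈ Finset.range j, (if j ≤ i then (ρ ^ 2) ^ i else 0) = 0 :=
      Finset.sum_eq_zero fun i hi => if_neg (by simpa using hi)
    rw [this, sub_zero]
    simp only [le_add_iff_nonneg_left, zero_le, if_true, pow_add]
    exact g1.mul_right _
  have g3 := ((Complex.hasSum_ofReal.2 g2).mul_left ((1 - ρ ^ 2 : ℝ) : ℂ)).mul_right (c i * e2 i p)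
  have hne : ((1 - ρ ^ 2 : ℝ)) ≠ 0 := by linarith
  have ev : ((1 - ρ ^ 2 : ℝ) : ℂ) * (((1 - ρ ^ 2)⁻¹ * (ρ ^ 2) ^ j : ℝ) : ℂ) * (c i * e2 i p)
      = (ρ : ℂ) ^ (i.1 * 1 + i.2 * (-1)).natAbs * ((ρ : ℂ) ^ (i.1 * 1 + i.2 * 1).natAbs * c i) * e2 i p := by
    rw [← Complex.ofReal_mul, mul_inv_cancel_left₀ hne]
    have e3 := pow_add (ρ : ℂ) (i.1 * 1 + i.2 * (-1)).natAbs (i.1 * 1 + i.2 * 1).natAbs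
    rw [e1, pow_mul] at e3
    push_cast; rw [e3]; ring
  rw [ev] at g3
  have ef : (fun k : ℕ => ((1 - ρ ^ 2 : ℝ) : ℂ) * ((ρ ^ 2 : ℝ) : ℂ) ^ k * ((if |i.1| ≤ (k:ℤ) ∧ |i.2| ≤ (k:ℤ) then c i else 0) * e2 i p))
      = fun k : ℕ => ((1 - ρ ^ 2 : ℝ) : ℂ) * ((if j ≤ k then (ρ ^ 2) ^ k else 0 : ℝ) : ℂ) * (c i * e2 i p) := by
    ext k
    simp only [e2']
    split_ifs
    · push_cast; ring
    · simp
  rw [ef]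
  exact g3

def Bad (n0 : ℕ) (lam : ℝ) (ξ : ℕ → ℂ) : Prop :=
  (∃ a M : ℕ, 1 ≤ M ∧ a + M ≤ n0 + 1 ∧ lam * M ^ 2 < ∑ i ∈ Finset.range M, ∑ j ∈ Finset.range M, ‖ξ (a + i) - ξ (a + j)‖)
  ∨ (∃ n ≤ n0, lam * ((n : ℝ) + 1) < ‖∑ k ∈ Finset.range (n + 1), ξ k‖)

theorem main_poly (s : Finset (ℤ × ℤ)) (hs : ∀ i ∈ s, -i ∈ s) (c : ℤ × ℤ → ℂ) (hc : ∀ i, c (-i) = (starRingEnd ℂ) (c i))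
    (P : ℝ × ℝ → ℝ) (hP : ∀ p, TP s c p = (P p : ℂ)) (hP1 : ∀ p, 1 ≤ P p) (lam : ℝ) (hlam : 0 < lam) (n0 : ℕ) :
    ENNReal.ofReal lam * volume (T2 ∩ {p | Bad n0 (263 * lam) (fun n => Sq s c n p)})
      ≤ 3136 * ∫⁻ p in T2, ENNReal.ofReal (Th (P p)) := by
  set I := ∫⁻ p in T2, ENNReal.ofReal (Th (P p))
  have b1 := osc_set s hs c hc P hP hP1 lam hlam
  set ρ : ℕ → ℝ := fun n => 1 - 1 / (2 * ((n:ℝ) + 1)) with hρ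
  have hρ0 : ∀ n, 1 / 2 ≤ ρ n := by
    intro n
    have : 1 / (2 * ((n:ℝ) + 1)) ≤ 1 / 2 := by
      apply one_div_le_one_div_of_le (by norm_num)
      have : (0:ℝ) ≤ n := by positivity
      linarith
    simp only [hρ]; linarith
  have hρ1 : ∀ n, ρ n < 1 := by
    intro n
    have : 0 < 1 / (2 * ((n:ℝ) + 1)) := by positivity
    simp only [hρ]; linarith
  have b2 := anchor_set s c P hP hP1 lam hlam ρ hρ0 hρ1 n0
  set E1 := {p | OscBad (64 * lam) (fun n => Sq s c n p)} with hE1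
  set E2 := {p | ∃ n ∈ Finset.range (n0 + 1), 7 * lam <
       ‖TP s (fun i => (ρ n : ℂ) ^ (i.1 * 1 + i.2 * (-1)).natAbs * ((ρ n : ℂ) ^ (i.1 * 1 + i.2 * 1).natAbs * c i)) p‖} with hE2
  have hsub : T2 ∩ {p | Bad n0 (263 * lam) (fun n => Sq s c n p)} ⊆ (T2 ∩ E1) ∪ (T2 ∩ E2) := by
    rintro p ⟨hp, hb⟩
    rw [← inter_union_distrib_left]
    refine ⟨hp, ?_⟩
    by_contra hcon
    rw [mem_union] at hcon
    push Not at hcon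
    obtain ⟨h1, h2⟩ := hcon
    have h1' : ¬ OscBad (64 * lam) (fun n => Sq s c n p) := h1
    unfold OscBad at h1'
    push Not at h1'
    have h2' : ¬ ∃ n ∈ Finset.range (n0 + 1), 7 * lam <
       ‖TP s (fun i => (ρ n : ℂ) ^ (i.1 * 1 + i.2 * (-1)).natAbs * ((ρ n : ℂ) ^ (i.1 * 1 + i.2 * 1).natAbs * c i)) p‖ := h2
    push Not at h2'
    rcases hb with ⟨a, M, hM, _, hlt⟩ | ⟨n, hn, hlt⟩
    · have := h1' a M hM
      have : (0:ℝ) ≤ lam * M ^ 2 := by positivity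
      linarith
    · have hh := disc_anchor (fun k => Sq s c k p) (n + 1) (by omega) (ρ n ^ 2) (by positivity)
        (by
          have : (0:ℝ) < (n:ℝ) + 1 := by positivity
          simp only [hρ]; push_cast
          have e : (1 - (1 - 1 / (2 * ((n:ℝ) + 1))) ^ 2) * ((n:ℝ) + 1) = 1 - 1 / (4 * ((n:ℝ) + 1)) := by field_simp; ring
          rw [e]
          have : 1 / (4 * ((n:ℝ) + 1)) ≤ 1 / 4 := by
            apply one_div_le_one_div_of_le (by norm_num)
            have : (0:ℝ) ≤ n := by positivity
            linarith
          linarith)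
        (by
          have : (0:ℝ) < (n:ℝ) + 1 := by positivity
          simp only [hρ]; push_cast
          have e : (1 - (1 - 1 / (2 * ((n:ℝ) + 1))) ^ 2) * ((n:ℝ) + 1) = 1 - 1 / (4 * ((n:ℝ) + 1)) := by field_simp; ring
          rw [e]
          have : 0 ≤ 1 / (4 * ((n:ℝ) + 1)) := by positivity
          linarith) _ (abel_Sq s c p (ρ n) (by linarith [hρ0 n]) (hρ1 n)) (64 * lam) (by positivity)
        (fun M hM => by simpa using h1' 0 M hM)
      have h3 := h2' n (by simp; omega)
      have : (0:ℝ) < (n:ℝ) + 1 := by positivity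
      push_cast at hh
      have h4 : ‖∑ k ∈ Finset.range (n + 1), Sq s c k p‖ ≤ (7 * lam + 4 * (64 * lam)) * ((n:ℝ) + 1) := by
        refine hh.trans ?_
        gcongr
      linarith
  calc _ ≤ ENNReal.ofReal lam * (volume (T2 ∩ E1) + volume (T2 ∩ E2)) := by
        gcongr; exact (measure_mono hsub).trans (measure_union_le _ _)
    _ = ENNReal.ofReal lam * volume (T2 ∩ E1) + ENNReal.ofReal lam * volume (T2 ∩ E2) := mul_add _ _ _
    _ ≤ 336 * I + 2800 * I := add_le_add b1 b2
    _ = 3136 * I := by ring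

def wk (n : ℕ) (α β : ℝ) (k : ℕ) : ℝ := volume.real (Ico α β ∩ {t : ℝ | ⌊((n:ℝ) + 1) * t⌋₊ = k})

lemma step_eq (ξ : ℕ → ℝ) (n : ℕ) (t : ℝ) (h0 : 0 ≤ t) (h1 : t ≤ 1) (ht : ∀ k : ℕ, ((n:ℝ) + 1) * t ≠ k) :
    stepFun ξ n t = ξ ⌊((n:ℝ) + 1) * t⌋₊ := by
  have hn : (0:ℝ) < (n:ℝ) + 1 := by positivity
  have hx : 0 ≤ ((n:ℝ) + 1) * t := by positivity
  have hlt : ⌊((n:ℝ) + 1) * t⌋₊ < n + 1 := by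
    rw [Nat.floor_lt hx]
    have : ((n:ℝ) + 1) * t ≠ (n + 1 : ℕ) := ht _
    push_cast at this ⊢
    exact lt_of_le_of_ne (by nlinarith) this
  unfold stepFun
  rw [Finset.sum_eq_single ⌊((n:ℝ) + 1) * t⌋₊]
  · rw [indicator_of_mem]
    rw [mem_Icc, div_le_iff₀ hn, le_div_iff₀ hn]
    have := Nat.floor_le hx
    have := (Nat.lt_floor_add_one (((n:ℝ) + 1) * t)).le
    constructor <;> linarith
  · intro k _ hk
    rw [indicator_of_notMem]
    rintro ⟨h3, h4⟩
    rw [div_le_iff₀ hn] at h3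
    rw [le_div_iff₀ hn] at h4
    apply hk
    symm
    rw [Nat.floor_eq_iff hx]
    refine ⟨by linarith, lt_of_le_of_ne (by linarith) ?_⟩
    have := ht (k + 1)
    push_cast at this; exact this
  · intro h; simp at h; omega

lemma step_ae (ξ : ℕ → ℝ) (n : ℕ) (α β : ℝ) (hα : 0 ≤ α) (hβ : β ≤ 1) :
    ∀ᵐ t ∂(volume.restrict (Icc α β)), stepFun ξ n t = ξ ⌊((n:ℝ) + 1) * t⌋₊ := by
  have hn : (0:ℝ) < (n:ℝ) + 1 := by positivity
  rw [ae_restrict_iff' measurableSet_Icc]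
  have hc : (range (fun k : ℕ => (k:ℝ) / ((n:ℝ) + 1))).Countable := countable_range _
  filter_upwards [hc.ae_notMem volume] with t ht hI
  refine step_eq ξ n t (hα.trans hI.1) (hI.2.trans hβ) fun k hk => ht ⟨k, ?_⟩
  simp only
  rw [← hk]; field_simp

lemma step_int (ξ : ℕ → ℝ) (n : ℕ) (α β : ℝ) (hα : 0 ≤ α) (hβ : β ≤ 1) (F : ℝ → ℝ) :
    ∫ t in Icc α β, F (stepFun ξ n t) = ∑ k ∈ Finset.range (n + 1), wk n α β k * F (ξ k) := by
  have hn : (0:ℝ) < (n:ℝ) + 1 := by positivity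
  have e1 : ∫ t in Icc α β, F (stepFun ξ n t) = ∫ t in Icc α β, F (ξ ⌊((n:ℝ) + 1) * t⌋₊) := by
    apply integral_congr_ae
    filter_upwards [step_ae ξ n α β hα hβ] with t ht
    rw [ht]
  rw [e1, integral_Icc_eq_integral_Ico]
  have hm : ∀ k : ℕ, MeasurableSet (Ico α β ∩ {t : ℝ | ⌊((n:ℝ) + 1) * t⌋₊ = k}) := by
    intro k
    refine measurableSet_Ico.inter ?_
    have : Measurable (fun t : ℝ => ⌊((n:ℝ) + 1) * t⌋₊) := Nat.measurable_floor.comp (by fun_prop)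
    exact this (measurableSet_singleton k)
  have hU : Ico α β = ⋃ k ∈ Finset.range (n + 1), (Ico α β ∩ {t : ℝ | ⌊((n:ℝ) + 1) * t⌋₊ = k}) := by
    ext t
    simp only [mem_iUnion, mem_inter_iff, Finset.mem_range, Set.mem_ofPred_eq, exists_prop]
    constructor
    · intro h
      refine ⟨_, ?_, h, rfl⟩
      rw [Nat.floor_lt (by have := hα.trans h.1; positivity)]
      push_cast
      have : t < 1 := h.2.trans_le hβ
      nlinarith
    · rintro ⟨k, _, h, _⟩; exact h
  conv_lhs => rw [hU]
  have hcongr : ∀ k, ∀ t ∈ (Ico α β ∩ {t : ℝ | ⌊((n:ℝ) + 1) * t⌋₊ = k}), F (ξ ⌊((n:ℝ) + 1) * t⌋₊) = F (ξ k) := by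
    rintro k t ⟨_, h⟩
    rw [Set.mem_ofPred_eq] at h
    rw [h]
  rw [integral_biUnion_finset _ (fun k _ => hm k)]
  · refine Finset.sum_congr rfl fun k _ => ?_
    rw [setIntegral_congr_fun (hm k) (hcongr k), setIntegral_const]
    rfl
  · intro i _ j _ hij
    rw [Function.onFun, Set.disjoint_left]
    rintro t ⟨_, h⟩ ⟨_, h'⟩
    rw [Set.mem_ofPred_eq] at h h'
    exact hij (h.symm.trans h')
  · intro k _
    refine IntegrableOn.congr_fun (f := fun _ => F (ξ k)) ?_ (fun t ht => (hcongr k t ht).symm) (hm k)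
    refine integrableOn_const ?_
    exact (measure_mono inter_subset_left |>.trans_lt (by simp)).ne

lemma wk_nonneg (n α β k) : 0 ≤ wk n α β k := measureReal_nonneg

lemma wk_sub (n : ℕ) (α β : ℝ) (hα : 0 ≤ α) (k : ℕ) (t : ℝ) (ht : t ∈ Ico α β ∩ {t : ℝ | ⌊((n:ℝ) + 1) * t⌋₊ = k}) :
    (k : ℝ) ≤ ((n:ℝ) + 1) * t ∧ ((n:ℝ) + 1) * t < k + 1 := by
  obtain ⟨h1, h2⟩ := ht
  rw [Set.mem_ofPred_eq, Nat.floor_eq_iff (by have := hα.trans h1.1; positivity)] at h2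
  exact h2

lemma wk_le (n : ℕ) (α β : ℝ) (hα : 0 ≤ α) (k : ℕ) : wk n α β k ≤ 1 / ((n:ℝ) + 1) := by
  have hn : (0:ℝ) < (n:ℝ) + 1 := by positivity
  have : Ico α β ∩ {t : ℝ | ⌊((n:ℝ) + 1) * t⌋₊ = k} ⊆ Ico ((k:ℝ) / ((n:ℝ) + 1)) (((k:ℝ) + 1) / ((n:ℝ) + 1)) := by
    intro t ht
    have := wk_sub n α β hα k t ht
    rw [mem_Ico, div_le_iff₀ hn, lt_div_iff₀ hn]
    constructor <;> linarith
  refine (measureReal_mono this (by simp)).trans (le_of_eq ?_)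
  rw [Real.volume_real_Ico_of_le (by gcongr; linarith)]
  field_simp; ring

lemma wk_zero_left (n : ℕ) (α β : ℝ) (hα : 0 ≤ α) (k : ℕ) (h : (k:ℝ) + 1 ≤ ((n:ℝ) + 1) * α) : wk n α β k = 0 := by
  have : Ico α β ∩ {t : ℝ | ⌊((n:ℝ) + 1) * t⌋₊ = k} = ∅ := by
    ext t
    simp only [mem_empty_iff_false, iff_false]
    intro ht
    have h2 := wk_sub n α β hα k t ht
    have : ((n:ℝ) + 1) * α ≤ ((n:ℝ) + 1) * t := by gcongr; exact ht.1.1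
    linarith
  unfold wk; rw [this]; simp

lemma wk_zero_right (n : ℕ) (α β : ℝ) (hα : 0 ≤ α) (k : ℕ) (h : ((n:ℝ) + 1) * β ≤ k) : wk n α β k = 0 := by
  have : Ico α β ∩ {t : ℝ | ⌊((n:ℝ) + 1) * t⌋₊ = k} = ∅ := by
    ext t
    simp only [mem_empty_iff_false, iff_false]
    intro ht
    have h2 := wk_sub n α β hα k t ht
    have : ((n:ℝ) + 1) * t < ((n:ℝ) + 1) * β := by gcongr; exact ht.1.2
    linarith
  unfold wk; rw [this]; simp

lemma osc_term (n0 : ℕ) (lam : ℝ) (hlam : 0 ≤ lam) (ξ : ℕ → ℝ)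
    (h : ∀ a M : ℕ, 1 ≤ M → a + M ≤ n0 + 1 → ∑ i ∈ Finset.range M, ∑ j ∈ Finset.range M, |ξ (a + i) - ξ (a + j)| ≤ lam * M ^ 2)
    (n : ℕ) (hn : n ≤ n0) (α β : ℝ) (hα : 0 ≤ α) (hαβ : α < β) (hβ : β ≤ 1) :
    (β - α)⁻¹ * ∫ t in Icc α β, |stepFun ξ n t - (β - α)⁻¹ * ∫ s in Icc α β, stepFun ξ n s| ≤ 9 * lam := by
  have hn1 : (0:ℝ) < (n:ℝ) + 1 := by positivity
  have hI : 0 < β - α := by linarith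
  set w := wk n α β with hw
  set a := ⌊((n:ℝ) + 1) * α⌋₊ with ha
  set b := ⌈((n:ℝ) + 1) * β⌉₊ with hb
  have hNα : 0 ≤ ((n:ℝ) + 1) * α := by positivity
  have ha1 : (a:ℝ) ≤ ((n:ℝ) + 1) * α := Nat.floor_le hNα
  have ha2 : ((n:ℝ) + 1) * α < a + 1 := Nat.lt_floor_add_one _
  have hb1 : ((n:ℝ) + 1) * β ≤ b := Nat.le_ceil _
  have hb2 : (b:ℝ) < ((n:ℝ) + 1) * β + 1 := Nat.ceil_lt_add_one (by nlinarith)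
  have hNlt : ((n:ℝ) + 1) * α < ((n:ℝ) + 1) * β := by gcongr
  have hab : a < b := by
    have : (a:ℝ) < b := by linarith
    exact_mod_cast this
  have hbn : b ≤ n + 1 := by
    rw [hb, Nat.ceil_le]; push_cast; nlinarith
  obtain ⟨M, hM⟩ : ∃ M, b = a + M := ⟨b - a, by omega⟩
  have hM1 : 1 ≤ M := by omega
  have hred : ∀ f : ℕ → ℝ, ∑ k ∈ Finset.range (n + 1), w k * f k = ∑ i ∈ Finset.range M, w (a + i) * f (a + i) := by
    intro f
    have : ∑ k ∈ Finset.Ico a b, w k * f k = ∑ i ∈ Finset.range M, w (a + i) * f (a + i) := by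
      rw [Finset.sum_Ico_eq_sum_range, hM]; simp
    rw [← this]
    symm
    apply Finset.sum_subset
    · intro k hk; simp at hk ⊢; omega
    · intro k _ hk
      simp only [Finset.mem_Ico, not_and, not_lt] at hk
      have : w k = 0 := by
        by_cases hka : a ≤ k
        · have : (b:ℝ) ≤ k := by exact_mod_cast hk hka
          exact wk_zero_right n α β hα k (by linarith)
        · have : (k:ℝ) + 1 ≤ a := by exact_mod_cast (by omega : k + 1 ≤ a)
          exact wk_zero_left n α β hα k (by linarith)
      rw [this, zero_mul]
  have hw0 : ∀ k, 0 ≤ w k := wk_nonneg n α β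
  have hwl : ∀ k, w k ≤ 1 / ((n:ℝ) + 1) := wk_le n α β hα
  have hone : ∑ i ∈ Finset.range M, w (a + i) = β - α := by
    have h1 := step_int ξ n α β hα hβ (fun _ => 1)
    rw [hred] at h1
    simp only [mul_one] at h1
    rw [← h1]
    simp [hαβ.le]
  have hmean : ∫ s in Icc α β, stepFun ξ n s = ∑ i ∈ Finset.range M, w (a + i) * ξ (a + i) := by
    have h1 := step_int ξ n α β hα hβ (fun x => x)
    rw [hred] at h1; exact h1
  rw [hmean]
  set m := (β - α)⁻¹ * ∑ i ∈ Finset.range M, w (a + i) * ξ (a + i) with hm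
  have h1 := step_int ξ n α β hα hβ (fun x => |x - m|)
  rw [hred] at h1
  rw [h1]
  have hpt : ∀ i, |ξ (a + i) - m| ≤ (β - α)⁻¹ * ∑ j ∈ Finset.range M, w (a + j) * |ξ (a + i) - ξ (a + j)| := by
    intro i
    have : ξ (a + i) - m = (β - α)⁻¹ * ∑ j ∈ Finset.range M, w (a + j) * (ξ (a + i) - ξ (a + j)) := by
      simp only [mul_sub, Finset.sum_sub_distrib, ← Finset.sum_mul]
      rw [hone, ← mul_assoc, inv_mul_cancel₀ hI.ne', one_mul]
    rw [this, abs_mul, abs_of_pos (inv_pos.2 hI)]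
    gcongr
    refine (Finset.abs_sum_le_sum_abs _ _).trans (Finset.sum_le_sum fun j _ => ?_)
    rw [abs_mul, abs_of_nonneg (hw0 _)]
  have hstep : (β - α)⁻¹ * ∑ i ∈ Finset.range M, w (a + i) * |ξ (a + i) - m|
     ≤ (β - α)⁻¹ ^ 2 * ∑ i ∈ Finset.range M, ∑ j ∈ Finset.range M, w (a + i) * w (a + j) * |ξ (a + i) - ξ (a + j)| := by
    rw [pow_two, mul_assoc]
    gcongr
    rw [Finset.mul_sum]
    refine Finset.sum_le_sum fun i _ => ?_
    calc w (a + i) * |ξ (a + i) - m| ≤ w (a + i) * ((β - α)⁻¹ * ∑ j ∈ Finset.range M, w (a + j) * |ξ (a + i) - ξ (a + j)|) :=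
          mul_le_mul_of_nonneg_left (hpt i) (hw0 _)
      _ = _ := by
          rw [Finset.mul_sum, Finset.mul_sum, Finset.mul_sum]; exact Finset.sum_congr rfl fun j _ => by ring
  refine hstep.trans ?_
  have hosc := h a M hM1 (by omega)
  by_cases hM3 : 3 ≤ M
  · have hlen : (M:ℝ) / (3 * ((n:ℝ) + 1)) ≤ β - α := by
      rw [div_le_iff₀ (by positivity)]
      have e : (b:ℝ) = a + M := by exact_mod_cast hM
      have : (3:ℝ) ≤ M := by exact_mod_cast hM3
      nlinarith
    have hM0 : (0:ℝ) < M := by exact_mod_cast hM1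
    calc _ ≤ (β - α)⁻¹ ^ 2 * ∑ i ∈ Finset.range M, ∑ j ∈ Finset.range M, (1 / ((n:ℝ) + 1)) * (1 / ((n:ℝ) + 1)) * |ξ (a + i) - ξ (a + j)| := by
          gcongr with i _ j _
          · exact hw0 _
          · exact hwl _
          · exact hwl _
      _ = (β - α)⁻¹ ^ 2 * ((1 / ((n:ℝ) + 1)) * (1 / ((n:ℝ) + 1)) * ∑ i ∈ Finset.range M, ∑ j ∈ Finset.range M, |ξ (a + i) - ξ (a + j)|) := by
          simp only [← Finset.mul_sum]
      _ ≤ ((M:ℝ) / (3 * ((n:ℝ) + 1)))⁻¹ ^ 2 * ((1 / ((n:ℝ) + 1)) * (1 / ((n:ℝ) + 1)) * (lam * M ^ 2)) := by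
          gcongr
      _ = 9 * lam := by field_simp; ring
  · have hM2 : M ≤ 2 := by omega
    have hM2' : (M:ℝ) ≤ 2 := by exact_mod_cast hM2
    have hmax : ∀ i ∈ Finset.range M, ∀ j ∈ Finset.range M, |ξ (a + i) - ξ (a + j)| ≤ 4 * lam := by
      intro i hi j hj
      calc |ξ (a + i) - ξ (a + j)| ≤ ∑ j ∈ Finset.range M, |ξ (a + i) - ξ (a + j)| :=
            Finset.single_le_sum (f := fun j => |ξ (a + i) - ξ (a + j)|) (fun _ _ => abs_nonneg _) hj
        _ ≤ ∑ i ∈ Finset.range M, ∑ j ∈ Finset.range M, |ξ (a + i) - ξ (a + j)| :=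
            Finset.single_le_sum (f := fun i => ∑ j ∈ Finset.range M, |ξ (a + i) - ξ (a + j)|) (fun _ _ => Finset.sum_nonneg fun _ _ => abs_nonneg _) hi
        _ ≤ lam * M ^ 2 := hosc
        _ ≤ lam * 2 ^ 2 := by gcongr
        _ = 4 * lam := by ring
    calc _ ≤ (β - α)⁻¹ ^ 2 * ∑ i ∈ Finset.range M, ∑ j ∈ Finset.range M, w (a + i) * w (a + j) * (4 * lam) := by
          refine mul_le_mul_of_nonneg_left (Finset.sum_le_sum fun i hi => Finset.sum_le_sum fun j hj => ?_) (by positivity)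
          exact mul_le_mul_of_nonneg_left (hmax i hi j hj) (mul_nonneg (hw0 _) (hw0 _))
      _ = (β - α)⁻¹ ^ 2 * ((β - α) * (β - α) * (4 * lam)) := by
          simp only [← Finset.sum_mul, ← Finset.mul_sum, hone]
      _ = 4 * lam := by field_simp
      _ ≤ 9 * lam := by linarith

lemma bmo_of_not_bad (n0 : ℕ) (lam : ℝ) (hlam : 0 ≤ lam) (ξ : ℕ → ℝ) (h : ¬ Bad n0 lam (fun k => (ξ k : ℂ)))
    (n : ℕ) (hn : n ≤ n0) : bmoNorm (stepFun ξ n) ≤ 10 * lam := by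
  unfold Bad at h
  push Not at h
  obtain ⟨h1, h2⟩ := h
  have hn1 : (0:ℝ) < (n:ℝ) + 1 := by positivity
  have hnorm : ∀ a b : ℝ, ‖(a:ℂ) - (b:ℂ)‖ = |a - b| := fun a b => by rw [← Complex.ofReal_sub, Complex.norm_real, Real.norm_eq_abs]
  simp only [hnorm] at h1
  unfold bmoNorm
  have hne : Nonempty {p : ℝ × ℝ // 0 ≤ p.1 ∧ p.1 < p.2 ∧ p.2 ≤ 1} := ⟨⟨(0, 1), by norm_num⟩⟩
  have e1 := ciSup_le (f := fun I : {p : ℝ × ℝ // 0 ≤ p.1 ∧ p.1 < p.2 ∧ p.2 ≤ 1} => (I.1.2 - I.1.1)⁻¹ *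
        ∫ t in Set.Icc I.1.1 I.1.2,
          |stepFun ξ n t - (I.1.2 - I.1.1)⁻¹ * ∫ s in Set.Icc I.1.1 I.1.2, stepFun ξ n s|)
      fun I => osc_term n0 lam hlam ξ h1 n hn I.1.1 I.1.2 I.2.1 I.2.2.1 I.2.2.2
  have e2 : |∫ t in Set.Icc (0 : ℝ) 1, stepFun ξ n t| ≤ lam := by
    have hs := step_int ξ n 0 1 le_rfl le_rfl (fun x => x)
    have hw : ∀ k ∈ Finset.range (n + 1), wk n 0 1 k * ξ k = 1 / ((n:ℝ) + 1) * ξ k := by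
      intro k hk
      have hk' : k < n + 1 := by simpa using hk
      have hk2 : (k:ℝ) + 1 ≤ (n:ℝ) + 1 := by exact_mod_cast hk'
      congr 1
      have : Ico (0:ℝ) 1 ∩ {t : ℝ | ⌊((n:ℝ) + 1) * t⌋₊ = k} = Ico ((k:ℝ) / ((n:ℝ) + 1)) (((k:ℝ) + 1) / ((n:ℝ) + 1)) := by
        ext t
        constructor
        · intro ht
          have := wk_sub n 0 1 le_rfl k t ht
          rw [mem_Ico, div_le_iff₀ hn1, lt_div_iff₀ hn1]
          constructor <;> linarith
        · intro ht
          have ht0 : 0 ≤ t := le_trans (by positivity) ht.1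
          rw [mem_Ico, div_le_iff₀ hn1, lt_div_iff₀ hn1] at ht
          refine ⟨⟨ht0, ?_⟩, ?_⟩
          · nlinarith
          · rw [Set.mem_ofPred_eq, Nat.floor_eq_iff (by positivity)]
            constructor <;> linarith
      unfold wk
      rw [this, Real.volume_real_Ico_of_le (by gcongr; linarith)]
      field_simp; ring
    rw [hs, Finset.sum_congr rfl hw, ← Finset.mul_sum, abs_mul, abs_of_pos (by positivity)]
    have := h2 n hn
    rw [← Complex.ofReal_sum, Complex.norm_real, Real.norm_eq_abs] at this
    rw [one_div, inv_mul_le_iff₀ hn1]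
    linarith
  linarith

lemma Icc_step (M : ℕ) : Finset.Icc (-((M + 1 : ℕ) : ℤ)) ((M + 1 : ℕ) : ℤ) =
    insert (-((M : ℤ) + 1)) (insert ((M : ℤ) + 1) (Finset.Icc (-(M : ℤ)) (M : ℤ))) := by
  ext x
  simp only [Finset.mem_Icc, Finset.mem_insert]
  push_cast
  omega

lemma sum_Icc_step (F : ℤ → ℂ) (M : ℕ) : ∑ m ∈ Finset.Icc (-((M + 1 : ℕ) : ℤ)) ((M + 1 : ℕ) : ℤ), F m =
    F (-((M : ℤ) + 1)) + (F ((M : ℤ) + 1) + ∑ m ∈ Finset.Icc (-(M : ℤ)) (M : ℤ), F m) := by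
  rw [Icc_step, Finset.sum_insert, Finset.sum_insert]
  · simp only [Finset.mem_Icc]; omega
  · simp only [Finset.mem_Icc, Finset.mem_insert]; omega

lemma sum_Icc_sym (F : ℤ → ℂ) (M : ℕ) : ∑ m ∈ Finset.Icc (-(M : ℤ)) (M : ℤ), F m =
    F 0 + ∑ k ∈ Finset.range M, F (-((k : ℤ) + 1)) + ∑ k ∈ Finset.range M, F ((k : ℤ) + 1) := by
  induction M with
  | zero => simp
  | succ M ih =>
    rw [sum_Icc_step, ih, Finset.sum_range_succ, Finset.sum_range_succ]
    ring

lemma diag_sum (h : ℤ → ℂ) (M : ℕ) :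
    ∑ p ∈ Finset.range (M + 1), ∑ q ∈ Finset.range (M + 1), h ((p : ℤ) - q) =
      ∑ m ∈ Finset.Icc (-(M : ℤ)) (M : ℤ), (((M : ℝ) + 1 - |(m : ℝ)| : ℝ) : ℂ) * h m := by
  induction M with
  | zero => simp
  | succ M ih =>
    have h1 : ∑ p ∈ Finset.range (M + 1 + 1), ∑ q ∈ Finset.range (M + 1 + 1), h ((p : ℤ) - q) =
        ∑ p ∈ Finset.range (M + 1), ∑ q ∈ Finset.range (M + 1), h ((p : ℤ) - q)
        + (h 0 + ∑ p ∈ Finset.range (M + 1), h (-((p : ℤ) + 1)) + ∑ q ∈ Finset.range (M + 1), h ((q : ℤ) + 1)) := by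
      have e1 : ∑ p ∈ Finset.range (M + 1), h ((p : ℤ) - ((M + 1 : ℕ) : ℤ)) = ∑ p ∈ Finset.range (M + 1), h (-((p : ℤ) + 1)) := by
        rw [← Finset.sum_range_reflect]
        refine Finset.sum_congr rfl fun j hj => ?_
        have := Finset.mem_range.1 hj
        congr 1
        push_cast
        omega
      have e2 : ∑ q ∈ Finset.range (M + 1), h (((M + 1 : ℕ) : ℤ) - (q : ℤ)) = ∑ q ∈ Finset.range (M + 1), h ((q : ℤ) + 1) := by
        rw [← Finset.sum_range_reflect]
        refine Finset.sum_congr rfl fun j hj => ?_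
        have := Finset.mem_range.1 hj
        congr 1
        push_cast
        omega
      rw [Finset.sum_range_succ (n := M + 1)]
      simp_rw [Finset.sum_range_succ (n := M + 1)]
      rw [Finset.sum_add_distrib, e1, e2, sub_self]
      ring
    rw [h1, ih, ← sum_Icc_sym h (M + 1)]
    rw [sum_Icc_step h, sum_Icc_step]
    have e3 : ∑ m ∈ Finset.Icc (-(M : ℤ)) (M : ℤ), ((((M + 1 : ℕ) : ℝ) + 1 - |(m : ℝ)| : ℝ) : ℂ) * h m
        = ∑ m ∈ Finset.Icc (-(M : ℤ)) (M : ℤ), (((M : ℝ) + 1 - |(m : ℝ)| : ℝ) : ℂ) * h m + ∑ m ∈ Finset.Icc (-(M : ℤ)) (M : ℤ), h m := by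
      rw [← Finset.sum_add_distrib]
      refine Finset.sum_congr rfl fun m _ => ?_
      push_cast
      ring
    rw [e3]
    have a1 : |((-((M : ℤ) + 1) : ℤ) : ℝ)| = M + 1 := by
      push_cast; rw [abs_neg, abs_of_nonneg (by positivity)]
    have a2 : |((((M : ℤ) + 1) : ℤ) : ℝ)| = M + 1 := by
      push_cast; rw [abs_of_nonneg (by positivity)]
    rw [a1, a2]
    push_cast
    ring

/-- Fejer multiplier -/
def phi (N : ℕ) (m : ℤ) : ℝ := 1 - |(m : ℝ)| / ((N : ℝ) + 1)

/-- Fejer kernel -/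
def FF (N : ℕ) (u : ℝ) : ℝ := ‖DD (N + 1) u‖ ^ 2 / ((N : ℝ) + 1)

lemma FF_nonneg (N u) : 0 ≤ FF N u := by unfold FF; positivity

lemma FF_cont (N) : Continuous (FF N) := by
  unfold FF
  have := DD_continuous (N + 1)
  fun_prop

lemma FF_neg (N u) : FF N (-u) = FF N u := by unfold FF; rw [DD_norm_neg]

lemma FF_exp (N : ℕ) (u : ℝ) : (FF N u : ℂ) = ∑ m ∈ Finset.Icc (-(N : ℤ)) (N : ℤ), (phi N m : ℂ) * ex m u := by
  have h0 : ((N : ℂ) + 1) ≠ 0 := by exact_mod_cast (Nat.succ_ne_zero N)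
  have h1 : ((‖DD (N + 1) u‖ ^ 2 : ℝ) : ℂ) = ∑ p ∈ Finset.range (N + 1), ∑ q ∈ Finset.range (N + 1), ex ((p : ℤ) - q) u := by
    push_cast
    rw [← Complex.mul_conj', DD, map_sum, Finset.sum_mul_sum]
    refine Finset.sum_congr rfl fun p _ => Finset.sum_congr rfl fun q _ => ?_
    rw [ex_conj, sub_eq_add_neg, ex_add]
  rw [FF, Complex.ofReal_div, h1, diag_sum (fun m => ex m u), Finset.sum_div]
  refine Finset.sum_congr rfl fun m _ => ?_
  unfold phi
  push_cast
  field_simp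

def Kn (N : ℕ) (p q : ℝ × ℝ) : ℝ := FF N (p.1 - q.1) * FF N (p.2 - q.2)

lemma Kn_nonneg (N p q) : 0 ≤ Kn N p q := mul_nonneg (FF_nonneg _ _) (FF_nonneg _ _)

lemma Kn_symm (N p q) : Kn N p q = Kn N q p := by
  unfold Kn
  rw [← FF_neg N (p.1 - q.1), ← FF_neg N (p.2 - q.2), neg_sub, neg_sub]

lemma Kn_cont (N) : Continuous (fun z : (ℝ × ℝ) × (ℝ × ℝ) => Kn N z.1 z.2) := by
  unfold Kn
  have := FF_cont N
  fun_prop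

lemma FF_bdd (N : ℕ) (u : ℝ) : FF N u ≤ (N : ℝ) + 1 := by
  unfold FF
  rw [div_le_iff₀ (by positivity)]
  have := DD_norm_le (N + 1) u
  have h0 := norm_nonneg (DD (N + 1) u)
  push_cast at this
  nlinarith

lemma Kn_bdd (N p q) : ‖Kn N p q‖ ≤ ((N : ℝ) + 1) * ((N : ℝ) + 1) := by
  rw [Real.norm_of_nonneg (Kn_nonneg _ _ _)]
  exact mul_le_mul (FF_bdd _ _) (FF_bdd _ _) (FF_nonneg _ _) (by positivity)

def bx (N : ℕ) : Finset (ℤ × ℤ) := Finset.Icc (-(N : ℤ)) (N : ℤ) ×ˢ Finset.Icc (-(N : ℤ)) (N : ℤ)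

lemma Kn_exp (N : ℕ) (p q : ℝ × ℝ) : (Kn N p q : ℂ) =
    ∑ i ∈ bx N, ((phi N i.1 * phi N i.2 : ℝ) : ℂ) * (e2 i p * (starRingEnd ℂ) (e2 i q)) := by
  unfold Kn bx
  rw [Complex.ofReal_mul, FF_exp, FF_exp, Finset.sum_mul_sum, Finset.sum_product]
  refine Finset.sum_congr rfl fun m _ => Finset.sum_congr rfl fun k _ => ?_
  simp only [e2, ex_sub', map_mul]
  push_cast
  ring

def cf (g : ℝ × ℝ → ℝ) (i : ℤ × ℤ) : ℂ := fourierCoef2 g i.1 i.2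

lemma cf_eq (g : ℝ × ℝ → ℝ) (i : ℤ × ℤ) : cf g i = (1 / (4 * (Real.pi : ℂ) ^ 2)) * ∫ q in T2, (g q : ℂ) * (starRingEnd ℂ) (e2 i q) := by
  unfold cf fourierCoef2
  congr 2
  ext q
  rw [e2_conj, e2, ex, ex, ← Complex.exp_add]
  congr 2
  push_cast [Prod.fst_neg, Prod.snd_neg]
  ring

lemma e2_norm (i p) : ‖e2 i p‖ = 1 := by rw [e2, norm_mul, ex_norm, ex_norm, one_mul]

lemma cf_int (g : ℝ × ℝ → ℝ) (hg : IntegrableOn g T2) (i : ℤ × ℤ) :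
    IntegrableOn (fun q => (g q : ℂ) * (starRingEnd ℂ) (e2 i q)) T2 := by
  refine Integrable.mul_bdd (c := 1) hg.ofReal ?_ ?_
  · exact (Complex.continuous_conj.comp (e2_continuous i)).aestronglyMeasurable
  · exact Eventually.of_forall fun q => by simp [e2_norm]

lemma cf_conj (g : ℝ × ℝ → ℝ) (i : ℤ × ℤ) : cf g (-i) = (starRingEnd ℂ) (cf g i) := by
  rw [cf_eq, cf_eq, map_mul, ← integral_conj]
  congr 1
  · simp
    exact (map_ofNat (starRingEnd ℂ) 4).symm
  · congr 1
    ext q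
    rw [map_mul, Complex.conj_ofReal, Complex.conj_conj, e2_conj, neg_neg]

def gN (N : ℕ) (g : ℝ × ℝ → ℝ) (p : ℝ × ℝ) : ℝ := (1 / (4 * Real.pi ^ 2)) * ∫ q in T2, g q * Kn N p q

lemma gN_TP (N : ℕ) (g : ℝ × ℝ → ℝ) (hg : IntegrableOn g T2) (p : ℝ × ℝ) :
    TP (bx N) (fun i => ((phi N i.1 * phi N i.2 : ℝ) : ℂ) * cf g i) p = (gN N g p : ℂ) := by
  have h1 : ((∫ q in T2, g q * Kn N p q : ℝ) : ℂ) = ∫ q in T2, ((g q * Kn N p q : ℝ) : ℂ) := integral_ofReal.symm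
  unfold gN TP
  rw [Complex.ofReal_mul, h1]
  have h2 : ∀ q, ((g q * Kn N p q : ℝ) : ℂ) = ∑ i ∈ bx N, (((phi N i.1 * phi N i.2 : ℝ) : ℂ) * e2 i p) * ((g q : ℂ) * (starRingEnd ℂ) (e2 i q)) := by
    intro q
    rw [Complex.ofReal_mul, Kn_exp, Finset.mul_sum]
    refine Finset.sum_congr rfl fun i _ => ?_
    ring
  simp_rw [h2]
  rw [integral_finsetSum]
  · rw [Finset.mul_sum]
    refine Finset.sum_congr rfl fun i _ => ?_
    rw [integral_const_mul, cf_eq]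
    push_cast
    ring
  · intro i _
    exact (cf_int g hg i).const_mul _

lemma vol_T2 : volume T2 = ENNReal.ofReal (4 * Real.pi ^ 2) := by
  have : (volume : Measure (ℝ × ℝ)) T2 = volume T1 * volume T1 := by
    rw [T2, Measure.volume_eq_prod, Measure.prod_prod]
  rw [this, volume_T1, ← ENNReal.ofReal_mul (by positivity)]
  congr 1
  ring

lemma T2_fin : IsFiniteMeasure (volume.restrict T2) := ⟨by
  rw [Measure.restrict_apply_univ, vol_T2]; exact ENNReal.ofReal_lt_top⟩

lemma const_int (a : ℝ) : IntegrableOn (fun _ : ℝ × ℝ => a) T2 := by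
  have := T2_fin
  exact integrable_const a

lemma cf_one (i : ℤ × ℤ) : cf (fun _ => 1) i = if i = 0 then 1 else 0 := by
  rw [cf_eq, restrict_T2]
  have : (fun q : ℝ × ℝ => (((1:ℝ)) : ℂ) * (starRingEnd ℂ) (e2 i q)) = fun q => ex (-i.1) q.1 * ex (-i.2) q.2 := by
    ext q
    rw [e2_conj, e2]; simp
  rw [this, integral_prod_mul (fun x => ex (-i.1) x) (fun y => ex (-i.2) y), ex_int, ex_int]
  obtain ⟨a, b⟩ := i
  have hpi : (Real.pi : ℂ) ≠ 0 := by exact_mod_cast Real.pi_ne_zero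
  by_cases ha : a = 0 <;> by_cases hb : b = 0 <;> simp [ha, hb]
  field_simp
  norm_num

lemma gN_one (N : ℕ) (p : ℝ × ℝ) : gN N (fun _ => 1) p = 1 := by
  have h := gN_TP N (fun _ => 1) (const_int 1) p
  unfold TP at h
  simp_rw [cf_one] at h
  rw [Finset.sum_eq_single (0 : ℤ × ℤ)] at h
  · simp [phi, e2, ex_zero] at h
    exact_mod_cast h.symm
  · intro b _ hb; simp [hb]
  · intro hh; exfalso; apply hh; simp [bx]

lemma Kn_integral (N : ℕ) (p : ℝ × ℝ) : ∫ q in T2, Kn N p q = 4 * Real.pi ^ 2 := by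
  have h := gN_one N p
  unfold gN at h
  simp only [one_mul] at h
  have := Real.pi_pos
  field_simp at h
  linarith

lemma mulK_int (N : ℕ) (g : ℝ × ℝ → ℝ) (hg : IntegrableOn g T2) (p : ℝ × ℝ) :
    IntegrableOn (fun q => g q * Kn N p q) T2 := by
  refine Integrable.mul_bdd (c := ((N : ℝ) + 1) * ((N : ℝ) + 1)) hg ?_ ?_
  · exact ((Kn_cont N).comp (Continuous.prodMk continuous_const continuous_id)).aestronglyMeasurable
  · exact Eventually.of_forall fun q => Kn_bdd _ _ _

lemma K_int (N : ℕ) (p : ℝ × ℝ) : IntegrableOn (fun q => Kn N p q) T2 := by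
  have := mulK_int N (fun _ => 1) (const_int 1) p
  simpa using this

lemma gN_ge (N : ℕ) (g : ℝ × ℝ → ℝ) (hg : IntegrableOn g T2) (h1 : ∀ p, 1 ≤ g p) (p : ℝ × ℝ) : 1 ≤ gN N g p := by
  rw [← gN_one N p]
  unfold gN
  gcongr
  · exact mulK_int N _ (const_int 1) p
  · exact mulK_int N _ hg p
  · exact (measurableSet_T1.prod measurableSet_T1).nullMeasurableSet
  · exact Kn_nonneg _ _ _
  · exact h1 _

lemma Th_tan (a b : ℝ) (ha : 1 ≤ a) (hb : 1 ≤ b) : Th a + (Real.log (1 + a) + 1) * (b - a) ≤ Th b := by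
  unfold Th
  have h := Real.log_le_sub_one_of_pos (x := (1 + a) / (1 + b)) (by positivity)
  rw [Real.log_div (by positivity) (by positivity)] at h
  have h2 : (1 + b) * (Real.log (1 + a) - Real.log (1 + b)) ≤ (1 + b) * ((1 + a) / (1 + b) - 1) := by
    gcongr
  have h3 : (1 + b) * ((1 + a) / (1 + b) - 1) = a - b := by
    field_simp; ring
  rw [h3] at h2
  nlinarith

lemma jensen (N : ℕ) (g : ℝ × ℝ → ℝ) (hg : IntegrableOn g T2) (h1 : ∀ p, 1 ≤ g p)
    (hT : IntegrableOn (fun q => Th (g q)) T2) (p : ℝ × ℝ) :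
    Th (gN N g p) ≤ (1 / (4 * Real.pi ^ 2)) * ∫ q in T2, Th (g q) * Kn N p q := by
  set a := gN N g p with ha
  have ha1 : 1 ≤ a := gN_ge N g hg h1 p
  have hpi := Real.pi_pos
  have e1 : ∫ q in T2, g q * Kn N p q = 4 * Real.pi ^ 2 * a := by
    rw [ha, gN]; field_simp
  have e2 := Kn_integral N p
  set L := Real.log (1 + a) + 1
  have i1 := mulK_int N g hg p
  have i2 := K_int N p
  have i3 : IntegrableOn (fun q => L * (g q * Kn N p q)) T2 := i1.const_mul L
  have i4 : IntegrableOn (fun q => (Th a - L * a) * Kn N p q) T2 := i2.const_mul _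
  have i5 : IntegrableOn (fun q => L * (g q * Kn N p q) + (Th a - L * a) * Kn N p q) T2 := i3.add i4
  have h : ∫ q in T2, (L * (g q * Kn N p q) + (Th a - L * a) * Kn N p q) ≤ ∫ q in T2, Th (g q) * Kn N p q := by
    refine integral_mono i5 (mulK_int N _ hT p) fun q => ?_
    have t := mul_le_mul_of_nonneg_right (Th_tan a (g q) ha1 (h1 q)) (Kn_nonneg N p q)
    simp only
    refine le_trans (le_of_eq ?_) t
    ring
  rw [integral_add i3 i4, integral_const_mul, integral_const_mul, e1, e2] at h
  have : Th a = (1 / (4 * Real.pi ^ 2)) * (L * (4 * Real.pi ^ 2 * a) + (Th a - L * a) * (4 * Real.pi ^ 2)) := by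
    field_simp; ring
  rw [this]
  gcongr

lemma jensen_int (N : ℕ) (g : ℝ × ℝ → ℝ) (hm : Measurable g) (hg : IntegrableOn g T2) (h1 : ∀ p, 1 ≤ g p)
    (hT : IntegrableOn (fun q => Th (g q)) T2) :
    ∫⁻ p in T2, ENNReal.ofReal (Th (gN N g p)) ≤ ∫⁻ p in T2, ENNReal.ofReal (Th (g p)) := by
  have hpi := Real.pi_pos
  have hTh0 : ∀ q, 0 ≤ Th (g q) := fun q => Th_nonneg _ (by linarith [h1 q])
  have hmT : Measurable (fun q => Th (g q)) := by
    unfold Th; fun_prop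
  have hK := (Kn_cont N).measurable
  have s1 : ∀ p, ENNReal.ofReal (Th (gN N g p)) ≤ ENNReal.ofReal (1 / (4 * Real.pi ^ 2)) *
      ∫⁻ q in T2, ENNReal.ofReal (Th (g q)) * ENNReal.ofReal (Kn N p q) := by
    intro p
    refine (ENNReal.ofReal_le_ofReal (jensen N g hg h1 hT p)).trans ?_
    rw [ENNReal.ofReal_mul (by positivity), ofReal_integral_eq_lintegral_ofReal (mulK_int N _ hT p)
      (Eventually.of_forall fun q => mul_nonneg (hTh0 q) (Kn_nonneg _ _ _))]
    gcongr with q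
    rw [ENNReal.ofReal_mul (hTh0 q)]
  have s2 : ∀ q, ∫⁻ p in T2, ENNReal.ofReal (Kn N p q) = ENNReal.ofReal (4 * Real.pi ^ 2) := by
    intro q
    simp_rw [fun p => Kn_symm N p q]
    rw [← ofReal_integral_eq_lintegral_ofReal (K_int N q) (Eventually.of_forall fun p => Kn_nonneg _ _ _), Kn_integral]
  have hF : Measurable (fun z : (ℝ × ℝ) × (ℝ × ℝ) => ENNReal.ofReal (Th (g z.2)) * ENNReal.ofReal (Kn N z.1 z.2)) :=
    ((hmT.comp measurable_snd).ennreal_ofReal).mul hK.ennreal_ofReal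
  have := T2_fin
  calc ∫⁻ p in T2, ENNReal.ofReal (Th (gN N g p))
      ≤ ∫⁻ p in T2, ENNReal.ofReal (1 / (4 * Real.pi ^ 2)) *
          ∫⁻ q in T2, ENNReal.ofReal (Th (g q)) * ENNReal.ofReal (Kn N p q) := lintegral_mono s1
    _ = ENNReal.ofReal (1 / (4 * Real.pi ^ 2)) * ∫⁻ p in T2,
          ∫⁻ q in T2, ENNReal.ofReal (Th (g q)) * ENNReal.ofReal (Kn N p q) :=
        lintegral_const_mul' _ _ ENNReal.ofReal_ne_top
    _ = ENNReal.ofReal (1 / (4 * Real.pi ^ 2)) * ∫⁻ q in T2,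
          ∫⁻ p in T2, ENNReal.ofReal (Th (g q)) * ENNReal.ofReal (Kn N p q) := by
        rw [lintegral_lintegral_swap hF.aemeasurable]
    _ = ENNReal.ofReal (1 / (4 * Real.pi ^ 2)) * ∫⁻ q in T2,
          ENNReal.ofReal (4 * Real.pi ^ 2) * ENNReal.ofReal (Th (g q)) := by
        congr 1
        refine lintegral_congr fun q => ?_
        rw [lintegral_const_mul' _ _ ENNReal.ofReal_ne_top, s2, mul_comm]
    _ = ∫⁻ p in T2, ENNReal.ofReal (Th (g p)) := by
        rw [lintegral_const_mul' _ _ ENNReal.ofReal_ne_top, ← mul_assoc, ← ENNReal.ofReal_mul (by positivity)]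
        have : 1 / (4 * Real.pi ^ 2) * (4 * Real.pi ^ 2) = 1 := by field_simp
        rw [this, ENNReal.ofReal_one, one_mul]

def SC (g : ℝ × ℝ → ℝ) (n : ℕ) (p : ℝ × ℝ) : ℂ := ∑ i ∈ bx n, cf g i * e2 i p

lemma Snn_SC (g : ℝ × ℝ → ℝ) (n : ℕ) (x y : ℝ) : Snn g n x y = (SC g n (x, y)).re := by
  unfold Snn SC bx
  rw [Finset.sum_product]
  congr 1
  refine Finset.sum_congr rfl fun m _ => Finset.sum_congr rfl fun k _ => ?_
  rw [cf, e2, ex, ex, ← Complex.exp_add, mul_add]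

def cN (N : ℕ) (g : ℝ × ℝ → ℝ) (i : ℤ × ℤ) : ℂ := ((phi N i.1 * phi N i.2 : ℝ) : ℂ) * cf g i

lemma phi_lim (m : ℤ) : Tendsto (fun N : ℕ => phi N m) atTop (nhds 1) := by
  unfold phi
  have h : Tendsto (fun N : ℕ => |(m : ℝ)| * (1 / ((N : ℝ) + 1))) atTop (nhds (|(m : ℝ)| * 0)) :=
    tendsto_one_div_add_atTop_nhds_zero_nat.const_mul _
  have h2 := h.const_sub 1
  simpa [div_eq_mul_inv] using h2

lemma Sq_lim (g : ℝ × ℝ → ℝ) (n : ℕ) (p : ℝ × ℝ) :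
    Tendsto (fun N : ℕ => Sq (bx N) (cN N g) n p) atTop (nhds (SC g n p)) := by
  have h1 : Tendsto (fun N : ℕ => ∑ i ∈ bx n, cN N g i * e2 i p) atTop (nhds (SC g n p)) := by
    unfold SC
    refine tendsto_finsetSum _ fun i _ => ?_
    refine Tendsto.mul_const _ ?_
    unfold cN
    have h2 : Tendsto (fun N : ℕ => phi N i.1 * phi N i.2) atTop (nhds (1 * 1)) := (phi_lim i.1).mul (phi_lim i.2)
    have h3 := (Complex.continuous_ofReal.tendsto _).comp h2
    have h4 := h3.mul_const (cf g i)
    simpa using h4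
  refine h1.congr' ?_
  filter_upwards [eventually_ge_atTop n] with N hN
  unfold Sq TP
  have hsub : bx n ⊆ bx N := by
    intro i hi
    simp only [bx, Finset.mem_product, Finset.mem_Icc] at hi ⊢
    omega
  rw [← Finset.sum_subset hsub]
  · refine Finset.sum_congr rfl fun i hi => ?_
    simp only [bx, Finset.mem_product, Finset.mem_Icc] at hi
    beta_reduce
    rw [if_pos ⟨abs_le.2 ⟨hi.1.1, hi.1.2⟩, abs_le.2 ⟨hi.2.1, hi.2.2⟩⟩]
  · intro i _ hi
    beta_reduce
    rw [if_neg, zero_mul]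
    intro h
    apply hi
    simp only [bx, Finset.mem_product, Finset.mem_Icc]
    exact ⟨abs_le.1 h.1, abs_le.1 h.2⟩

lemma Bad_lim (n0 : ℕ) (κ : ℝ) (ξ : ℕ → ℂ) (ζ : ℕ → ℕ → ℂ) (hζ : ∀ k, Tendsto (fun N => ζ N k) atTop (nhds (ξ k)))
    (h : Bad n0 κ ξ) : ∀ᶠ N in atTop, Bad n0 κ (ζ N) := by
  rcases h with ⟨a, M, h1, h2, h3⟩ | ⟨n, h1, h2⟩
  · have : Tendsto (fun N => ∑ i ∈ Finset.range M, ∑ j ∈ Finset.range M, ‖ζ N (a + i) - ζ N (a + j)‖) atTop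
        (nhds (∑ i ∈ Finset.range M, ∑ j ∈ Finset.range M, ‖ξ (a + i) - ξ (a + j)‖)) :=
      tendsto_finsetSum _ fun i _ => tendsto_finsetSum _ fun j _ => ((hζ _).sub (hζ _)).norm
    filter_upwards [this.eventually_const_lt h3] with N hN
    exact Or.inl ⟨a, M, h1, h2, hN⟩
  · have : Tendsto (fun N => ‖∑ k ∈ Finset.range (n + 1), ζ N k‖) atTop
        (nhds (‖∑ k ∈ Finset.range (n + 1), ξ k‖)) :=
      (tendsto_finsetSum _ fun i _ => hζ _).norm
    filter_upwards [this.eventually_const_lt h2] with N hN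
    exact Or.inr ⟨n, h1, hN⟩

lemma Bad_split (n0 : ℕ) (κ l : ℝ) (hl : 0 < l) (A B : ℕ → ℂ)
    (h : Bad n0 (l * (2 * κ)) (fun k => (((l * (A k - B k) : ℂ).re : ℝ) : ℂ))) : Bad n0 κ A ∨ Bad n0 κ B := by
  have key : ∀ z w : ℂ, ‖(((l * (z - w) : ℂ).re : ℝ) : ℂ)‖ ≤ l * (‖z‖ + ‖w‖) := by
    intro z w
    rw [Complex.norm_real, Real.norm_eq_abs]
    refine (Complex.abs_re_le_norm _).trans ?_
    rw [norm_mul, Complex.norm_real, Real.norm_of_nonneg hl.le]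
    gcongr
    exact norm_sub_le _ _
  rcases h with ⟨a, M, h1, h2, h3⟩ | ⟨n, h1, h2⟩
  · by_contra hc
    push Not at hc
    obtain ⟨hA, hB⟩ := hc
    have hA' : ¬ (κ * M ^ 2 < ∑ i ∈ Finset.range M, ∑ j ∈ Finset.range M, ‖A (a + i) - A (a + j)‖) :=
      fun hh => hA (Or.inl ⟨a, M, h1, h2, hh⟩)
    have hB' : ¬ (κ * M ^ 2 < ∑ i ∈ Finset.range M, ∑ j ∈ Finset.range M, ‖B (a + i) - B (a + j)‖) :=
      fun hh => hB (Or.inl ⟨a, M, h1, h2, hh⟩)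
    push Not at hA' hB'
    have h4 : ∑ i ∈ Finset.range M, ∑ j ∈ Finset.range M, ‖((((l * (A (a + i) - B (a + i)) : ℂ).re : ℝ) : ℂ)) - (((l * (A (a + j) - B (a + j)) : ℂ).re : ℝ) : ℂ)‖
        ≤ ∑ i ∈ Finset.range M, ∑ j ∈ Finset.range M, l * (‖A (a + i) - A (a + j)‖ + ‖B (a + i) - B (a + j)‖) := by
      refine Finset.sum_le_sum fun i _ => Finset.sum_le_sum fun j _ => ?_
      refine le_trans (le_of_eq ?_) (key _ _)
      rw [← Complex.ofReal_sub, ← Complex.sub_re]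
      congr 3
      ring
    simp only [← Finset.mul_sum, Finset.sum_add_distrib] at h4
    have h5 := h3.trans_le h4
    have h6 : l * (∑ i ∈ Finset.range M, ∑ j ∈ Finset.range M, ‖A (a + i) - A (a + j)‖ + ∑ i ∈ Finset.range M, ∑ j ∈ Finset.range M, ‖B (a + i) - B (a + j)‖) ≤ l * (κ * M ^ 2 + κ * M ^ 2) := by
      gcongr
    linarith
  · by_contra hc
    push Not at hc
    obtain ⟨hA, hB⟩ := hc
    have hA' : ¬ (κ * ((n : ℝ) + 1) < ‖∑ k ∈ Finset.range (n + 1), A k‖) :=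
      fun hh => hA (Or.inr ⟨n, h1, hh⟩)
    have hB' : ¬ (κ * ((n : ℝ) + 1) < ‖∑ k ∈ Finset.range (n + 1), B k‖) :=
      fun hh => hB (Or.inr ⟨n, h1, hh⟩)
    push Not at hA' hB'
    have h4 : ‖∑ k ∈ Finset.range (n + 1), (((l * (A k - B k) : ℂ).re : ℝ) : ℂ)‖ ≤ l * (‖∑ k ∈ Finset.range (n + 1), A k‖ + ‖∑ k ∈ Finset.range (n + 1), B k‖) := by
      refine le_trans (le_of_eq ?_) (key _ _)
      rw [← Complex.ofReal_sum, ← Complex.re_sum, ← Finset.mul_sum, Finset.sum_sub_distrib]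
    have h5 := h2.trans_le h4
    have h6 : l * (‖∑ k ∈ Finset.range (n + 1), A k‖ + ‖∑ k ∈ Finset.range (n + 1), B k‖) ≤ l * (κ * ((n : ℝ) + 1) + κ * ((n : ℝ) + 1)) := by
      gcongr
    linarith

/-- the weak-type estimate for a single function `g ≥ 1` -/
lemma main_fun (g : ℝ × ℝ → ℝ) (hm : Measurable g) (hg : IntegrableOn g T2) (h1 : ∀ p, 1 ≤ g p)
    (hT : IntegrableOn (fun q => Th (g q)) T2) (lam : ℝ) (hlam : 0 < lam) (n0 : ℕ) :
    ENNReal.ofReal lam * volume (T2 ∩ {p | Bad n0 (263 * lam) (fun n => SC g n p)})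
      ≤ 3136 * ∫⁻ p in T2, ENNReal.ofReal (Th (g p)) := by
  have hN : ∀ N, ENNReal.ofReal lam * volume (T2 ∩ {p | Bad n0 (263 * lam) (fun n => Sq (bx N) (cN N g) n p)})
      ≤ 3136 * ∫⁻ p in T2, ENNReal.ofReal (Th (g p)) := by
    intro N
    refine (main_poly (bx N) ?_ (cN N g) ?_ (gN N g) (gN_TP N g hg) (gN_ge N g hg h1) lam hlam n0).trans ?_
    · intro i hi
      simp only [bx, Finset.mem_product, Finset.mem_Icc, Prod.fst_neg, Prod.snd_neg] at hi ⊢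
      omega
    · intro i
      unfold cN
      rw [cf_conj, map_mul, Complex.conj_ofReal]
      simp [phi]
    · gcongr 3136 * ?_
      exact jensen_int N g hm hg h1 hT
  set E : ℕ → Set (ℝ × ℝ) := fun N => T2 ∩ {p | Bad n0 (263 * lam) (fun n => Sq (bx N) (cN N g) n p)}
  have hsub : T2 ∩ {p | Bad n0 (263 * lam) (fun n => SC g n p)} ⊆ ⋃ N0, ⋂ N ≥ N0, E N := by
    rintro p ⟨hp, hb⟩
    have := Bad_lim n0 (263 * lam) (fun n => SC g n p) (fun N n => Sq (bx N) (cN N g) n p) (fun k => Sq_lim g k p) hb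
    obtain ⟨N0, h⟩ := eventually_atTop.1 this
    exact mem_iUnion.2 ⟨N0, mem_iInter₂.2 fun N hN => ⟨hp, h N hN⟩⟩
  have hmono : Monotone (fun N0 => ⋂ N ≥ N0, E N) := by
    intro a b hab x hx
    refine mem_iInter₂.2 fun N hN => mem_iInter₂.1 hx N (le_trans hab hN)
  calc _ ≤ ENNReal.ofReal lam * volume (⋃ N0, ⋂ N ≥ N0, E N) := by gcongr
    _ = ⨆ N0, ENNReal.ofReal lam * volume (⋂ N ≥ N0, E N) := by
        rw [hmono.measure_iUnion, ENNReal.mul_iSup]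
    _ ≤ _ := iSup_le fun N0 => by
        refine le_trans ?_ (hN N0)
        gcongr
        exact iInter₂_subset N0 le_rfl

lemma Th_mono (a b : ℝ) (ha : 0 ≤ a) (h : a ≤ b) : Th a ≤ Th b := by
  unfold Th
  have : 0 ≤ Real.log (1 + a) := Real.log_nonneg (by linarith)
  have : Real.log (1 + a) ≤ Real.log (1 + b) := Real.log_le_log (by linarith) (by linarith)
  have : 0 ≤ 1 + b := by linarith
  gcongr

lemma Phi_nonneg (t : ℝ) (ht : 0 ≤ t) : 0 ≤ PhiY t := by
  unfold PhiY logPlus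
  split_ifs with h
  · exact mul_nonneg ht (Real.log_nonneg h.le)
  · simp

lemma Th_Phi (t : ℝ) (ht : 0 ≤ t) : Th (1 + t) ≤ 12 + 4 * PhiY t := by
  by_cases h : t ≤ 2
  · have h1 := Th_mono (1 + t) 3 (by linarith) (by linarith)
    have h2 : Th 3 ≤ 12 := by
      unfold Th
      have := Real.log_le_sub_one_of_pos (x := (1 + 3 : ℝ)) (by norm_num)
      linarith
    linarith [Phi_nonneg t ht]
  · push Not at h
    unfold PhiY logPlus Th
    rw [if_pos (by linarith)]
    have h1 : Real.log (1 + (1 + t)) ≤ 2 * Real.log t := by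
      rw [show 2 * Real.log t = Real.log (t ^ 2) by rw [Real.log_pow]; norm_num]
      exact Real.log_le_log (by linarith) (by nlinarith)
    have h0 : 0 ≤ Real.log t := Real.log_nonneg (by linarith)
    calc (1 + (1 + t)) * Real.log (1 + (1 + t)) ≤ (1 + (1 + t)) * (2 * Real.log t) := by gcongr
      _ ≤ (2 * t) * (2 * Real.log t) := by gcongr; linarith
      _ ≤ _ := by linarith

lemma Th_bound (g F : ℝ × ℝ → ℝ) (h1 : ∀ p, 1 ≤ g p) (h2 : ∀ p, g p ≤ 1 + |F p|)
    (hF : ∫⁻ p, ENNReal.ofReal (PhiY (|F p|)) ∂(volume.restrict T2) ≤ 1) :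
    ∫⁻ p in T2, ENNReal.ofReal (Th (g p)) ≤ ENNReal.ofReal (48 * Real.pi ^ 2 + 4) := by
  calc ∫⁻ p in T2, ENNReal.ofReal (Th (g p)) ≤ ∫⁻ p in T2, (ENNReal.ofReal 12 + ENNReal.ofReal 4 * ENNReal.ofReal (PhiY (|F p|))) := by
        refine lintegral_mono fun p => ?_
        rw [← ENNReal.ofReal_mul (by norm_num), ← ENNReal.ofReal_add (by norm_num) (by have := Phi_nonneg _ (abs_nonneg (F p)); positivity)]
        exact ENNReal.ofReal_le_ofReal ((Th_mono _ _ (by linarith [h1 p]) (h2 p)).trans (Th_Phi _ (abs_nonneg _)))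
    _ = ENNReal.ofReal 12 * volume T2 + ENNReal.ofReal 4 * ∫⁻ p in T2, ENNReal.ofReal (PhiY (|F p|)) := by
        rw [lintegral_add_left measurable_const, lintegral_const_mul' _ _ ENNReal.ofReal_ne_top]
        simp
    _ ≤ ENNReal.ofReal 12 * volume T2 + ENNReal.ofReal 4 * 1 := by gcongr
    _ = _ := by
        rw [vol_T2, mul_one, ← ENNReal.ofReal_mul (by norm_num), ← ENNReal.ofReal_add (by positivity) (by norm_num)]
        congr 1; ring

lemma Bad_mono (n m : ℕ) (h : n ≤ m) (κ : ℝ) (ξ : ℕ → ℂ) (hb : Bad n κ ξ) : Bad m κ ξ := by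
  rcases hb with ⟨a, M, h1, h2, h3⟩ | ⟨k, h1, h2⟩
  · exact Or.inl ⟨a, M, h1, by omega, h3⟩
  · exact Or.inr ⟨k, by omega, h2⟩

lemma single_bound (g F : ℝ × ℝ → ℝ) (hm : Measurable g) (hg : IntegrableOn g T2) (h1 : ∀ p, 1 ≤ g p)
    (h2 : ∀ p, g p ≤ 1 + |F p|)
    (hF : ∫⁻ p, ENNReal.ofReal (PhiY (|F p|)) ∂(volume.restrict T2) ≤ 1) (μ : ℝ) (hμ : 0 < μ) (n0 : ℕ) :
    volume (T2 ∩ {p | Bad n0 (263 * μ) (fun n => SC g n p)}) ≤ ENNReal.ofReal (3136 * (48 * Real.pi ^ 2 + 4) / μ) := by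
  have hb := Th_bound g F h1 h2 hF
  have hmT : Measurable (fun q => Th (g q)) := by
    unfold Th; fun_prop
  have hT : IntegrableOn (fun q => Th (g q)) T2 := by
    refine ⟨hmT.aestronglyMeasurable, ?_⟩
    rw [hasFiniteIntegral_iff_ofReal (Eventually.of_forall fun q => Th_nonneg _ (by linarith [h1 q]))]
    exact hb.trans_lt ENNReal.ofReal_lt_top
  have h := main_fun g hm hg h1 hT μ hμ n0
  rw [ENNReal.ofReal_div_of_pos hμ, ENNReal.le_div_iff_mul_le (Or.inl (by simpa using hμ)) (Or.inl ENNReal.ofReal_ne_top), mul_comm]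
  refine h.trans ?_
  rw [ENNReal.ofReal_mul (by norm_num)]
  gcongr
  simp

lemma SC_lin (f : ℝ × ℝ → ℝ) (A B : ℝ × ℝ → ℝ) (l : ℝ) (hA : IntegrableOn A T2) (hB : IntegrableOn B T2)
    (h : ∀ p, f p = l * (A p - B p)) (n : ℕ) (p : ℝ × ℝ) : SC f n p = l * (SC A n p - SC B n p) := by
  have hc : ∀ i, cf f i = l * (cf A i - cf B i) := by
    intro i
    rw [cf_eq, cf_eq, cf_eq, ← mul_sub, ← integral_sub (cf_int A hA i) (cf_int B hB i)]
    have : ∀ q, (f q : ℂ) * (starRingEnd ℂ) (e2 i q) = (l : ℂ) * ((A q : ℂ) * (starRingEnd ℂ) (e2 i q) - (B q : ℂ) * (starRingEnd ℂ) (e2 i q)) := by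
      intro q
      rw [h q]; push_cast; ring
    simp_rw [this]
    rw [integral_const_mul]
    ring
  unfold SC
  rw [← Finset.sum_sub_distrib, Finset.mul_sum]
  refine Finset.sum_congr rfl fun i _ => ?_
  rw [hc]; ring

/-- the absolute constant -/
def CC : ℝ := 2 * (3136 * (48 * Real.pi ^ 2 + 4)) * 5260

lemma CC_pos : 0 < CC := by unfold CC; positivity

lemma weak_G (f F A B : ℝ × ℝ → ℝ) (l lam μ : ℝ) (hl : 0 < l) (hμ : 0 < μ)
    (hF1 : ∫⁻ p, ENNReal.ofReal (PhiY (|F p|)) ∂(volume.restrict T2) ≤ 1)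
    (hAm : Measurable A) (hBm : Measurable B) (hAi : IntegrableOn A T2) (hBi : IntegrableOn B T2)
    (hA1 : ∀ p, 1 ≤ A p) (hB1 : ∀ p, 1 ≤ B p) (hA2 : ∀ p, A p ≤ 1 + |F p|) (hB2 : ∀ p, B p ≤ 1 + |F p|)
    (hfe : ∀ p, f p = l * (A p - B p)) (hlm : lam / 10 = l * (2 * (263 * μ))) (n0 : ℕ) :
    volume (T2 ∩ {p | Bad n0 (lam / 10) (fun n => ((Snn f n p.1 p.2 : ℝ) : ℂ))}) ≤
      ENNReal.ofReal (2 * (3136 * (48 * Real.pi ^ 2 + 4) / μ)) := by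
  have hs : T2 ∩ {p | Bad n0 (lam / 10) (fun n => ((Snn f n p.1 p.2 : ℝ) : ℂ))} ⊆ (T2 ∩ {p | Bad n0 (263 * μ) (fun n => SC A n p)}) ∪ (T2 ∩ {p | Bad n0 (263 * μ) (fun n => SC B n p)}) := by
    rintro p ⟨hp, hb⟩
    have hb' : Bad n0 (lam / 10) (fun n => ((Snn f n p.1 p.2 : ℝ) : ℂ)) := hb
    simp only [Snn_SC, SC_lin f A B l hAi hBi hfe] at hb'
    rw [hlm] at hb'
    rcases Bad_split n0 (263 * μ) l hl _ _ hb' with h | h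
    · exact Or.inl ⟨hp, h⟩
    · exact Or.inr ⟨hp, h⟩
  have hA := single_bound A F hAm hAi hA1 hA2 hF1 μ hμ n0
  have hB := single_bound B F hBm hBi hB1 hB2 hF1 μ hμ n0
  refine (measure_mono hs).trans ((measure_union_le _ _).trans ((add_le_add hA hB).trans (le_of_eq ?_)))
  rw [← ENNReal.ofReal_add (by positivity) (by positivity), ← two_mul]

lemma weak_U (f : ℝ × ℝ → ℝ) (lam : ℝ) (hlam : 0 < lam) (V : ENNReal)
    (hV : ∀ n0, volume (T2 ∩ {p | Bad n0 (lam / 10) (fun n => ((Snn f n p.1 p.2 : ℝ) : ℂ))}) ≤ V) :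
    volume {p : ℝ × ℝ | p ∈ T2 ∧ lam < bmoSeq (fun n => Snn f n p.1 p.2)} ≤ V := by
  have hsub : {p : ℝ × ℝ | p ∈ T2 ∧ lam < bmoSeq (fun n => Snn f n p.1 p.2)} ⊆
      ⋃ n0 : ℕ, (T2 ∩ {p | Bad n0 (lam / 10) (fun n => ((Snn f n p.1 p.2 : ℝ) : ℂ))}) := by
    rintro p ⟨hp, hb⟩
    obtain ⟨n, hn⟩ := exists_lt_of_lt_ciSup hb
    refine mem_iUnion.2 ⟨n, hp, ?_⟩
    by_contra hc
    have := bmo_of_not_bad n (lam / 10) (by positivity) (fun k => Snn f k p.1 p.2) hc n le_rfl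
    linarith
  have hmono : Monotone (fun n0 : ℕ => (T2 ∩ {p : ℝ × ℝ | Bad n0 (lam / 10) (fun n => ((Snn f n p.1 p.2 : ℝ) : ℂ))})) := by
    intro a b hab x hx
    have hb : Bad a (lam / 10) (fun n => ((Snn f n x.1 x.2 : ℝ) : ℂ)) := hx.2
    have hb2 : Bad b (lam / 10) (fun n => ((Snn f n x.1 x.2 : ℝ) : ℂ)) := Bad_mono a b hab _ _ hb
    have h1 : x ∈ T2 := hx.1
    have h2 : x ∈ {p : ℝ × ℝ | Bad b (lam / 10) (fun n => ((Snn f n p.1 p.2 : ℝ) : ℂ))} := hb2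
    exact mem_inter h1 h2
  refine (measure_mono hsub).trans ?_
  rw [hmono.measure_iUnion]
  exact iSup_le hV

lemma weak_lam0 (f : ℝ × ℝ → ℝ) (hm : Measurable f) (hf : IntegrableOn f T2) (l : ℝ) (hl : 0 < l)
    (hl1 : ∫⁻ p, ENNReal.ofReal (PhiY (|f p| / l)) ∂(volume.restrict T2) ≤ 1) (lam : ℝ) (hlam : 0 < lam) :
    volume {p : ℝ × ℝ | p ∈ T2 ∧ lam < bmoSeq (fun n => Snn f n p.1 p.2)} ≤ ENNReal.ofReal (CC * l / lam) := by
  obtain ⟨F, hFdef⟩ : ∃ F : ℝ × ℝ → ℝ, F = fun p => f p / l := ⟨_, rfl⟩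
  have hFm : Measurable F := by rw [hFdef]; exact hm.div_const l
  have hFi : IntegrableOn F T2 := by rw [hFdef]; exact hf.div_const l
  have hF1 : ∫⁻ p, ENNReal.ofReal (PhiY (|F p|)) ∂(volume.restrict T2) ≤ 1 := by
    simp only [hFdef, abs_div, abs_of_pos hl]
    exact hl1
  have hA1 : ∀ p, 1 ≤ 1 + max (F p) 0 := fun p => by linarith [le_max_right (F p) 0]
  have hB1 : ∀ p, 1 ≤ 1 + max (-F p) 0 := fun p => by linarith [le_max_right (-F p) 0]
  have hA2 : ∀ p, 1 + max (F p) 0 ≤ 1 + |F p| := fun p => by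
    have := max_le (le_abs_self (F p)) (abs_nonneg (F p))
    linarith
  have hB2 : ∀ p, 1 + max (-F p) 0 ≤ 1 + |F p| := fun p => by
    have := max_le (neg_le_abs (F p)) (abs_nonneg (F p))
    linarith
  have hfe : ∀ p, f p = l * ((1 + max (F p) 0) - (1 + max (-F p) 0)) := by
    intro p
    have : (1 + max (F p) 0) - (1 + max (-F p) 0) = F p := by
      rcases le_total (F p) 0 with h | h
      · rw [max_eq_right h, max_eq_left (by linarith)]; ring
      · rw [max_eq_left h, max_eq_right (by linarith)]; ring
    rw [this, hFdef]; field_simp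
  have hμ : 0 < lam / (5260 * l) := by positivity
  have hlm : lam / 10 = l * (2 * (263 * (lam / (5260 * l)))) := by
    field_simp; norm_num
  have hC : 2 * (3136 * (48 * Real.pi ^ 2 + 4) / (lam / (5260 * l))) = CC * l / lam := by
    unfold CC
    field_simp
  rw [← hC]
  refine weak_U f lam hlam _ fun n0 => ?_
  exact weak_G f F (fun p => 1 + max (F p) 0) (fun p => 1 + max (-F p) 0) l lam (lam / (5260 * l)) hl hμ hF1
    (measurable_const.add (hFm.max measurable_const)) (measurable_const.add (hFm.neg.max measurable_const))
    ((const_int 1).add hFi.pos_part) ((const_int 1).add hFi.neg_part) hA1 hB1 hA2 hB2 hfe hlm n0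

/-- there is an absolute constant `c > 0` such that for every measurable
`2π`-biperiodic `f` with finite Luxemburg norm `‖f‖_(Φ)`, `Φ(t) = t log⁺ t`, and every
`λ > 0`, `|{(x,y) ∈ 𝕋² : bmo[S_{nn}(x,y,f)] > λ}| ≤ c ‖f‖_(Φ) / λ`. -/
theorem bmo_weak_type_luxemburg :
    ∃ c : ℝ, 0 < c ∧ ∀ f : ℝ × ℝ → ℝ, Measurable f → Biperiodic f →
      IntegrableOn f T2 →
      {lam : ℝ | 0 < lam ∧
          ∫⁻ p, ENNReal.ofReal (PhiY (|f p| / lam)) ∂(volume.restrict T2) ≤ 1}.Nonempty →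
      ∀ lam : ℝ, 0 < lam →
        volume {p : ℝ × ℝ | p ∈ T2 ∧ lam < bmoSeq (fun n => Snn f n p.1 p.2)} ≤
          ENNReal.ofReal (c * luxNorm (volume.restrict T2) PhiY f / lam) := by
  refine ⟨CC, CC_pos, fun f hm _ hf hne lam hlam => ?_⟩
  set S := {lam : ℝ | 0 < lam ∧
          ∫⁻ p, ENNReal.ofReal (PhiY (|f p| / lam)) ∂(volume.restrict T2) ≤ 1} with hS
  have hlux : luxNorm (volume.restrict T2) PhiY f = sInf S := rfl
  rw [hlux]
  refine ENNReal.le_of_forall_pos_le_add fun ε hε _ => ?_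
  have hC := CC_pos
  have hpos : sInf S < sInf S + ε * lam / CC := by
    have : (0:ℝ) < ε := hε
    have : 0 < ε * lam / CC := by positivity
    linarith
  obtain ⟨l, hl, hlt⟩ := exists_lt_of_csInf_lt hne hpos
  have h0 : 0 ≤ sInf S := Real.sInf_nonneg fun x hx => hx.1.le
  refine (weak_lam0 f hm hf l hl.1 hl.2 lam hlam).trans ?_
  rw [← ENNReal.ofReal_coe_nnreal, ← ENNReal.ofReal_add (by positivity) (by positivity)]
  refine ENNReal.ofReal_le_ofReal ?_
  calc CC * l / lam ≤ CC * (sInf S + ε * lam / CC) / lam := by gcongr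
    _ = CC * sInf S / lam + ε := by field_simp
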